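/- arXiv:1212.2096 — 2 statements merged into one kernel-verified Lean document; each statement's English description precedes it below -/
import Mathlib

section
/- Let ψ(t)=t^{−δ}e^{−αt^r} with δ≥0, α>0, r>0, let β∈ℝ, and let ω be a convex modulus of continuity. Then there exist a constant K>0 (depending only on δ, α, r) and n₀∈ℕ such that for all n≥n₀: |E_n(L^ψ_β H_{ω_{L₁}})_{L₁} − (2/π)·ψ(n)·e_n(ω)| ≤ K·ψ(n)·γ_n(α,r)·ω(1/n), where γ_n(α,r) = 1/(rαn^r) if 0<r<1, γ_n(α,r) = (1+1/α)e^{−α}/n if r=1, and γ_n(α,r) = e^{−αrn^{r−1}}/n if r>1. -/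
open Real MeasureTheory Filter

noncomputable section

/-- `ω` is a modulus of continuity: continuous, nondecreasing, subadditive on `[0,∞)`,
nonnegative, and `ω 0 = 0`. -/
def IsModulus (ω : ℝ → ℝ) : Prop :=
  ContinuousOn ω (Set.Ici 0) ∧ MonotoneOn ω (Set.Ici 0) ∧
  (∀ s t : ℝ, 0 ≤ s → 0 ≤ t → ω (s + t) ≤ ω s + ω t) ∧ ω 0 = 0 ∧
  ∀ t : ℝ, 0 ≤ t → 0 ≤ ω t


/-- `T` is a trigonometric polynomial of degree at most `n − 1`. -/
def IsTrigPoly (n : ℕ) (T : ℝ → ℝ) : Prop :=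
  ∃ a b : ℕ → ℝ,
    ∀ x, T x = ∑ k ∈ Finset.range n, (a k * Real.cos (k * x) + b k * Real.sin (k * x))

/-- The kernel `Ψ_β(t) = ∑_{k=1}^∞ ψ(k) cos(kt − βπ/2)`. -/
def PsiKer (ψ : ℝ → ℝ) (β : ℝ) (t : ℝ) : ℝ :=
  ∑' k : ℕ, ψ (k + 1) * Real.cos ((k + 1) * t - β * π / 2)

/-- The class `L^ψ_β H_{ω_{L₁}}`. -/
def L1Class (ψ : ℝ → ℝ) (β : ℝ) (ω : ℝ → ℝ) : Set (ℝ → ℝ) :=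
  {f | IntervalIntegrable f volume (-π) π ∧ Function.Periodic f (2 * π) ∧
    ∃ a₀ : ℝ, ∃ φ : ℝ → ℝ, IntervalIntegrable φ volume (-π) π ∧
      Function.Periodic φ (2 * π) ∧
      (∫ t in (-π)..π, φ t) = 0 ∧
      (∀ t : ℝ, 0 ≤ t → ∀ h : ℝ, |h| ≤ t →
        (∫ x in (-π)..π, |φ (x + h) - φ x|) ≤ ω t) ∧
      ∀ᵐ x : ℝ, f x = a₀ / 2 + (1 / π) * ∫ t in (-π)..π, φ (x - t) * PsiKer ψ β t}

/-- Best `L₁` approximation of `f` by trigonometric polynomials of degree `≤ n − 1`. -/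
def EnL1 (n : ℕ) (f : ℝ → ℝ) : ℝ :=
  sInf {e | ∃ T : ℝ → ℝ, IsTrigPoly n T ∧ e = ∫ x in (-π)..π, |f x - T x|}

/-- Best `L₁` approximation of a class of functions. -/
def EnL1Class (n : ℕ) (N : Set (ℝ → ℝ)) : ℝ := sSup (EnL1 n '' N)

/-- `e_n(ω) = ∫_0^{π/2} ω(2t/n) sin t dt`. -/
def eN (n : ℕ) (ω : ℝ → ℝ) : ℝ := ∫ t in (0:ℝ)..(π / 2), ω (2 * t / n) * Real.sin t


/-- `γ_n(α,r)` from Corollary 1. -/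
def gammaAR (α r : ℝ) (n : ℕ) : ℝ :=
  if r < 1 then 1 / (r * α * (n : ℝ) ^ r)
  else if r = 1 then (1 + 1 / α) * Real.exp (-α) / n
  else Real.exp (-α * r * (n : ℝ) ^ (r - 1)) / n

/-- `ψ(t) = t^{−δ} e^{−α t^r}`. -/
def psiDAR (δ α r : ℝ) (t : ℝ) : ℝ := t ^ (-δ) * Real.exp (-α * t ^ r)


lemma IsTrigPoly.add {n : ℕ} {T U : ℝ → ℝ} (hT : IsTrigPoly n T) (hU : IsTrigPoly n U) :
    IsTrigPoly n (fun x => T x + U x) := by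
  obtain ⟨a, b, h⟩ := hT
  obtain ⟨c, d, h'⟩ := hU
  refine ⟨fun k => a k + c k, fun k => b k + d k, fun x => ?_⟩
  simp only []
  rw [h, h', ← Finset.sum_add_distrib]
  refine Finset.sum_congr rfl fun k _ => by ring

lemma IsTrigPoly.smul {n : ℕ} {T : ℝ → ℝ} (c : ℝ) (hT : IsTrigPoly n T) :
    IsTrigPoly n (fun x => c * T x) := by
  obtain ⟨a, b, h⟩ := hT
  refine ⟨fun k => c * a k, fun k => c * b k, fun x => ?_⟩
  simp only []
  rw [h, Finset.mul_sum]
  refine Finset.sum_congr rfl fun k _ => by ring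

lemma IsTrigPoly.sub {n : ℕ} {T U : ℝ → ℝ} (hT : IsTrigPoly n T) (hU : IsTrigPoly n U) :
    IsTrigPoly n (fun x => T x - U x) := by
  have := hT.add (hU.smul (-1))
  convert this using 2
  ring

lemma IsTrigPoly.zero (n : ℕ) : IsTrigPoly n (fun _ => 0) :=
  ⟨fun _ => 0, fun _ => 0, fun x => by simp⟩

lemma IsTrigPoly.sum {n : ℕ} {ι : Type*} (s : Finset ι) {T : ι → ℝ → ℝ}
    (hT : ∀ i ∈ s, IsTrigPoly n (T i)) : IsTrigPoly n (fun x => ∑ i ∈ s, T i x) := by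
  classical
  induction s using Finset.induction_on with
  | empty => simpa using IsTrigPoly.zero n
  | insert i s hi ih =>
    simp only [Finset.sum_insert hi]
    exact (hT i (Finset.mem_insert_self i s)).add
      (ih fun j hj => hT j (Finset.mem_insert_of_mem hj))

lemma IsTrigPoly.cosPhase {n k : ℕ} (hk : k < n) (θ : ℝ) :
    IsTrigPoly n (fun x => Real.cos (k * x + θ)) := by
  refine ⟨fun j => if j = k then Real.cos θ else 0, fun j => if j = k then -Real.sin θ else 0,
    fun x => ?_⟩
  rw [Finset.sum_eq_single k]
  · simp [Real.cos_add]; ring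
  · intro j _ hj; simp [hj]
  · intro h; simp at h; omega

lemma IsTrigPoly.cosPhaseInt {n : ℕ} {k : ℤ} (hk : k.natAbs < n) (θ : ℝ) :
    IsTrigPoly n (fun x => Real.cos (k * x + θ)) := by
  rcases Int.natAbs_eq k with h | h
  · have := IsTrigPoly.cosPhase hk θ
    rw [h]; simpa using this
  · have := IsTrigPoly.cosPhase hk (-θ)
    rw [h]
    convert this using 2 with x
    rw [← Real.cos_neg]
    push_cast
    congr 1
    simp
    ring

lemma IsTrigPoly.const {n : ℕ} (hn : 0 < n) (c : ℝ) : IsTrigPoly n (fun _ => c) := by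
  have := (IsTrigPoly.cosPhase hn 0).smul c
  simpa using this

lemma IsTrigPoly.continuous {n : ℕ} {T : ℝ → ℝ} (hT : IsTrigPoly n T) : Continuous T := by
  obtain ⟨a, b, h⟩ := hT
  rw [funext h]
  fun_prop

lemma IsTrigPoly.periodic {n : ℕ} {T : ℝ → ℝ} (hT : IsTrigPoly n T) :
    Function.Periodic T (2 * π) := by
  obtain ⟨a, b, h⟩ := hT
  intro x
  rw [h, h]
  refine Finset.sum_congr rfl fun k _ => ?_
  have h1 : (k:ℝ) * (x + 2 * π) = k * x + k * (2 * π) := by ring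
  rw [h1, Real.cos_add_nat_mul_two_pi, Real.sin_add_nat_mul_two_pi]

lemma IsTrigPoly.conv {n : ℕ} {U : ℝ → ℝ} (hU : IsTrigPoly n U) {w u : ℝ → ℝ} {c d : ℝ}
    (hw : IntervalIntegrable w volume c d) (hu : Continuous u) :
    IsTrigPoly n (fun x => ∫ s in c..d, w s * U (x - u s)) := by
  obtain ⟨a, b, h⟩ := hU
  refine ⟨fun k => ∫ s in c..d, w s * (a k * cos (k * u s) - b k * sin (k * u s)),
    fun k => ∫ s in c..d, w s * (a k * sin (k * u s) + b k * cos (k * u s)), fun x => ?_⟩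
  have e : ∀ s, w s * U (x - u s) = ∑ k ∈ Finset.range n,
      (w s * (a k * cos (k * u s) - b k * sin (k * u s)) * cos (k * x) +
        w s * (a k * sin (k * u s) + b k * cos (k * u s)) * sin (k * x)) := by
    intro s
    rw [h, Finset.mul_sum]
    refine Finset.sum_congr rfl fun k _ => ?_
    rw [mul_sub, Real.cos_sub, Real.sin_sub]; ring
  simp_rw [e]
  have i1 : ∀ k : ℕ, IntervalIntegrable
      (fun s => w s * (a k * cos (k * u s) - b k * sin (k * u s)) * cos (k * x)) volume c d := by
    intro k
    refine (hw.mul_continuousOn ?_).mul_const _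
    fun_prop
  have i2 : ∀ k : ℕ, IntervalIntegrable
      (fun s => w s * (a k * sin (k * u s) + b k * cos (k * u s)) * sin (k * x)) volume c d := by
    intro k
    refine (hw.mul_continuousOn ?_).mul_const _
    fun_prop
  rw [intervalIntegral.integral_finsetSum fun k _ => (i1 k).add (i2 k)]
  refine Finset.sum_congr rfl fun k _ => ?_
  rw [intervalIntegral.integral_add (i1 k) (i2 k), intervalIntegral.integral_mul_const,
    intervalIntegral.integral_mul_const]

/-- periodic integrable -/
def PI1 (φ : ℝ → ℝ) : Prop := Function.Periodic φ (2 * π) ∧ IntervalIntegrable φ volume (-π) π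

lemma PI1.ii {φ : ℝ → ℝ} (h : PI1 φ) (a b : ℝ) : IntervalIntegrable φ volume a b := by
  refine h.1.intervalIntegrable (t := -π) (by positivity) ?_ a b
  convert h.2 using 1; ring

lemma PI1.shift {φ : ℝ → ℝ} (h : PI1 φ) (c : ℝ) : PI1 (fun x => φ (x + c)) := by
  refine ⟨fun x => ?_, ?_⟩
  · have := h.1 (x + c)
    simp only [] at *
    rw [← this]; congr 1; ring
  · have := (h.ii (-π + c) (π + c)).comp_add_right c
    simpa using this

lemma PI1.neg_shift {φ : ℝ → ℝ} (h : PI1 φ) (c : ℝ) : PI1 (fun x => φ (c - x)) := by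
  refine ⟨fun x => ?_, ?_⟩
  · have := h.1 (c - x - 2 * π)
    simp only [] at *
    rw [← sub_sub, ← this]; congr 1; ring
  · have := (h.ii (c + π) (c - π)).comp_sub_left c
    simpa using this

lemma per_int_shift {g : ℝ → ℝ} (h : Function.Periodic g (2 * π)) (c : ℝ) :
    ∫ x in (-π)..π, g (x + c) = ∫ x in (-π)..π, g x := by
  rw [intervalIntegral.integral_comp_add_right]
  have := h.intervalIntegral_add_eq (-π + c) (-π)
  convert this using 2 <;> ring

lemma per_int_neg {g : ℝ → ℝ} (h : Function.Periodic g (2 * π)) (c : ℝ) :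
    ∫ x in (-π)..π, g (c - x) = ∫ x in (-π)..π, g x := by
  rw [intervalIntegral.integral_comp_sub_left]
  have := h.intervalIntegral_add_eq (c - π) (-π)
  convert this using 2 <;> ring

lemma PI1.aesm {φ : ℝ → ℝ} (h : PI1 φ) : AEStronglyMeasurable φ volume := by
  have : LocallyIntegrable φ volume := by
    rw [locallyIntegrable_iff]
    intro k hk
    obtain ⟨R, hR⟩ := hk.isBounded.subset_closedBall 0
    rw [Real.closedBall_eq_Icc] at hR
    rcases le_or_gt 0 R with h0 | h0
    · have := h.ii (0 - R) (0 + R)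
      rw [intervalIntegrable_iff_integrableOn_Icc_of_le (by linarith)] at this
      exact this.mono_set hR
    · have : Set.Icc (0 - R) (0 + R) = ∅ := Set.Icc_eq_empty (by linarith)
      rw [this, Set.subset_empty_iff] at hR
      simp [hR]
  exact this.aestronglyMeasurable

lemma PI1.add {φ χ : ℝ → ℝ} (h : PI1 φ) (h' : PI1 χ) : PI1 (fun x => φ x + χ x) :=
  ⟨h.1.add h'.1, h.2.add h'.2⟩

lemma PI1.sub {φ χ : ℝ → ℝ} (h : PI1 φ) (h' : PI1 χ) : PI1 (fun x => φ x - χ x) :=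
  ⟨h.1.sub h'.1, h.2.sub h'.2⟩

lemma PI1.absInt_shift {φ : ℝ → ℝ} (h : PI1 φ) (c : ℝ) :
    ∫ x in (-π)..π, |φ (x - c)| = ∫ x in (-π)..π, |φ x| := by
  have := per_int_shift (g := fun x => |φ x|) (fun x => by simp only []; rw [h.1 x]) (-c)
  simpa [sub_eq_add_neg] using this

lemma prodInt {φ : ℝ → ℝ} (h : PI1 φ) {w u : ℝ → ℝ} (hw : Continuous w) (hu : Continuous u)
    (c d : ℝ) : Integrable (fun p : ℝ × ℝ => w p.2 * φ (p.1 - u p.2))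
      ((volume.restrict (Set.Ioc (-π) π)).prod (volume.restrict (Set.Ioc c d))) := by
  have qmp : Measure.QuasiMeasurePreserving (fun p : ℝ × ℝ => p.1 - u p.2)
      (volume.prod volume) volume := by
    refine QuasiMeasurePreserving.prod_of_left (by fun_prop) (Eventually.of_forall fun y => ?_)
    exact (measurePreserving_sub_right volume (u y)).quasiMeasurePreserving
  have hm : AEStronglyMeasurable (fun p : ℝ × ℝ => w p.2 * φ (p.1 - u p.2))
      ((volume.restrict (Set.Ioc (-π) π)).prod (volume.restrict (Set.Ioc c d))) := by
    rw [Measure.prod_restrict]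
    refine AEStronglyMeasurable.restrict ?_
    refine AEStronglyMeasurable.mul (Continuous.aestronglyMeasurable (by fun_prop)) ?_
    exact h.aesm.comp_quasiMeasurePreserving qmp
  rw [integrable_prod_iff' hm]
  have hpi : -π ≤ π := by linarith [Real.pi_pos]
  constructor
  · refine Eventually.of_forall fun y => ?_
    have := (h.shift (-u y)).2
    rw [intervalIntegrable_iff_integrableOn_Ioc_of_le hpi] at this
    simp only [sub_eq_add_neg]
    exact Integrable.const_mul this _
  · have e : ∀ y, ∫ x in Set.Ioc (-π) π, ‖w y * φ (x - u y)‖ =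
        |w y| * ∫ x in (-π)..π, |φ x| := by
      intro y
      rw [← h.absInt_shift (u y), intervalIntegral.integral_of_le hpi, ← integral_const_mul]
      simp only [norm_mul, Real.norm_eq_abs]
    simp only [e]
    have : Continuous (fun y => |w y| * ∫ x in (-π)..π, |φ x|) := by fun_prop
    exact (this.integrableOn_Icc (a := c) (b := d)).mono_set Set.Ioc_subset_Icc_self

lemma minkowski {F : ℝ → ℝ → ℝ} {c d : ℝ} (hcd : c ≤ d)
    (hF : Integrable (fun p : ℝ × ℝ => F p.1 p.2)
      ((volume.restrict (Set.Ioc (-π) π)).prod (volume.restrict (Set.Ioc c d)))) {N : ℝ → ℝ}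
    (hN : ∀ s ∈ Set.Icc c d, ∫ x in (-π)..π, |F x s| ≤ N s)
    (hNi : IntervalIntegrable N volume c d) :
    IntervalIntegrable (fun x => ∫ s in c..d, F x s) volume (-π) π ∧
    ∫ x in (-π)..π, |∫ s in c..d, F x s| ≤ ∫ s in c..d, N s := by
  have hpi : -π ≤ π := by linarith [Real.pi_pos]
  simp only [intervalIntegral.integral_of_le hpi, intervalIntegral.integral_of_le hcd,
    intervalIntegrable_iff_integrableOn_Ioc_of_le hpi,
    intervalIntegrable_iff_integrableOn_Ioc_of_le hcd] at *
  refine ⟨hF.integral_prod_left, ?_⟩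
  calc ∫ x in Set.Ioc (-π) π, |∫ s in Set.Ioc c d, F x s|
      ≤ ∫ x in Set.Ioc (-π) π, ∫ s in Set.Ioc c d, |F x s| := by
        refine integral_mono hF.integral_prod_left.abs hF.abs.integral_prod_left fun x => ?_
        exact abs_integral_le_integral_abs
    _ = ∫ s in Set.Ioc c d, ∫ x in Set.Ioc (-π) π, |F x s| := by
        exact integral_integral_swap hF.abs
    _ ≤ ∫ s in Set.Ioc c d, N s := by
        refine setIntegral_mono_on hF.abs.integral_prod_right hNi measurableSet_Ioc ?_
        intro s hs
        exact hN s (Set.Ioc_subset_Icc_self hs)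


lemma int_cos_int (k : ℤ) (hk : k ≠ 0) : ∫ t in (-π)..π, cos (k * t) = 0 := by
  have hk' : (k:ℝ) ≠ 0 := by exact_mod_cast hk
  rw [intervalIntegral.integral_comp_mul_left (fun x => cos x) hk']
  simp [integral_cos, Real.sin_int_mul_pi]

/-- |∑ a_l e^{ilt}|² -/
def Kf (m : ℕ) (a : ℕ → ℝ) (t : ℝ) : ℝ :=
  (∑ l ∈ Finset.range m, a l * cos (l * t)) ^ 2 + (∑ l ∈ Finset.range m, a l * sin (l * t)) ^ 2

lemma Kf_nonneg (m a t) : 0 ≤ Kf m a t := by unfold Kf; positivity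

lemma Kf_cont (m a) : Continuous (Kf m a) := by unfold Kf; fun_prop

lemma Kf_eq (m a t) : Kf m a t = ∑ l ∈ Finset.range m, ∑ k ∈ Finset.range m,
    a l * a k * cos (((l - k : ℤ) : ℝ) * t + 0) := by
  unfold Kf
  rw [sq, sq, Finset.sum_mul_sum, Finset.sum_mul_sum, ← Finset.sum_add_distrib]
  refine Finset.sum_congr rfl fun l _ => ?_
  rw [← Finset.sum_add_distrib]
  refine Finset.sum_congr rfl fun k _ => ?_
  push_cast
  rw [add_zero, sub_mul, Real.cos_sub]; ring

lemma Kf_trig (m a) : IsTrigPoly m (Kf m a) := by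
  rw [funext (Kf_eq m a)]
  refine IsTrigPoly.sum _ fun l hl => IsTrigPoly.sum _ fun k hk => IsTrigPoly.smul _ ?_
  refine IsTrigPoly.cosPhaseInt ?_ 0
  simp at hl hk
  omega

lemma Kf_int (m a) : ∫ t in (-π)..π, Kf m a t = 2 * π * ∑ l ∈ Finset.range m, a l ^ 2 := by
  simp_rw [Kf_eq]
  rw [intervalIntegral.integral_finsetSum
    fun l _ => Continuous.intervalIntegrable (by fun_prop) _ _, Finset.mul_sum]
  refine Finset.sum_congr rfl fun l hl => ?_
  rw [intervalIntegral.integral_finsetSum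
    fun l _ => Continuous.intervalIntegrable (by fun_prop) _ _, Finset.sum_eq_single l]
  · simp; ring
  · intro k _ hk
    rw [intervalIntegral.integral_const_mul]
    simp only [add_zero]
    rw [int_cos_int _ (by omega), mul_zero]
  · intro h; exact absurd hl h

lemma Kf_diff (m : ℕ) (a : ℕ → ℝ) (ha : a m = 0) (t : ℝ) :
    2 * (1 - cos t) * Kf m a t =
      Kf (m + 1) (fun l => a l - if l = 0 then 0 else a (l - 1)) t := by
  have hc : ∑ l ∈ Finset.range (m + 1), (a l - if l = 0 then 0 else a (l - 1)) * cos (l * t) =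
      (∑ l ∈ Finset.range m, a l * cos (l * t)) -
        (∑ l ∈ Finset.range m, a l * cos (l * t)) * cos t +
        (∑ l ∈ Finset.range m, a l * sin (l * t)) * sin t := by
    simp only [sub_mul, Finset.sum_sub_distrib]
    rw [Finset.sum_range_succ, ha, Finset.sum_range_succ' (fun l => (if l = 0 then 0 else a (l-1)) * cos (l * t))]
    simp only [Nat.add_eq_zero_iff, one_ne_zero, and_false, if_false, if_true, Nat.add_sub_cancel]
    rw [sub_add, Finset.sum_mul, Finset.sum_mul, ← Finset.sum_sub_distrib]
    simp only [zero_mul, add_zero]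
    congr 1
    refine Finset.sum_congr rfl fun l _ => ?_
    push_cast
    rw [add_mul, one_mul, Real.cos_add]; ring
  have hs : ∑ l ∈ Finset.range (m + 1), (a l - if l = 0 then 0 else a (l - 1)) * sin (l * t) =
      (∑ l ∈ Finset.range m, a l * sin (l * t)) -
        ((∑ l ∈ Finset.range m, a l * sin (l * t)) * cos t +
        (∑ l ∈ Finset.range m, a l * cos (l * t)) * sin t) := by
    simp only [sub_mul, Finset.sum_sub_distrib]
    rw [Finset.sum_range_succ, ha, Finset.sum_range_succ' (fun l => (if l = 0 then 0 else a (l-1)) * sin (l * t))]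
    simp only [Nat.add_eq_zero_iff, one_ne_zero, and_false, if_false, if_true, Nat.add_sub_cancel]
    rw [Finset.sum_mul, Finset.sum_mul, ← Finset.sum_add_distrib]
    simp only [zero_mul, add_zero]
    congr 1
    refine Finset.sum_congr rfl fun l _ => ?_
    push_cast
    rw [add_mul, one_mul, Real.sin_add]; ring
  unfold Kf
  rw [hc, hs]
  generalize (∑ l ∈ Finset.range m, a l * cos (l * t)) = C
  generalize (∑ l ∈ Finset.range m, a l * sin (l * t)) = S
  have := Real.sin_sq_add_cos_sq t
  linear_combination (-(C^2+S^2)) * this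

/-- Jackson kernel, unnormalised -/
def Jk (n : ℕ) : ℝ → ℝ := Kf n (fun l => (l:ℝ) * (n - l))

lemma sum_sq_id (m : ℝ) (M : ℕ) : ∑ l ∈ Finset.range M, ((l:ℝ) * (m - l)) ^ 2 =
    m^2 * ((M-1)*M*(2*M-1)/6) - 2*m*(M*(M-1)/2)^2 + (M-1)*M*(2*M-1)*(3*M^2-3*M-1)/30 := by
  induction M with
  | zero => simp
  | succ k ih => rw [Finset.sum_range_succ, ih]; push_cast; ring

lemma Jk_int (n : ℕ) (hn : 2 ≤ n) : π * n ^ 5 / 16 ≤ ∫ t in (-π)..π, Jk n t := by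
  unfold Jk
  rw [Kf_int, sum_sq_id]
  have h2 : (2:ℝ) ≤ n := by exact_mod_cast hn
  have h4 : (16:ℝ) ≤ n ^ 4 := by
    calc (16:ℝ) = 2 ^ 4 := by norm_num
      _ ≤ _ := by gcongr
  have e : (n:ℝ)^2 * ((n-1)*n*(2*n-1)/6) - 2*n*(n*(n-1)/2)^2 + (n-1)*n*(2*n-1)*(3*n^2-3*n-1)/30
    = n * (n ^ 4 - 1) / 30 := by ring
  rw [e]
  have : (n:ℝ) ^ 5 / 32 ≤ n * (n ^ 4 - 1) / 30 := by nlinarith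
  nlinarith [Real.pi_pos]

lemma Jk_int_cos (n : ℕ) (hn : 2 ≤ n) : ∫ t in (-π)..π, (1 - cos t) * Jk n t ≤ π * n ^ 3 := by
  have : ∀ t, (1 - cos t) * Jk n t = (1/2) * Kf (n + 1) (fun l => (l:ℝ) * (n - l) -
      if l = 0 then 0 else ((l - 1 : ℕ):ℝ) * (n - (l - 1 : ℕ))) t := by
    intro t
    have := Kf_diff n (fun l => (l:ℝ) * (n - l)) (by simp) t
    rw [← this]; unfold Jk; ring
  simp_rw [this]
  rw [intervalIntegral.integral_const_mul, Kf_int, Finset.sum_range_succ']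
  simp only [Nat.add_eq_zero_iff, one_ne_zero, and_false, if_false, if_true, Nat.add_sub_cancel]
  have hb : ∑ l ∈ Finset.range n, (((l + 1 : ℕ):ℝ) * (n - (l + 1 : ℕ)) - l * (n - l)) ^ 2 ≤
      ∑ l ∈ Finset.range n, (n:ℝ) ^ 2 := by
    refine Finset.sum_le_sum fun l hl => ?_
    have hl' : (l:ℝ) + 1 ≤ n := by exact_mod_cast Finset.mem_range.1 hl
    have h0 : (0:ℝ) ≤ l := by positivity
    push_cast
    refine sq_le_sq' ?_ ?_ <;> nlinarith
  rw [Finset.sum_const, Finset.card_range, nsmul_eq_mul] at hb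
  simp only [CharP.cast_eq_zero, zero_mul, sub_zero, ne_eq, OfNat.ofNat_ne_zero, not_false_eq_true, zero_pow, add_zero]
  nlinarith [Real.pi_pos]

lemma Jk_moment (n : ℕ) (hn : 2 ≤ n) :
    ∫ t in (-π)..π, Jk n t * (1 + n * |t|) ≤ 50 * ∫ t in (-π)..π, Jk n t := by
  have hc : Continuous (Jk n) := Kf_cont _ _
  have h1 := Jk_int n hn
  have h2 := Jk_int_cos n hn
  have hpi := Real.pi_pos
  have key : ∫ t in (-π)..π, Jk n t * (1 + n * |t|) ≤
      ∫ t in (-π)..π, ((3/2) * Jk n t + (n^2 * π^2/4) * ((1 - cos t) * Jk n t)) := by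
    refine intervalIntegral.integral_mono_on (by linarith)
      (Continuous.intervalIntegrable (by fun_prop) _ _)
      (Continuous.intervalIntegrable (by fun_prop) _ _) fun t ht => ?_
    have hq := Real.cos_le_one_sub_mul_cos_sq (abs_le.2 ht)
    have hq' : t ^ 2 ≤ π ^ 2 / 2 * (1 - cos t) := by
      have : π^2/2 * (2 / π^2 * t^2) = t^2 := by field_simp
      have h3 : 0 ≤ π^2/2 := by positivity
      nlinarith
    have hJ : 0 ≤ Jk n t := Kf_nonneg _ _ _
    have ha : (n:ℝ) * |t| ≤ 1/2 + n^2 * t^2 / 2 := by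
      have := sq_nonneg ((n:ℝ) * |t| - 1)
      have h5 := sq_abs t
      nlinarith
    have : 1 + (n:ℝ) * |t| ≤ 3/2 + n^2 * π^2/4 * (1 - cos t) := by
      have h4 : (n:ℝ)^2 * t^2 ≤ n^2 * (π ^ 2 / 2 * (1 - cos t)) := by gcongr
      linarith
    calc Jk n t * (1 + n * |t|) ≤ Jk n t * (3/2 + n^2 * π^2/4 * (1 - cos t)) := by gcongr
      _ = _ := by ring
  rw [intervalIntegral.integral_add (Continuous.intervalIntegrable (by fun_prop) _ _)
    (Continuous.intervalIntegrable (by fun_prop) _ _), intervalIntegral.integral_const_mul,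
    intervalIntegral.integral_const_mul] at key
  have h3 : (n:ℝ)^2 * π^2/4 * ∫ t in (-π)..π, (1 - cos t) * Jk n t ≤ (n:ℝ)^2 * π^2/4 * (π * n^3) := by
    gcongr
  have h4 : (n:ℝ)^2 * π^2/4 * (π * n^3) ≤ 48 * (π * n^5/16) := by
    have : π ^ 2 ≤ 12 := by nlinarith [Real.pi_lt_d2]
    have h6 : 0 ≤ π * (n:ℝ)^5 := by positivity
    nlinarith
  have h7 : 0 ≤ π * (n:ℝ)^5 / 16 := by positivity
  linarith

/-- Fejer type -/
def Gk (m : ℕ) : ℝ → ℝ := Kf m (fun _ => 1)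

lemma Gk_nonneg (m t) : 0 ≤ Gk m t := Kf_nonneg _ _ _

lemma Gk_zero (t) : Gk 0 t = 0 := by simp [Gk, Kf]
lemma Gk_one (t) : Gk 1 t = 1 := by simp [Gk, Kf]

lemma Gk_succ (m t) : Gk (m+1) t = Gk m t + 1 + 2 * ∑ j ∈ Finset.range m, cos ((j+1 : ℕ) * t) := by
  have : ∑ j ∈ Finset.range m, cos ((j+1 : ℕ) * t) =
      (∑ l ∈ Finset.range m, cos (l * t)) * cos (m * t) +
      (∑ l ∈ Finset.range m, sin (l * t)) * sin (m * t) := by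
    rw [← Finset.sum_range_reflect, Finset.sum_mul, Finset.sum_mul, ← Finset.sum_add_distrib]
    refine Finset.sum_congr rfl fun l hl => ?_
    have : ((m - 1 - l + 1 : ℕ) : ℝ) = m - l := by
      have := Finset.mem_range.1 hl
      rw [← Nat.cast_sub this.le]
      congr 1; omega
    rw [this, sub_mul, Real.cos_sub]; ring
  rw [this]
  unfold Gk Kf
  simp only [one_mul]
  rw [Finset.sum_range_succ, Finset.sum_range_succ]
  have := Real.sin_sq_add_cos_sq (m * t)
  linear_combination this

lemma Gk_rec (m t) : Gk (m+2) t + Gk m t - 2 * Gk (m+1) t = 2 * cos ((m+1 : ℕ) * t) := by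
  have h1 := Gk_succ m t
  have h2 := Gk_succ (m+1) t
  rw [Finset.sum_range_succ] at h2
  have : m + 2 = m + 1 + 1 := rfl
  rw [this]
  linarith

lemma Gk_le (m t) : Gk m t ≤ m ^ 2 := by
  unfold Gk Kf
  simp only [one_mul]
  have h1 := sq_sum_le_card_mul_sum_sq (s := Finset.range m) (f := fun l : ℕ => cos (l * t))
  have h2 := sq_sum_le_card_mul_sum_sq (s := Finset.range m) (f := fun l : ℕ => sin (l * t))
  have h3 : ∑ l ∈ Finset.range m, cos (l * t) ^ 2 + ∑ l ∈ Finset.range m, sin (l * t) ^ 2 = m := by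
    rw [← Finset.sum_add_distrib]
    simp
  simp only [Finset.card_range] at h1 h2
  calc _ ≤ m * ∑ l ∈ Finset.range m, cos (l * t) ^ 2 + m * ∑ l ∈ Finset.range m, sin (l * t) ^ 2 :=
      add_le_add h1 h2
    _ = _ := by rw [← mul_add, h3]; ring

lemma Gk_zero_val (m) : Gk m 0 = m ^ 2 := by simp [Gk, Kf]

def Gd (m : ℕ) (t : ℝ) : ℝ :=
  2 * ((∑ l ∈ Finset.range m, cos (l * t)) * (∑ l ∈ Finset.range m, -(l * sin (l * t))) +
    (∑ l ∈ Finset.range m, sin (l * t)) * (∑ l ∈ Finset.range m, (l * cos (l * t))))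

lemma Gd_cont (m) : Continuous (Gd m) := by unfold Gd; fun_prop

lemma Gk_deriv (m t) : HasDerivAt (Gk m) (Gd m t) t := by
  have hl : ∀ l : ℕ, HasDerivAt (fun t : ℝ => (l:ℝ) * t) l t := fun l => by
    simpa using (hasDerivAt_id t).const_mul (l:ℝ)
  have h1 : HasDerivAt (fun t => ∑ l ∈ Finset.range m, cos (l * t))
      (∑ l ∈ Finset.range m, -(l * sin (l * t))) t := by
    refine HasDerivAt.fun_sum fun l _ => ?_
    simpa [mul_comm] using (hl l).cos
  have h2 : HasDerivAt (fun t => ∑ l ∈ Finset.range m, sin (l * t))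
      (∑ l ∈ Finset.range m, (l * cos (l * t))) t := by
    refine HasDerivAt.fun_sum fun l _ => ?_
    simpa [mul_comm] using (hl l).sin
  have := (h1.fun_pow 2).fun_add (h2.fun_pow 2)
  have e : Gk m = fun t => (∑ l ∈ Finset.range m, cos (l * t)) ^ 2 +
      (∑ l ∈ Finset.range m, sin (l * t)) ^ 2 := by
    funext t; unfold Gk Kf; simp only [one_mul]
  rw [e]
  refine this.congr_deriv ?_
  unfold Gd; simp; ring

lemma Gd_int (m : ℕ) : ∫ t in (-π)..π, |Gd m t| ≤ 8 * π * (m ^ 2 - 1) ∨ m = 0 := by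
  rcases Nat.lt_or_ge m 2 with h | h
  · interval_cases m
    · right; rfl
    · left; simp [Gd]
  left
  have hm : (2:ℝ) ≤ m := by exact_mod_cast h
  have hpi := Real.pi_pos
  have key : ∫ t in (-π)..π, |Gd m t| ≤
      ∫ t in (-π)..π, ((m:ℝ) * Gk m t + (1/m) * Kf m (fun l => l) t) := by
    have hc1 : Continuous (Gk m) := Kf_cont _ _
    have hc2 : Continuous (Kf m (fun l => l)) := Kf_cont _ _
    have hc3 := Gd_cont m
    refine intervalIntegral.integral_mono_on (by linarith)
      (Continuous.intervalIntegrable (by fun_prop) _ _)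
      (Continuous.intervalIntegrable (by fun_prop) _ _) fun t _ => ?_
    unfold Gd Gk Kf
    simp only [one_mul, Finset.sum_neg_distrib]
    generalize (∑ l ∈ Finset.range m, cos (l * t)) = C
    generalize (∑ l ∈ Finset.range m, sin (l * t)) = S
    generalize (∑ l ∈ Finset.range m, (l:ℝ) * cos (l * t)) = C'
    generalize (∑ l ∈ Finset.range m, (l:ℝ) * sin (l * t)) = S'
    have e1 : (m:ℝ) * (C^2+S^2) + 1/m*(C'^2+S'^2) - 2 * (C * -S' + S * C') =
      (1/m) * ((m * C + S')^2 + (m * S - C')^2) := by field_simp; ring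
    have e2 : (m:ℝ) * (C^2+S^2) + 1/m*(C'^2+S'^2) + 2 * (C * -S' + S * C') =
      (1/m) * ((m * C - S')^2 + (m * S + C')^2) := by field_simp; ring
    have p1 : 0 ≤ (1/(m:ℝ)) * ((m * C + S')^2 + (m * S - C')^2) := by positivity
    have p2 : 0 ≤ (1/(m:ℝ)) * ((m * C - S')^2 + (m * S + C')^2) := by positivity
    rw [abs_le]
    constructor <;> linarith
  have hc1 : Continuous (Gk m) := Kf_cont _ _
  have hc2 : Continuous (Kf m (fun l => l)) := Kf_cont _ _
  rw [intervalIntegral.integral_add (Continuous.intervalIntegrable (by fun_prop) _ _)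
    (Continuous.intervalIntegrable (by fun_prop) _ _), intervalIntegral.integral_const_mul,
    intervalIntegral.integral_const_mul] at key
  unfold Gk at key
  rw [Kf_int, Kf_int] at key
  simp only [one_pow, Finset.sum_const, Finset.card_range, nsmul_eq_mul, mul_one] at key
  have hs : ∑ l ∈ Finset.range m, (l:ℝ) ^ 2 ≤ m * m ^ 2 := by
    calc _ ≤ ∑ l ∈ Finset.range m, (m:ℝ) ^ 2 := by
          refine Finset.sum_le_sum fun l hl => ?_
          have : (l:ℝ) ≤ m := by exact_mod_cast (Finset.mem_range.1 hl).le
          gcongr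
      _ = _ := by simp
  have hs' : 1/(m:ℝ) * (2 * π * ∑ l ∈ Finset.range m, (l:ℝ) ^ 2) ≤ 2 * π * m ^ 2 := by
    calc _ ≤ 1/(m:ℝ) * (2 * π * (m * m ^ 2)) := by gcongr
      _ = _ := by field_simp
  have h8 : (4:ℝ) ≤ m ^ 2 := by nlinarith
  have h9 : 4 * π ≤ π * m ^ 2 := by nlinarith
  nlinarith


structure GoodSeq (p : ℕ → ℝ) : Prop where
  nonneg : ∀ j, 0 ≤ p j
  anti : ∀ j, p (j+1) ≤ p j
  conv : ∀ j, 2 * p (j+1) ≤ p j + p (j+2)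
  summ : Summable p
  lim : Tendsto (fun M : ℕ => p M * ((M:ℝ)+1)^2) atTop (nhds 0)

lemma summ_cos {p : ℕ → ℝ} (hs : Summable p) (h0 : ∀ j, 0 ≤ p j) (f : ℕ → ℝ) :
    Summable (fun j => p j * cos (f j)) := by
  refine Summable.of_norm_bounded hs fun j => ?_
  rw [norm_mul, Real.norm_eq_abs, Real.norm_eq_abs, abs_of_nonneg (h0 j)]
  exact mul_le_of_le_one_right (h0 j) (Real.abs_cos_le_one _)

lemma tsum_cos_cont {p : ℕ → ℝ} (hs : Summable p) (h0 : ∀ j, 0 ≤ p j) (f : ℕ → ℝ → ℝ)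
    (hf : ∀ j, Continuous (f j)) : Continuous (fun t => ∑' j, p j * cos (f j t)) := by
  refine continuous_tsum (fun j => ?_) hs fun j t => ?_
  · have := hf j; fun_prop
  · rw [norm_mul, Real.norm_eq_abs, Real.norm_eq_abs, abs_of_nonneg (h0 j)]
    exact mul_le_of_le_one_right (h0 j) (Real.abs_cos_le_one _)

lemma tsum_cos_abs_le {p : ℕ → ℝ} (hs : Summable p) (h0 : ∀ j, 0 ≤ p j) (f : ℕ → ℝ) :
    |∑' j, p j * cos (f j)| ≤ ∑' j, p j := by
  rw [← Real.norm_eq_abs]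
  refine tsum_of_norm_bounded hs.hasSum fun j => ?_
  rw [norm_mul, Real.norm_eq_abs, Real.norm_eq_abs, abs_of_nonneg (h0 j)]
  exact mul_le_of_le_one_right (h0 j) (Real.abs_cos_le_one _)

def Pk (p : ℕ → ℝ) (t : ℝ) : ℝ := p 0 + 2 * ∑' j : ℕ, p (j+1) * cos ((j+1 : ℕ) * t)

lemma GoodSeq.summ1 {p : ℕ → ℝ} (h : GoodSeq p) : Summable (fun j => p (j+1)) :=
  (summable_nat_add_iff 1).2 h.summ

lemma Pk_cont {p : ℕ → ℝ} (h : GoodSeq p) : Continuous (Pk p) := by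
  have := tsum_cos_cont h.summ1 (fun j => h.nonneg _) (fun j t => (j+1 : ℕ) * t)
    (fun j => by fun_prop)
  unfold Pk; fun_prop

lemma Pk_per (p : ℕ → ℝ) : Function.Periodic (Pk p) (2 * π) := by
  intro t
  unfold Pk
  congr 3
  funext j
  rw [mul_add, Real.cos_add_nat_mul_two_pi]

def cc (p : ℕ → ℝ) (m : ℕ) : ℝ := p m - 2 * p (m+1) + p (m+2)

lemma abel (p : ℕ → ℝ) (t : ℝ) (M : ℕ) : ∑ m ∈ Finset.range M, cc p m * Gk (m+1) t =
    p 0 + 2 * ∑ j ∈ Finset.range M, p (j+1) * cos ((j+1 : ℕ) * t) + p (M+1) * Gk M t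
      - p M * Gk (M+1) t := by
  induction M with
  | zero => simp [Gk_zero, Gk_one]
  | succ M ih =>
    rw [Finset.sum_range_succ, ih, Finset.sum_range_succ]
    have := Gk_rec M t
    unfold cc
    linear_combination (p (M+1)) * this

lemma Pk_lim {p : ℕ → ℝ} (h : GoodSeq p) (t : ℝ) :
    Tendsto (fun M => ∑ m ∈ Finset.range M, cc p m * Gk (m+1) t) atTop (nhds (Pk p t)) := by
  have h1 : Tendsto (fun M => p (M+1) * Gk M t) atTop (nhds 0) := by
    refine squeeze_zero (fun M => mul_nonneg (h.nonneg _) (Gk_nonneg _ _)) (fun M => ?_) h.lim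
    have h2 : (M:ℝ)^2 ≤ ((M:ℝ)+1)^2 := by gcongr; linarith
    exact mul_le_mul (h.anti M) ((Gk_le M t).trans h2) (Gk_nonneg _ _) (h.nonneg _)
  have h2 : Tendsto (fun M => p M * Gk (M+1) t) atTop (nhds 0) := by
    refine squeeze_zero (fun M => mul_nonneg (h.nonneg _) (Gk_nonneg _ _)) (fun M => ?_) h.lim
    have := Gk_le (M+1) t
    push_cast at this
    exact mul_le_mul_of_nonneg_left this (h.nonneg _)
  have h3 := (summ_cos h.summ1 (fun j => h.nonneg _)
    (fun j => ((j+1 : ℕ):ℝ) * t)).hasSum.tendsto_sum_nat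
  have := ((h3.const_mul 2).const_add (p 0)).add h1 |>.sub h2
  simp only [abel]
  simpa [Pk] using this

lemma cc_nonneg {p : ℕ → ℝ} (h : GoodSeq p) (m) : 0 ≤ cc p m := by
  have := h.conv m; unfold cc; linarith

lemma Pk_nonneg {p : ℕ → ℝ} (h : GoodSeq p) (t : ℝ) : 0 ≤ Pk p t :=
  ge_of_tendsto' (Pk_lim h t) fun M =>
    Finset.sum_nonneg fun m _ => mul_nonneg (cc_nonneg h m) (Gk_nonneg _ _)

lemma Kf_per (m a) : Function.Periodic (Kf m a) (2 * π) := by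
  intro x
  unfold Kf
  simp only [mul_add, Real.cos_add_nat_mul_two_pi, Real.sin_add_nat_mul_two_pi]

lemma Gd_per (m) : Function.Periodic (Gd m) (2 * π) := by
  intro x
  unfold Gd
  simp only [mul_add, Real.cos_add_nat_mul_two_pi, Real.sin_add_nat_mul_two_pi]

/-- integral over period as a sum over cells -/
lemma cells {g : ℝ → ℝ} (hg : PI1 g) (n : ℕ) (hn : 0 < n) (z : ℝ) :
    ∑ i ∈ Finset.range (2 * n), ∫ t in (z + i * (π / n) - π/(2*n))..(z + i * (π / n) + π/(2*n)), g t
      = ∫ t in (-π)..π, g t := by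
  have hn' : (n:ℝ) ≠ 0 := by positivity
  have := intervalIntegral.sum_integral_adjacent_intervals (f := g) (μ := volume)
    (a := fun i : ℕ => z + i * (π / n) - π/(2*n)) (n := 2 * n) (fun k _ => hg.ii _ _)
  have e : ∀ i : ℕ, z + i * (π / n) + π/(2*n) = z + (i+1 : ℕ) * (π / n) - π/(2*n) := by
    intro i; push_cast; field_simp; ring
  simp only [e]
  rw [this]
  have h2 := hg.1.intervalIntegral_add_eq (z + (0:ℕ) * (π / n) - π/(2*n)) (-π)
  convert h2 using 2
  · push_cast; field_simp
    ring
  · ring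

lemma Gk_var (m n : ℕ) (hn : 0 < n) (z s : ℝ) (hs : 0 ≤ s) (hs' : s ≤ π/(2*n)) :
    ∑ i ∈ Finset.range (2*n), |Gk (m+1) (z + i * (π / n) + s) - Gk (m+1) (z + i * (π / n) - s)| ≤
      8 * π * (((m:ℝ)+1)^2 - 1) := by
  have hc := Gd_cont (m+1)
  have h1 : ∀ i : ℕ, |Gk (m+1) (z + i * (π / n) + s) - Gk (m+1) (z + i * (π / n) - s)| ≤
      ∫ t in (z + i * (π / n) - π/(2*n))..(z + i * (π / n) + π/(2*n)), |Gd (m+1) t| := by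
    intro i
    rw [← intervalIntegral.integral_eq_sub_of_hasDerivAt (fun x _ => Gk_deriv (m+1) x)
      (hc.intervalIntegrable _ _)]
    refine (intervalIntegral.abs_integral_le_integral_abs (by linarith)).trans ?_
    refine intervalIntegral.integral_mono_interval (by linarith) (by linarith) (by linarith)
      (Eventually.of_forall fun x => abs_nonneg _) (hc.abs.intervalIntegrable _ _)
  refine (Finset.sum_le_sum fun i _ => h1 i).trans ?_
  rw [cells (g := fun t => |Gd (m+1) t|) ⟨fun x => by simp only []; rw [Gd_per], hc.abs.intervalIntegrable _ _⟩ n hn z]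
  rcases Gd_int (m+1) with h | h
  · push_cast at h; exact h
  · omega

lemma Pk_var {p : ℕ → ℝ} (h : GoodSeq p) (n : ℕ) (hn : 0 < n) (z s : ℝ) (hs : 0 ≤ s)
    (hs' : s ≤ π/(2*n)) :
    ∑ i ∈ Finset.range (2*n), |Pk p (z + i * (π / n) + s) - Pk p (z + i * (π / n) - s)| ≤
      32 * π * ∑' j, p (j+1) := by
  have hl : Tendsto (fun M => ∑ i ∈ Finset.range (2*n),
      |∑ m ∈ Finset.range M, cc p m * Gk (m+1) (z + i * (π / n) + s) -
        ∑ m ∈ Finset.range M, cc p m * Gk (m+1) (z + i * (π / n) - s)|) atTop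
      (nhds (∑ i ∈ Finset.range (2*n),
        |Pk p (z + i * (π / n) + s) - Pk p (z + i * (π / n) - s)|)) :=
    tendsto_finsetSum _ fun i _ => ((Pk_lim h _).sub (Pk_lim h _)).abs
  refine le_of_tendsto hl ?_
  filter_upwards [eventually_ge_atTop 1] with M hM
  calc _ ≤ ∑ i ∈ Finset.range (2*n), ∑ m ∈ Finset.range M, cc p m *
        |Gk (m+1) (z + i * (π / n) + s) - Gk (m+1) (z + i * (π / n) - s)| := by
        refine Finset.sum_le_sum fun i _ => ?_
        rw [← Finset.sum_sub_distrib]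
        refine (Finset.abs_sum_le_sum_abs _ _).trans (le_of_eq ?_)
        refine Finset.sum_congr rfl fun m _ => ?_
        rw [← mul_sub, abs_mul, abs_of_nonneg (cc_nonneg h m)]
    _ = ∑ m ∈ Finset.range M, cc p m * ∑ i ∈ Finset.range (2*n),
        |Gk (m+1) (z + i * (π / n) + s) - Gk (m+1) (z + i * (π / n) - s)| := by
        rw [Finset.sum_comm]
        simp only [Finset.mul_sum]
    _ ≤ ∑ m ∈ Finset.range M, cc p m * (8 * π * (((m:ℝ)+1)^2 - 1)) := by
        refine Finset.sum_le_sum fun m _ => ?_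
        exact mul_le_mul_of_nonneg_left (Gk_var m n hn z s hs hs') (cc_nonneg h m)
    _ = 8 * π * (∑ m ∈ Finset.range M, cc p m * Gk (m+1) 0 - ∑ m ∈ Finset.range M, cc p m) := by
        rw [← Finset.sum_sub_distrib, Finset.mul_sum]
        refine Finset.sum_congr rfl fun m _ => ?_
        rw [Gk_zero_val]; push_cast; ring
    _ ≤ 8 * π * (4 * ∑' j, p (j+1)) := by
        have hS : ∀ N, ∑ j ∈ Finset.range N, p (j+1) ≤ ∑' j, p (j+1) := fun N =>
          h.summ1.sum_le_tsum _ fun j _ => h.nonneg _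
        have h2 : ∀ N, ∑ m ∈ Finset.range N, cc p m = p 0 - p 1 - p N + p (N+1) := by
          intro N
          induction N with
          | zero => simp
          | succ N ih => rw [Finset.sum_range_succ, ih]; unfold cc; ring
        have h1 : p 1 ≤ ∑' j, p (j+1) := by simpa using hS 1
        have h3 : p M ≤ ∑' j, p (j+1) := by
          have := h.summ1.le_tsum (M-1) fun j _ => h.nonneg _
          simpa [Nat.sub_add_cancel hM] using this
        rw [abel, h2, Gk_zero_val, Gk_zero_val]
        simp only [mul_zero, cos_zero, mul_one]
        have h4 : p (M+1) * (M:ℝ)^2 ≤ p M * ((M+1:ℕ):ℝ)^2 := by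
          push_cast
          refine mul_le_mul (h.anti M) (by gcongr; linarith) (by positivity) (h.nonneg _)
        have h5 := hS M
        have h6 := h.nonneg (M+1)
        refine mul_le_mul_of_nonneg_left ?_ (by positivity)
        linarith
    _ = _ := by ring

lemma sum_cos_zero (n j : ℕ) (hj : 1 ≤ j) (hj' : j < 2 * n) (x : ℝ) :
    ∑ i ∈ Finset.range (2*n), cos (j * (x + i * (π / n))) = 0 := by
  have hn : 0 < n := by omega
  have hn' : (0:ℝ) < n := by exact_mod_cast hn
  set h : ℝ := j * (π / n) with hh
  have hs : sin (h/2) ≠ 0 := by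
    refine (Real.sin_pos_of_pos_of_lt_pi ?_ ?_).ne'
    · have : (0:ℝ) < j := by exact_mod_cast hj
      positivity
    · have : (j:ℝ) < 2 * n := by exact_mod_cast hj'
      rw [hh]
      calc (j:ℝ) * (π / n) / 2 < (2 * n) * (π / n) / 2 := by gcongr
        _ = π := by field_simp
  have key : ∀ N : ℕ, 2 * sin (h/2) * ∑ i ∈ Finset.range N, cos (j * (x + i * (π / n))) =
      sin (j * x + N * h - h/2) - sin (j * x - h/2) := by
    intro N
    induction N with
    | zero => simp
    | succ N ih =>
      rw [Finset.sum_range_succ, mul_add, ih]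
      have e1 : (j:ℝ) * (x + N * (π/n)) = j * x + N * h := by rw [hh]; ring
      have e2 : (j:ℝ) * x + (N+1:ℕ) * h - h/2 = (j * x + N * h) + h/2 := by push_cast; ring
      rw [e1, e2, Real.sin_add (j * x + N * h), Real.sin_sub (j * x + N * h)]
      ring
  have := key (2*n)
  have e : (j:ℝ) * x + (2*n:ℕ) * h - h/2 = (j * x - h/2) + j * (2 * π) := by
    rw [hh]; push_cast; field_simp; ring
  rw [e, Real.sin_add_nat_mul_two_pi, sub_self] at this
  simpa [hs] using this

lemma Pk_alias {p : ℕ → ℝ} (h : GoodSeq p) (n : ℕ) (hn : 0 < n) (x : ℝ) :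
    ∑ i ∈ Finset.range (2*n), Pk p (x + i * (π / n)) ≤ 2 * n * (p 0 + 2 * ∑' j, p (2*n+j)) := by
  unfold Pk
  rw [Finset.sum_add_distrib, ← Finset.mul_sum]
  have hsm : ∀ x, Summable fun j : ℕ => p (j+1) * cos ((j+1 : ℕ) * x) :=
    fun x => summ_cos h.summ1 (fun j => h.nonneg _) _
  rw [← Summable.tsum_finsetSum fun i _ => hsm _]
  set f : ℕ → ℝ := fun j => ∑ i ∈ Finset.range (2*n),
      p (j+1) * cos ((j+1 : ℕ) * (x + i * (π / n))) with hf
  have hs2 : Summable f := summable_sum fun i _ => hsm _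
  rw [← hs2.sum_add_tsum_nat_add (2*n-1)]
  have z : ∑ j ∈ Finset.range (2*n-1), f j = 0 := by
    refine Finset.sum_eq_zero fun j hj => ?_
    rw [hf]
    simp only []
    rw [← Finset.mul_sum, sum_cos_zero n (j+1) (by omega) (by simp at hj; omega), mul_zero]
  rw [z, zero_add]
  have hfb : ∀ j, f j ≤ (2*n) * p (j+1) := by
    intro j
    calc f j ≤ ∑ i ∈ Finset.range (2*n), p (j+1) := by
            refine Finset.sum_le_sum fun i _ => mul_le_of_le_one_right (h.nonneg _) (Real.cos_le_one _)
        _ = _ := by simp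
  have hb : ∑' j, f (j + (2*n-1)) ≤ ∑' j, (2*n) * p (2*n+j) := by
    refine Summable.tsum_le_tsum (fun j => ?_) ((summable_nat_add_iff (2*n-1)).2 hs2)
      (Summable.mul_left _ ?_)
    · have e : j + (2*n-1) + 1 = 2*n+j := by omega
      have := hfb (j + (2*n-1))
      rwa [e] at this
    · have := (summable_nat_add_iff (2*n)).2 h.summ
      simpa [add_comm] using this
  rw [tsum_mul_left] at hb
  simp only [Finset.sum_const, Finset.card_range, nsmul_eq_mul]
  push_cast
  linarith


lemma om_nat {ω : ℝ → ℝ} (h : IsModulus ω) (N : ℕ) {t : ℝ} (ht : 0 ≤ t) : ω (N * t) ≤ N * ω t := by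
  induction N with
  | zero => simp [h.2.2.2.1]
  | succ N ih =>
    have := h.2.2.1 (N * t) t (by positivity) ht
    push_cast
    rw [add_mul, add_mul, one_mul, one_mul]
    linarith

lemma om_mul {ω : ℝ → ℝ} (h : IsModulus ω) {l t : ℝ} (hl : 0 ≤ l) (ht : 0 ≤ t) :
    ω (l * t) ≤ (1 + l) * ω t := by
  have h1 := om_nat h ⌈l⌉₊ ht
  have h2 : ω (l * t) ≤ ω (⌈l⌉₊ * t) :=
    h.2.1 (Set.mem_Ici.2 (by positivity)) (Set.mem_Ici.2 (by positivity))
      (by gcongr; exact Nat.le_ceil l)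
  have h3 := (Nat.ceil_lt_add_one hl).le
  have h4 := h.2.2.2.2 t ht
  nlinarith

def HModul (φ ω : ℝ → ℝ) : Prop := ∀ h : ℝ, ∫ x in (-π)..π, |φ (x + h) - φ x| ≤ ω |h|

lemma convTrig {n : ℕ} {φ Q : ℝ → ℝ} (h : PI1 φ) (hQ : IsTrigPoly n Q) :
    IsTrigPoly n (fun x => ∫ t in (-π)..π, φ (x - t) * Q t) := by
  have := hQ.conv h.2 (continuous_id' (X := ℝ))
  convert this using 2 with x
  rw [← per_int_neg (g := fun t => φ t * Q (x - t)) ?_ x]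
  · simp
  · intro t
    simp only []
    rw [h.1 t]
    have := hQ.periodic (x - (t + 2 * π))
    rw [← this]; congr 2; ring

lemma PI1.trig {n : ℕ} {Q : ℝ → ℝ} (hQ : IsTrigPoly n Q) : PI1 Q :=
  ⟨hQ.periodic, hQ.continuous.intervalIntegrable _ _⟩

lemma PI1.convInt {φ : ℝ → ℝ} (h : PI1 φ) {w : ℝ → ℝ} (hw : Continuous w) (x a b : ℝ) :
    IntervalIntegrable (fun t => φ (x - t) * w t) volume a b :=
  ((h.neg_shift x).ii a b).mul_continuousOn hw.continuousOn

lemma prodInt' {φ : ℝ → ℝ} (h : PI1 φ) {w u : ℝ → ℝ} (hw : Continuous w) (hu : Continuous u)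
    (c d : ℝ) : Integrable (fun p : ℝ × ℝ => φ (p.1 - u p.2) * w p.2)
      ((volume.restrict (Set.Ioc (-π) π)).prod (volume.restrict (Set.Ioc c d))) := by
  simpa [mul_comm] using prodInt h hw hu c d

lemma pdiff {φ ω : ℝ → ℝ} (h : PI1 φ) (hm : HModul φ ω) (u v : ℝ) :
    ∫ x in (-π)..π, |φ (x - u) - φ (x - v)| ≤ ω |v - u| := by
  have := per_int_shift (g := fun x => |φ (x + (v - u)) - φ x|) (fun x => by
    simp only []
    have := h.1 (x + (v - u))
    rw [h.1 x, ← this]; congr 3; ring) (-v)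
  have h2 := hm (v - u)
  rw [← this] at h2
  convert h2 using 5 <;> ring_nf

lemma jackson {φ ω : ℝ → ℝ} (hω : IsModulus ω) (h : PI1 φ) (hm : HModul φ ω) (n : ℕ) (hn : 2 ≤ n) :
    ∃ U, IsTrigPoly n U ∧ ∫ x in (-π)..π, |φ x - U x| ≤ 50 * ω (1 / n) := by
  have hpi := Real.pi_pos
  set I := ∫ t in (-π)..π, Jk n t with hI
  have hIpos : 0 < I := by
    have := Jk_int n hn
    have h5 : (0:ℝ) < π * n ^ 5 / 16 := by positivity
    linarith
  have hJc : Continuous (Jk n) := Kf_cont _ _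
  refine ⟨fun x => (1/I) * ∫ t in (-π)..π, φ (x - t) * Jk n t,
    (convTrig h (Kf_trig _ _)).smul _, ?_⟩
  have e : ∀ x, φ x - (1/I) * ∫ t in (-π)..π, φ (x - t) * Jk n t =
      ∫ t in (-π)..π, (Jk n t / I) * φ (x - 0) - (Jk n t / I) * φ (x - t) := by
    intro x
    have hi := h.convInt (hJc.div_const I) x (-π) π
    rw [intervalIntegral.integral_sub (Continuous.intervalIntegrable (by fun_prop) _ _)
      (by simpa [mul_comm] using hi)]
    rw [intervalIntegral.integral_mul_const, intervalIntegral.integral_div, ← hI, div_self hIpos.ne',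
      sub_zero, one_mul, ← intervalIntegral.integral_const_mul]
    congr 2
    funext t; ring
  simp only [e]
  have M := minkowski (F := fun x t => (Jk n t / I) * φ (x - 0) - (Jk n t / I) * φ (x - t))
    (c := -π) (d := π) (by linarith)
    ((prodInt h (hJc.div_const I) (continuous_const (y := 0)) _ _).sub
      (prodInt h (hJc.div_const I) continuous_id _ _))
    (N := fun t => (ω (1/n) / I) * (Jk n t * (1 + n * |t|))) ?_
    (Continuous.intervalIntegrable (by fun_prop) _ _)
  · refine M.2.trans ?_
    rw [intervalIntegral.integral_const_mul]
    have h1 := Jk_moment n hn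
    have h2 := hω.2.2.2.2 (1/n) (by positivity)
    calc _ ≤ (ω (1/n) / I) * (50 * I) := by gcongr
      _ = _ := by field_simp
  · intro t _
    have hJ : 0 ≤ Jk n t / I := div_nonneg (Kf_nonneg _ _ _) hIpos.le
    simp only [← mul_sub, abs_mul, abs_of_nonneg hJ]
    rw [intervalIntegral.integral_const_mul]
    have h1 := pdiff h hm 0 t
    have h2 := om_mul hω (l := n * |t|) (t := 1/n) (by positivity) (by positivity)
    have h3 : (n:ℝ) * |t| * (1/n) = |t| := by field_simp
    rw [h3] at h2
    rw [sub_zero] at h1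
    calc _ ≤ Jk n t / I * ((1 + n * |t|) * ω (1/n)) := by gcongr; exact h1.trans h2
      _ = _ := by ring

lemma cellRep {H : ℝ → ℝ} (hH : PI1 H) (n : ℕ) (hn : 0 < n) (z : ℝ) :
    ∫ t in (-π)..π, H t = ∫ s in (0:ℝ)..(π/(2*n)), ∑ i ∈ Finset.range (2*n),
      (H (z + i * (π / n) + s) + H (z + i * (π / n) - s)) := by
  have hi1 : ∀ c, IntervalIntegrable (fun s => H (c + s)) volume 0 (π/(2*n)) := fun c => by
    have := (hH.shift c).ii 0 (π/(2*n)); simpa [add_comm] using this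
  have hi2 : ∀ c, IntervalIntegrable (fun s => H (c - s)) volume 0 (π/(2*n)) := fun c =>
    (hH.neg_shift c).ii 0 (π/(2*n))
  rw [intervalIntegral.integral_finsetSum fun i _ => (hi1 _).add (hi2 _), ← cells hH n hn z]
  refine Finset.sum_congr rfl fun i _ => ?_
  rw [intervalIntegral.integral_add (hi1 _) (hi2 _), intervalIntegral.integral_comp_add_left,
    intervalIntegral.integral_comp_sub_left, add_zero, sub_zero]
  have := fun a b c => intervalIntegral.integral_add_adjacent_intervals (hH.ii a b) (hH.ii b c)
  rw [← this _ (z + i * (π / n)) _]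
  exact add_comm _ _

lemma cos_node (n : ℕ) (hn : 0 < n) (b s : ℝ) (i : ℕ) :
    cos (n * ((b - π/2)/n + i * (π / n) + s) - b) = (-1)^i * sin (n * s) := by
  have hn' : (n:ℝ) ≠ 0 := by positivity
  have : n * ((b - π/2)/n + i * (π / n) + s) - b = (n * s - π/2) + i * π := by
    field_simp; ring
  rw [this, Real.cos_add_nat_mul_pi, Real.cos_sub_pi_div_two]

lemma eN_eq {ω : ℝ → ℝ} (n : ℕ) (hn : 0 < n) :
    ∫ s in (0:ℝ)..(π/(2*n)), ω (2 * s) * sin (n * s) = eN n ω / n := by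
  have hn' : (n:ℝ) ≠ 0 := by positivity
  unfold eN
  have := intervalIntegral.integral_comp_mul_left (a := 0) (b := π/(2*n))
    (fun t => ω (2 * t / n) * sin t) hn'
  have e : (n:ℝ) * (π/(2*n)) = π/2 := by field_simp
  rw [mul_zero, e, smul_eq_mul, inv_mul_eq_div] at this
  rw [← this]
  congr 1
  funext s
  congr 2
  field_simp

lemma om_cont {ω : ℝ → ℝ} (h : IsModulus ω) (n : ℕ) :
    ContinuousOn (fun s => ω (2 * s)) (Set.uIcc 0 (π/(2*n))) := by
  refine h.1.comp (by fun_prop) fun s hs => ?_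
  rw [Set.uIcc_of_le (by positivity)] at hs
  exact Set.mem_Ici.2 (by linarith [hs.1])

lemma slice_bound {ι : Type*} (S : Finset ι) (w1 w2 D1 D2 : ι → ℝ) (A B : ι → ℝ → ℝ)
    (hA : ∀ i, IntervalIntegrable (A i) volume (-π) π)
    (hB : ∀ i, IntervalIntegrable (B i) volume (-π) π)
    (h1 : ∀ i, ∫ x in (-π)..π, |A i x| ≤ D1 i) (h2 : ∀ i, ∫ x in (-π)..π, |B i x| ≤ D2 i) :
    ∫ x in (-π)..π, |∑ i ∈ S, (w1 i * A i x + w2 i * B i x)| ≤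
      ∑ i ∈ S, (|w1 i| * D1 i + |w2 i| * D2 i) := by
  have hpi := Real.pi_pos
  have hi1 : ∀ i, IntervalIntegrable (fun x => |w1 i| * |A i x|) volume (-π) π :=
    fun i => (hA i).abs.const_mul _
  have hi2 : ∀ i, IntervalIntegrable (fun x => |w2 i| * |B i x|) volume (-π) π :=
    fun i => (hB i).abs.const_mul _
  have hs : ∀ (f : ι → ℝ → ℝ), (∀ i, IntervalIntegrable (f i) volume (-π) π) →
      IntervalIntegrable (fun x => ∑ i ∈ S, f i x) volume (-π) π := by
    intro f hf
    have := IntervalIntegrable.sum S (f := f) fun i _ => hf i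
    have e : (fun x => ∑ i ∈ S, f i x) = ∑ i ∈ S, f i := by funext x; simp
    rw [e]; exact this
  calc _ ≤ ∫ x in (-π)..π, ∑ i ∈ S, (|w1 i| * |A i x| + |w2 i| * |B i x|) := by
        refine intervalIntegral.integral_mono_on (by linarith) ?_ ?_ fun x _ => ?_
        · exact (hs _ fun i => ((hA i).const_mul _).add ((hB i).const_mul _)).abs
        · exact hs _ fun i => (hi1 i).add (hi2 i)
        · refine (Finset.abs_sum_le_sum_abs _ _).trans (Finset.sum_le_sum fun i _ => ?_)
          refine (abs_add_le _ _).trans (le_of_eq ?_)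
          rw [abs_mul, abs_mul]
    _ = ∑ i ∈ S, (|w1 i| * (∫ x in (-π)..π, |A i x|) + |w2 i| * ∫ x in (-π)..π, |B i x|) := by
        rw [intervalIntegral.integral_finsetSum fun i _ => (hi1 i).add (hi2 i)]
        refine Finset.sum_congr rfl fun i _ => ?_
        rw [intervalIntegral.integral_add (hi1 i) (hi2 i), intervalIntegral.integral_const_mul,
          intervalIntegral.integral_const_mul]
    _ ≤ _ := by
        refine Finset.sum_le_sum fun i _ => ?_
        have := h1 i
        have := h2 i
        gcongr

lemma PI1.absInt_add {φ : ℝ → ℝ} (h : PI1 φ) (u v : ℝ) :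
    ∫ x in (-π)..π, |φ (x - u) + φ (x - v)| ≤ 2 * ∫ x in (-π)..π, |φ x| := by
  have hpi := Real.pi_pos
  have h1 := (h.shift (-u)).2
  have h2 := (h.shift (-v)).2
  simp only [← sub_eq_add_neg] at h1 h2
  calc _ ≤ ∫ x in (-π)..π, (|φ (x - u)| + |φ (x - v)|) := by
        refine intervalIntegral.integral_mono_on (by linarith) (h1.add h2).abs (h1.abs.add h2.abs)
          fun x _ => abs_add_le _ _
    _ = _ := by
      rw [intervalIntegral.integral_add h1.abs h2.abs, h.absInt_shift, h.absInt_shift]; ring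

lemma upperB {φ ω U : ℝ → ℝ} (hω : IsModulus ω) (h : PI1 φ) (hm : HModul φ ω) {p : ℕ → ℝ}
    (hp : GoodSeq p) (n : ℕ) (hn : 0 < n) (b : ℝ) (hU : IsTrigPoly n U) :
    ∃ T, IsTrigPoly n T ∧ IntervalIntegrable
      (fun x => (∫ t in (-π)..π, φ (x - t) * (cos (n * t - b) * Pk p t)) - T x) volume (-π) π ∧
      ∫ x in (-π)..π, |(∫ t in (-π)..π, φ (x - t) * (cos (n * t - b) * Pk p t)) - T x| ≤
        2 * (p 0 + 2 * ∑' j, p (2*n+j)) * eN n ω +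
        (π/(2*n)) * ((32 * π * ∑' j, p (j+1)) * ∫ x in (-π)..π, |φ x - U x|) := by
  have hpi := Real.pi_pos
  have hn' : (0:ℝ) < n := by exact_mod_cast hn
  have hPc := Pk_cont hp
  set a : ℝ := π/(2*n) with ha
  have ha0 : 0 ≤ a := by positivity
  set z : ℕ → ℝ := fun i => (b - π/2)/n + i * (π / n) with hz
  set D := ∫ x in (-π)..π, |φ x - U x| with hD
  set τ := ∑' j, p (2*n+j) with hτ
  set S := ∑' j, p (j+1) with hS
  set w1 : ℕ → ℝ → ℝ := fun i s => (-1)^i * sin (n * s) * ((Pk p (z i + s) + Pk p (z i - s))/2) with hw1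
  set w2 : ℕ → ℝ → ℝ := fun i s => (-1)^i * sin (n * s) * ((Pk p (z i + s) - Pk p (z i - s))/2) with hw2
  have hw1c : ∀ i, Continuous (w1 i) := fun i => by rw [hw1]; fun_prop
  have hw2c : ∀ i, Continuous (w2 i) := fun i => by rw [hw2]; fun_prop
  have hU1 : PI1 U := PI1.trig hU
  set φ0 : ℝ → ℝ := fun x => φ x - U x with hφ0
  have h0 : PI1 φ0 := h.sub hU1
  set F : ℝ → ℝ → ℝ := fun x s => ∑ i ∈ Finset.range (2*n),
    (w1 i s * (φ (x - (z i + s)) - φ (x - (z i - s))) +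
      w2 i s * (φ0 (x - (z i + s)) + φ0 (x - (z i - s)))) with hF
  have hTU : IsTrigPoly n (fun x => ∑ i ∈ Finset.range (2*n),
      ((∫ s in (0:ℝ)..a, w2 i s * U (x - (z i + s))) + ∫ s in (0:ℝ)..a, w2 i s * U (x - (z i - s)))) :=
    IsTrigPoly.sum _ fun i _ => (hU.conv ((hw2c i).intervalIntegrable _ _) (by fun_prop)).add
      (hU.conv ((hw2c i).intervalIntegrable _ _) (by fun_prop))
  have ii1 : ∀ {χ : ℝ → ℝ} (_ : PI1 χ) {w : ℝ → ℝ} (_ : Continuous w) (x c : ℝ),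
      IntervalIntegrable (fun s => w s * χ (x - (c + s))) volume 0 a := by
    intro χ hχ w hw x c
    have := hχ.convInt hw (x - c) 0 a
    simpa [mul_comm, sub_sub] using this
  have ii2 : ∀ {χ : ℝ → ℝ} (_ : PI1 χ) {w : ℝ → ℝ} (_ : Continuous w) (x c : ℝ),
      IntervalIntegrable (fun s => w s * χ (x - (c - s))) volume 0 a := by
    intro χ hχ w hw x c
    have := ((hχ.shift (x - c)).ii 0 a).mul_continuousOn hw.continuousOn
    convert this using 2 with s
    rw [mul_comm]; congr 2; ring
  have key : ∀ x, (∫ t in (-π)..π, φ (x - t) * (cos (n * t - b) * Pk p t)) -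
      (∑ i ∈ Finset.range (2*n),
      ((∫ s in (0:ℝ)..a, w2 i s * U (x - (z i + s))) + ∫ s in (0:ℝ)..a, w2 i s * U (x - (z i - s))))
      = ∫ s in (0:ℝ)..a, F x s := by
    intro x
    have hH : PI1 (fun t => φ (x - t) * (cos (n * t - b) * Pk p t)) := by
      refine ⟨fun t => ?_, h.convInt (by fun_prop) x _ _⟩
      simp only []
      have e1 := (h.neg_shift x).1 t
      simp only [] at e1
      have e2 : (n:ℝ) * (t + 2 * π) - b = (n * t - b) + n * (2 * π) := by ring
      rw [e1, e2, Real.cos_add_nat_mul_two_pi, Pk_per p t]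
    rw [cellRep hH n hn ((b - π/2)/n)]
    have e3 : ∀ s, (∑ i ∈ Finset.range (2*n),
        (φ (x - ((b - π/2)/n + i * (π / n) + s)) * (cos (n * ((b - π/2)/n + i * (π / n) + s) - b) *
          Pk p ((b - π/2)/n + i * (π / n) + s)) +
        φ (x - ((b - π/2)/n + i * (π / n) - s)) * (cos (n * ((b - π/2)/n + i * (π / n) - s) - b) *
          Pk p ((b - π/2)/n + i * (π / n) - s)))) =
        F x s + ∑ i ∈ Finset.range (2*n), (w2 i s * U (x - (z i + s)) + w2 i s * U (x - (z i - s))) := by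
      intro s
      rw [hF]
      simp only []
      rw [← Finset.sum_add_distrib]
      refine Finset.sum_congr rfl fun i _ => ?_
      have c2 := cos_node n hn b (-s) i
      rw [← sub_eq_add_neg, mul_neg, Real.sin_neg] at c2
      rw [cos_node n hn b s i, c2]
      rw [hw1, hw2, hz, hφ0]
      simp only []
      ring
    simp only [e3]
    have iU : ∀ i, IntervalIntegrable (fun s => w2 i s * U (x - (z i + s)) + w2 i s * U (x - (z i - s)))
        volume 0 a := fun i => (ii1 hU1 (hw2c i) x (z i)).add (ii2 hU1 (hw2c i) x (z i))
    have iF : IntervalIntegrable (F x) volume 0 a := by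
      have := IntervalIntegrable.sum (Finset.range (2*n)) (μ := volume) (a := 0) (b := a)
        (f := fun i s => (w1 i s * (φ (x - (z i + s)) - φ (x - (z i - s))) +
          w2 i s * (φ0 (x - (z i + s)) + φ0 (x - (z i - s))))) fun i _ => by
            simp only [mul_sub, mul_add]
            exact ((ii1 h (hw1c i) x (z i)).sub (ii2 h (hw1c i) x (z i))).add
              ((ii1 h0 (hw2c i) x (z i)).add (ii2 h0 (hw2c i) x (z i)))
      have e : F x = ∑ i ∈ Finset.range (2*n), (fun s => (w1 i s * (φ (x - (z i + s)) - φ (x - (z i - s))) +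
          w2 i s * (φ0 (x - (z i + s)) + φ0 (x - (z i - s))))) := by funext s; simp [hF]
      rw [e]; exact this
    have iUs : IntervalIntegrable (fun s => ∑ i ∈ Finset.range (2*n),
        (w2 i s * U (x - (z i + s)) + w2 i s * U (x - (z i - s)))) volume 0 a := by
      have := IntervalIntegrable.sum (Finset.range (2*n)) (f := fun i s => w2 i s * U (x - (z i + s)) + w2 i s * U (x - (z i - s))) fun i _ => iU i
      have e : (fun s => ∑ i ∈ Finset.range (2*n),
        (w2 i s * U (x - (z i + s)) + w2 i s * U (x - (z i - s)))) = ∑ i ∈ Finset.range (2*n),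
        (fun s => w2 i s * U (x - (z i + s)) + w2 i s * U (x - (z i - s))) := by funext s; simp
      rw [e]; exact this
    rw [intervalIntegral.integral_add iF iUs, intervalIntegral.integral_finsetSum fun i _ => iU i]
    rw [add_sub_assoc, add_eq_left, sub_eq_zero]
    refine Finset.sum_congr rfl fun i _ => ?_
    rw [intervalIntegral.integral_add (ii1 hU1 (hw2c i) x (z i)) (ii2 hU1 (hw2c i) x (z i))]
  refine ⟨_, hTU, ?_⟩
  simp only [key]
  have hFint : Integrable (fun q : ℝ × ℝ => F q.1 q.2)
      ((volume.restrict (Set.Ioc (-π) π)).prod (volume.restrict (Set.Ioc 0 a))) := by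
    rw [hF]
    refine integrable_finsetSum _ fun i _ => ?_
    simp only [mul_sub, mul_add]
    exact ((prodInt h (hw1c i) (by fun_prop) _ _).sub (prodInt h (hw1c i) (by fun_prop) _ _)).add
      ((prodInt h0 (hw2c i) (by fun_prop) _ _).add (prodInt h0 (hw2c i) (by fun_prop) _ _))
  have hoc := om_cont hω n
  have iN : IntervalIntegrable (fun s => (ω (2*s) * sin (n*s))) volume 0 a := by
    refine ContinuousOn.intervalIntegrable (hoc.mul ?_)
    fun_prop
  have M := minkowski ha0 hFint (N := fun s => 2*n*(p 0 + 2*τ) * (ω (2*s) * sin (n*s)) +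
      (32 * π * S) * D) ?_ ((iN.const_mul _).add (by simp))
  · refine ⟨M.1, M.2.trans (le_of_eq ?_)⟩
    rw [intervalIntegral.integral_add (iN.const_mul _) (by simp), intervalIntegral.integral_const_mul,
      eN_eq n hn, intervalIntegral.integral_const, sub_zero, smul_eq_mul]
    field_simp
  · intro s hs
    have hsin : 0 ≤ sin (n * s) := by
      refine Real.sin_nonneg_of_nonneg_of_le_pi (mul_nonneg hn'.le hs.1) ?_
      calc (n:ℝ) * s ≤ n * a := by gcongr; exact hs.2
        _ = π/2 := by rw [ha]; field_simp
        _ ≤ π := by linarith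
    have hsin1 : sin (n * s) ≤ 1 := Real.sin_le_one _
    have sh : ∀ {χ : ℝ → ℝ} (_ : PI1 χ) (c : ℝ), IntervalIntegrable (fun x => χ (x - c)) volume (-π) π := by
      intro χ hχ c
      simpa [sub_eq_add_neg] using (hχ.shift (-c)).2
    have B := slice_bound (Finset.range (2*n)) (fun i => w1 i s) (fun i => w2 i s)
      (fun _ => ω (2 * s)) (fun _ => 2 * D) (fun i x => φ (x - (z i + s)) - φ (x - (z i - s)))
      (fun i x => φ0 (x - (z i + s)) + φ0 (x - (z i - s)))
      (fun i => (sh h _).sub (sh h _)) (fun i => (sh h0 _).add (sh h0 _))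
      (fun i => by
        have := pdiff h hm (z i + s) (z i - s)
        convert this using 2
        rw [show z i - s - (z i + s) = -(2 * s) by ring, abs_neg, abs_of_nonneg (by linarith [hs.1])])
      (fun i => h0.absInt_add _ _)
    refine B.trans ?_
    rw [Finset.sum_add_distrib, ← Finset.sum_mul, ← Finset.sum_mul]
    have hω0 : 0 ≤ ω (2 * s) := hω.2.2.2.2 _ (by linarith [hs.1])
    have hD0 : 0 ≤ D := intervalIntegral.integral_nonneg (by linarith) fun x _ => abs_nonneg _
    have b1 : ∑ i ∈ Finset.range (2*n), |w1 i s| ≤ sin (n*s) * (2*n*(p 0 + 2*τ)) := by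
      have e : ∀ i, |w1 i s| = sin (n*s) * ((Pk p (z i + s) + Pk p (z i - s))/2) := by
        intro i
        rw [hw1]
        simp only [abs_mul, abs_pow, abs_neg, abs_one, one_pow, one_mul]
        rw [abs_of_nonneg hsin, abs_of_nonneg]
        have := Pk_nonneg hp (z i + s)
        have := Pk_nonneg hp (z i - s)
        positivity
      simp only [e]
      rw [← Finset.mul_sum]
      refine mul_le_mul_of_nonneg_left ?_ hsin
      rw [← Finset.sum_div, Finset.sum_add_distrib]
      have p1 := Pk_alias hp n hn ((b - π/2)/n + s)
      have p2 := Pk_alias hp n hn ((b - π/2)/n - s)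
      have q1 : ∀ i : ℕ, (b - π/2)/n + s + i * (π/n) = z i + s := fun i => by rw [hz]; ring
      have q2 : ∀ i : ℕ, (b - π/2)/n - s + i * (π/n) = z i - s := fun i => by rw [hz]; ring
      simp only [q1] at p1
      simp only [q2] at p2
      linarith
    have b2 : ∑ i ∈ Finset.range (2*n), |w2 i s| ≤ (32 * π * S) / 2 := by
      have e : ∀ i, |w2 i s| ≤ |Pk p (z i + s) - Pk p (z i - s)| / 2 := by
        intro i
        rw [hw2]
        simp only [abs_mul, abs_pow, abs_neg, abs_one, one_pow, one_mul, abs_div, abs_two]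
        rw [abs_of_nonneg hsin]
        exact mul_le_of_le_one_left (by positivity) hsin1
      refine (Finset.sum_le_sum fun i _ => e i).trans ?_
      rw [← Finset.sum_div]
      have := Pk_var hp n hn ((b - π/2)/n) s hs.1 hs.2
      have : ∑ i ∈ Finset.range (2*n), |Pk p (z i + s) - Pk p (z i - s)| ≤ 32 * π * S := this
      linarith
    calc _ ≤ sin (n*s) * (2*n*(p 0 + 2*τ)) * ω (2*s) + (32 * π * S) / 2 * (2 * D) := by gcongr
      _ = _ := by ring


def Qk (ψ : ℝ → ℝ) (b : ℝ) (m : ℕ) (t : ℝ) : ℝ :=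
  (∑ k ∈ Finset.range m, ψ (k+1) * cos ((k+1) * t - b)) -
    ∑ j ∈ Finset.range (2*m+1), ψ ((m+1+(j+1) : ℕ)) * cos ((m - j : ℝ) * t - b)

def Rk (p : ℕ → ℝ) (b : ℝ) (n : ℕ) (t : ℝ) : ℝ :=
  ∑' j, p (2*n+j) * cos (((n+j : ℕ) : ℝ) * t + b)

lemma Qk_trig (ψ : ℝ → ℝ) (b : ℝ) (m : ℕ) : IsTrigPoly (m+1) (Qk ψ b m) := by
  refine IsTrigPoly.sub (IsTrigPoly.sum _ fun k hk => ?_) (IsTrigPoly.sum _ fun j hj => ?_)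
  · refine IsTrigPoly.smul _ ?_
    have := IsTrigPoly.cosPhase (n := m+1) (k := k+1) (by have := Finset.mem_range.1 hk; omega) (-b)
    simpa [sub_eq_add_neg] using this
  · refine IsTrigPoly.smul _ ?_
    have := IsTrigPoly.cosPhaseInt (n := m+1) (k := (m:ℤ) - j)
      (by have := Finset.mem_range.1 hj; omega) (-b)
    simpa [sub_eq_add_neg] using this

lemma psi_decomp (ψ : ℝ → ℝ) (β : ℝ) (m : ℕ) (hnn : ∀ k : ℕ, 0 ≤ ψ (k+1))
    (hs : Summable fun k : ℕ => ψ (k+1)) (hp : GoodSeq fun j => ψ ((m+1+j : ℕ))) (t : ℝ) :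
    PsiKer ψ β t = Qk ψ (β*π/2) m t +
      cos (((m+1 : ℕ):ℝ) * t - β*π/2) * Pk (fun j => ψ ((m+1+j : ℕ))) t -
      Rk (fun j => ψ ((m+1+j : ℕ))) (β*π/2) (m+1) t := by
  set b := β*π/2 with hb
  set p : ℕ → ℝ := fun j => ψ ((m+1+j : ℕ)) with hpd
  have S0 : Summable fun k : ℕ => ψ (k+1) * cos ((k+1) * t - b) :=
    summ_cos hs hnn fun k => (k+1) * t - b
  have S1 : Summable fun j : ℕ => p (j+1) * cos (((m+1+(j+1) : ℕ):ℝ) * t - b) :=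
    summ_cos hp.summ1 (fun j => hp.nonneg _) _
  have S1' : Summable fun j : ℕ => p j * cos (((m+1+j : ℕ):ℝ) * t - b) :=
    summ_cos hp.summ (fun j => hp.nonneg _) _
  have S2 : Summable fun j : ℕ => p (j+1) * cos ((m - j : ℝ) * t - b) :=
    summ_cos hp.summ1 (fun j => hp.nonneg _) fun j => (m - j : ℝ) * t - b
  have e1 : PsiKer ψ β t = (∑ k ∈ Finset.range m, ψ (k+1) * cos ((k+1) * t - b)) +
      ∑' j : ℕ, p j * cos (((m+1+j : ℕ):ℝ) * t - b) := by
    unfold PsiKer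
    rw [← S0.sum_add_tsum_nat_add m]
    congr 2
    funext j
    rw [hpd]
    have : (((j + m : ℕ):ℝ) + 1) = ((m+1+j : ℕ):ℝ) := by push_cast; ring
    rw [this]
  rw [e1, S1'.tsum_eq_zero_add]
  have e2 : cos (((m+1 : ℕ):ℝ) * t - b) * Pk p t = p 0 * cos (((m+1 : ℕ):ℝ) * t - b) +
      ((∑' j : ℕ, p (j+1) * cos (((m+1+(j+1) : ℕ):ℝ) * t - b)) +
        ∑' j : ℕ, p (j+1) * cos ((m - j : ℝ) * t - b)) := by
    rw [← S1.tsum_add S2]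
    unfold Pk
    rw [mul_add, ← mul_assoc, ← tsum_mul_left]
    congr 1
    · ring
    · refine tsum_congr fun j => ?_
      have a1 : (((m+1+(j+1) : ℕ):ℝ) * t - b) = (((m+1 : ℕ):ℝ) * t - b) + ((j+1:ℕ):ℝ) * t := by
        push_cast; ring
      have a2 : ((m - j : ℝ) * t - b) = (((m+1 : ℕ):ℝ) * t - b) - ((j+1:ℕ):ℝ) * t := by
        push_cast; ring
      rw [a1, a2, Real.cos_add, Real.cos_sub _ (((j+1:ℕ):ℝ) * t)]
      ring
  have e3 : ∑' j : ℕ, p (j+1) * cos ((m - j : ℝ) * t - b) =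
      (∑ j ∈ Finset.range (2*m+1), p (j+1) * cos ((m - j : ℝ) * t - b)) + Rk p b (m+1) t := by
    rw [← S2.sum_add_tsum_nat_add (2*m+1)]
    congr 1
    refine tsum_congr fun j => ?_
    have a1 : j + (2*m+1) + 1 = 2*(m+1)+j := by ring
    rw [a1, ← Real.cos_neg]
    congr 2
    push_cast; ring
  have e4 : (∑ j ∈ Finset.range (2*m+1), p (j+1) * cos ((m - j : ℝ) * t - b)) =
    ∑ j ∈ Finset.range (2*m+1), ψ ((m+1+(j+1) : ℕ)) * cos ((m - j : ℝ) * t - b) := rfl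
  rw [e2, e3, e4]
  unfold Qk
  simp only [add_zero]
  ring

lemma Rk_cont {p : ℕ → ℝ} (hp : GoodSeq p) (b : ℝ) (n : ℕ) : Continuous (Rk p b n) := by
  have hs : Summable fun j => p (2*n+j) := by
    simpa [add_comm] using (summable_nat_add_iff (2*n)).2 hp.summ
  exact tsum_cos_cont hs (fun j => hp.nonneg _) (fun j t => ((n+j : ℕ) : ℝ) * t + b)
    (fun j => by fun_prop)

lemma Rk_per (p : ℕ → ℝ) (b : ℝ) (n : ℕ) : Function.Periodic (Rk p b n) (2 * π) := by
  intro t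
  unfold Rk
  refine tsum_congr fun j => ?_
  rw [mul_add, add_right_comm, Real.cos_add_nat_mul_two_pi]

lemma Rk_le {p : ℕ → ℝ} (hp : GoodSeq p) (b : ℝ) (n : ℕ) (t : ℝ) :
    |Rk p b n t| ≤ ∑' j, p (2*n+j) := by
  have hs : Summable fun j => p (2*n+j) := by
    simpa [add_comm] using (summable_nat_add_iff (2*n)).2 hp.summ
  exact tsum_cos_abs_le hs (fun j => hp.nonneg _) fun j => ((n+j : ℕ) : ℝ) * t + b

lemma eN_le {ω : ℝ → ℝ} (hω : IsModulus ω) (n : ℕ) (hn : 0 < n) : |eN n ω| ≤ 10 * ω (1/n) := by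
  have hpi := Real.pi_pos
  have hpi4 := Real.pi_le_four
  have hn' : (0:ℝ) < n := by exact_mod_cast hn
  have h0 := hω.2.2.2.2 (1/n) (by positivity)
  unfold eN
  have : ∀ t ∈ Set.uIoc 0 (π/2), ‖ω (2 * t / n) * sin t‖ ≤ 5 * ω (1/n) := by
    intro t ht
    rw [Set.uIoc_of_le (by positivity)] at ht
    have h1 := om_mul hω (l := 2*t) (t := 1/n) (by linarith [ht.1]) (by positivity)
    rw [mul_one_div] at h1
    have h2 := hω.2.2.2.2 (2 * t / n) (by have := ht.1; positivity)
    rw [norm_mul, Real.norm_eq_abs, Real.norm_eq_abs, abs_of_nonneg h2]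
    have h3 := Real.abs_sin_le_one t
    have h4 : (1 + 2 * t) * ω (1/n) ≤ 5 * ω (1/n) := by
      gcongr; linarith [ht.2]
    exact (mul_le_of_le_one_right h2 h3).trans (h1.trans h4)
  have := intervalIntegral.norm_integral_le_of_norm_le_const this
  rw [Real.norm_eq_abs, sub_zero, abs_of_nonneg (a := π/2) (by positivity)] at this
  refine this.trans ?_
  have : 5 * ω (1/n) * (π/2) ≤ 5 * ω (1/n) * 2 := by gcongr; linarith
  linarith

lemma EnL1_le {n : ℕ} {f T : ℝ → ℝ} (hT : IsTrigPoly n T) : EnL1 n f ≤ ∫ x in (-π)..π, |f x - T x| := by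
  have hpi := Real.pi_pos
  refine csInf_le ⟨0, ?_⟩ ⟨T, hT, rfl⟩
  rintro e ⟨U, _, rfl⟩
  exact intervalIntegral.integral_nonneg (by linarith) fun x _ => abs_nonneg _

lemma upper {ψ ω f : ℝ → ℝ} (β : ℝ) (m : ℕ) (hm1 : 1 ≤ m) (hnn : ∀ k : ℕ, 0 ≤ ψ (k+1))
    (hs : Summable fun k : ℕ => ψ (k+1)) (hp : GoodSeq fun j => ψ ((m+1+j : ℕ)))
    (hω : IsModulus ω) (hf : f ∈ L1Class ψ β ω) :
    EnL1 (m+1) f ≤ (2/π) * ψ ((m+1 : ℕ)) * eN (m+1) ω +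
      4000 * ((∑' j, ψ ((m+1+(2*(m+1)+j) : ℕ))) + (∑' j, ψ ((m+1+(j+1) : ℕ))) / (m+1 : ℕ)) *
        ω (1 / (m+1 : ℕ)) := by
  have hpi := Real.pi_pos
  obtain ⟨hfi, hfp, a0, φ, hφi, hφp, hφ0, hφm, hae⟩ := hf
  have h : PI1 φ := ⟨hφp, hφi⟩
  have hm : HModul φ ω := fun t => hφm |t| (abs_nonneg _) t le_rfl
  obtain ⟨U, hU, hUD⟩ := jackson hω h hm (m+1) (by omega)
  obtain ⟨TB, hTB, hTBi, hTBl⟩ := upperB hω h hm hp (m+1) (by omega) (β*π/2) hU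
  set p : ℕ → ℝ := fun j => ψ ((m+1+j : ℕ)) with hpd
  set R := Rk p (β*π/2) (m+1) with hR
  have hRc : Continuous R := Rk_cont hp _ _
  have hQ := Qk_trig ψ (β*π/2) m
  set Q := Qk ψ (β*π/2) m with hQd
  have hU1 := PI1.trig hU
  have h0 : PI1 (fun x => φ x - U x) := h.sub hU1
  have hPc := Pk_cont hp
  have hUR : IsTrigPoly (m+1) (fun x => ∫ t in (-π)..π, R t * U (x - t)) :=
    hU.conv (hRc.intervalIntegrable _ _) (continuous_id' (X := ℝ))
  have hT : IsTrigPoly (m+1) (fun x => a0/2 + (1/π) * (((∫ t in (-π)..π, φ (x - t) * Q t) + TB x) -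
      ∫ t in (-π)..π, R t * U (x - t))) :=
    (IsTrigPoly.const (by omega) _).add ((((convTrig h hQ).add hTB).sub hUR).smul _)
  refine (EnL1_le hT).trans ?_
  set τ := ∑' j, p (2*(m+1)+j) with hτ
  set S := ∑' j, p (j+1) with hS
  set D := ∫ x in (-π)..π, |φ x - U x| with hD
  set E1 : ℝ → ℝ := fun x => (∫ t in (-π)..π, φ (x - t) * (cos (((m+1:ℕ):ℝ) * t - β*π/2) * Pk p t)) - TB x with hE1
  have M := minkowski (F := fun x t => R t * (φ (x - t) - U (x - t))) (c := -π) (d := π) (by linarith)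
    (prodInt h0 hRc (continuous_id' (X := ℝ)) _ _) (N := fun _ => τ * D) (by
      intro t _
      simp only [abs_mul]
      rw [intervalIntegral.integral_const_mul, h0.absInt_shift t]
      have := Rk_le hp (β*π/2) (m+1) t
      have hD0 : 0 ≤ D := intervalIntegral.integral_nonneg (by linarith) fun x _ => abs_nonneg _
      gcongr) (by simp)
  set E2 : ℝ → ℝ := fun x => ∫ t in (-π)..π, R t * (φ (x - t) - U (x - t)) with hE2
  have key : ∀ᵐ x : ℝ, f x - (a0/2 + (1/π) * (((∫ t in (-π)..π, φ (x - t) * Q t) + TB x) -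
      ∫ t in (-π)..π, R t * U (x - t))) = (1/π) * (E1 x - E2 x) := by
    filter_upwards [hae] with x hx
    have e0 : ∫ t in (-π)..π, φ (x - t) * PsiKer ψ β t = (∫ t in (-π)..π, φ (x - t) * Q t) +
        (∫ t in (-π)..π, φ (x - t) * (cos (((m+1:ℕ):ℝ) * t - β*π/2) * Pk p t)) -
        ∫ t in (-π)..π, φ (x - t) * R t := by
      rw [← intervalIntegral.integral_add (h.convInt hQ.continuous x _ _)
        (h.convInt (by fun_prop) x _ _), ← intervalIntegral.integral_sub
        ((h.convInt hQ.continuous x _ _).add (h.convInt (by fun_prop) x _ _)) (h.convInt hRc x _ _)]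
      refine intervalIntegral.integral_congr fun t _ => ?_
      rw [psi_decomp ψ β m hnn hs hp t]
      ring
    have e2 : E2 x = (∫ t in (-π)..π, φ (x - t) * R t) - ∫ t in (-π)..π, R t * U (x - t) := by
      have := hU1.convInt hRc x (-π) π
      simp only [mul_comm (U _)] at this
      rw [← intervalIntegral.integral_sub (h.convInt hRc x _ _) this]
      refine intervalIntegral.integral_congr fun t _ => ?_
      ring
    rw [hx, e0, e2, hE1]
    ring
  have e1 : ∫ x in (-π)..π, |f x - (a0/2 + (1/π) * (((∫ t in (-π)..π, φ (x - t) * Q t) + TB x) -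
      ∫ t in (-π)..π, R t * U (x - t)))| = ∫ x in (-π)..π, (1/π) * |E1 x - E2 x| := by
    refine intervalIntegral.integral_congr_ae ?_
    filter_upwards [key] with x hx _
    rw [hx, abs_mul, abs_of_pos (by positivity : 0 < 1/π)]
  rw [e1, intervalIntegral.integral_const_mul]
  have e3 : ∫ x in (-π)..π, |E1 x - E2 x| ≤ (∫ x in (-π)..π, |E1 x|) + ∫ x in (-π)..π, |E2 x| := by
    rw [← intervalIntegral.integral_add hTBi.abs M.1.abs]
    exact intervalIntegral.integral_mono_on (by linarith) (hTBi.sub M.1).abs (hTBi.abs.add M.1.abs)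
      fun x _ => abs_sub _ _
  have e4 := M.2
  rw [intervalIntegral.integral_const, smul_eq_mul] at e4
  have heN := (le_abs_self _).trans (eN_le hω (m+1) (by omega))
  set o := ω (1 / (m+1:ℕ)) with ho
  set e := eN (m+1) ω with he
  have ho0 : 0 ≤ o := hω.2.2.2.2 _ (by positivity)
  have hτ0 : 0 ≤ τ := tsum_nonneg fun j => hp.nonneg _
  have hS0 : 0 ≤ S := tsum_nonneg fun j => hp.nonneg _
  have hp0 : p 0 = ψ ((m+1:ℕ)) := rfl
  set N : ℝ := ((m+1:ℕ):ℝ) with hN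
  have hN0 : 0 < N := by positivity
  have p3 := Real.pi_lt_d2
  have p4 := Real.pi_gt_three
  change _ ≤ (2/π) * ψ N * e + 4000 * (τ + S / N) * o
  rw [← hp0]
  calc (1/π) * ∫ x in (-π)..π, |E1 x - E2 x|
      ≤ (1/π) * ((2 * (p 0 + 2 * τ) * e + (π/(2*N)) * ((32 * π * S) * D)) + (π - -π) * (τ * D)) := by
        gcongr; linarith
    _ ≤ (1/π) * ((2 * p 0 * e + 4 * τ * (10 * o) + (π/(2*N)) * ((32 * π * S) * (50 * o))) + (π - -π) * (τ * (50 * o))) := by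
        have : 4 * τ * e ≤ 4 * τ * (10 * o) := by gcongr
        have : 2 * (p 0 + 2 * τ) * e ≤ 2 * p 0 * e + 4 * τ * (10 * o) := by linarith
        have : (0:ℝ) ≤ π - -π := by linarith
        gcongr
    _ = (2/π) * p 0 * e + (40/π + 100) * τ * o + (800 * π) * (S/N) * o := by
        field_simp; ring
    _ ≤ (2/π) * p 0 * e + 4000 * τ * o + 4000 * (S/N) * o := by
        have : 40/π ≤ 40 := div_le_self (by norm_num) (by linarith)
        gcongr <;> linarith
    _ = _ := by ring


lemma conc_diff {ω : ℝ → ℝ} (hc : ConcaveOn ℝ (Set.Ici 0) ω) {u v c : ℝ} (hu : 0 ≤ u) (huv : u ≤ v)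
    (hc0 : 0 ≤ c) : ω (v + c) - ω v ≤ ω (u + c) - ω u := by
  rcases eq_or_lt_of_le (by linarith : 0 ≤ v + c - u) with hd | hd
  · have h1 : v = u := by linarith
    rw [h1]
  · have hu' : u ∈ Set.Ici (0:ℝ) := hu
    have hv' : v + c ∈ Set.Ici (0:ℝ) := Set.mem_Ici.2 (by linarith)
    have hvu : 0 ≤ v - u := by linarith
    have k1 := hc.2 hu' hv' (by positivity : 0 ≤ c/(v+c-u)) (by positivity : 0 ≤ (v-u)/(v+c-u))
      (by rw [← add_div]; rw [div_eq_one_iff_eq hd.ne']; ring)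
    have k2 := hc.2 hu' hv' (by positivity : 0 ≤ (v-u)/(v+c-u)) (by positivity : 0 ≤ c/(v+c-u))
      (by rw [← add_div]; rw [div_eq_one_iff_eq hd.ne']; ring)
    simp only [smul_eq_mul] at k1 k2
    have e1 : c/(v+c-u) * u + (v-u)/(v+c-u) * (v+c) = v := by field_simp; ring
    have e2 : (v-u)/(v+c-u) * u + c/(v+c-u) * (v+c) = u + c := by field_simp; ring
    rw [e1] at k1
    rw [e2] at k2
    have e3 : c/(v+c-u) = 1 - (v-u)/(v+c-u) := by field_simp; ring
    rw [e3] at k1 k2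
    linarith

def gE (ω : ℝ → ℝ) (a ε u : ℝ) : ℝ :=
  if max u 0 ≤ a then (ω (2 * max u 0 + 2 * ε) - ω (2 * max u 0)) / (4 * ε) else 0

def phE (ω : ℝ → ℝ) (a ε x : ℝ) : ℝ := gE ω a ε (arccos (cos x))

lemma om_sub_nonneg {ω : ℝ → ℝ} (hω : IsModulus ω) {u c : ℝ} (hu : 0 ≤ u) (hc : 0 ≤ c) :
    0 ≤ ω (u + c) - ω u :=
  sub_nonneg.2 (hω.2.1 hu (Set.mem_Ici.2 (by linarith)) (by linarith))

lemma gE_nonneg {ω : ℝ → ℝ} (hω : IsModulus ω) {a ε : ℝ} (hε : 0 < ε) (u : ℝ) : 0 ≤ gE ω a ε u := by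
  unfold gE
  split_ifs
  · exact div_nonneg (om_sub_nonneg hω (by positivity) (by positivity)) (by positivity)
  · exact le_rfl

lemma gE_anti {ω : ℝ → ℝ} (hω : IsModulus ω) (hc : ConcaveOn ℝ (Set.Ici 0) ω) {a ε : ℝ} (hε : 0 < ε) :
    Antitone (gE ω a ε) := by
  intro u v huv
  by_cases hv : max v 0 ≤ a
  · have hm : max u 0 ≤ max v 0 := max_le_max_right 0 huv
    have hu : max u 0 ≤ a := hm.trans hv
    unfold gE
    rw [if_pos hv, if_pos hu]
    gcongr ?_ / _
    exact conc_diff hc (by positivity) (by linarith) (by positivity)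
  · have : gE ω a ε v = 0 := if_neg hv
    rw [this]; exact gE_nonneg hω hε u

lemma phE_PI1 {ω : ℝ → ℝ} (hω : IsModulus ω) (hc : ConcaveOn ℝ (Set.Ici 0) ω) {a ε : ℝ} (hε : 0 < ε) :
    PI1 (phE ω a ε) := by
  refine ⟨fun x => by unfold phE; rw [Real.cos_add_two_pi], ?_⟩
  have hmeas : Measurable (phE ω a ε) := by
    unfold phE
    exact (gE_anti hω hc hε).measurable.comp (by fun_prop)
  rw [intervalIntegrable_iff]
  refine Measure.integrableOn_of_bounded (M := gE ω a ε 0) (by simp) hmeas.aestronglyMeasurable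
    (Eventually.of_forall fun x => ?_)
  unfold phE
  rw [Real.norm_eq_abs, abs_of_nonneg (gE_nonneg hω hε _)]
  exact gE_anti hω hc hε (Real.arccos_nonneg _)

lemma phE_even {ω : ℝ → ℝ} {a ε : ℝ} (x : ℝ) : phE ω a ε (-x) = phE ω a ε x := by
  unfold phE; rw [Real.cos_neg]

lemma phE_mono {ω : ℝ → ℝ} (hω : IsModulus ω) (hc : ConcaveOn ℝ (Set.Ici 0) ω) {a ε : ℝ} (hε : 0 < ε)
    {x y : ℝ} (h : cos x ≤ cos y) : phE ω a ε x ≤ phE ω a ε y :=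
  gE_anti hω hc hε (Real.antitone_arccos h)

lemma even_int {f : ℝ → ℝ} (hf : ∀ x, f (-x) = f x) {c : ℝ} (hi : IntervalIntegrable f volume (-c) 0)
    (hi' : IntervalIntegrable f volume 0 c) : ∫ x in (-c)..c, f x = 2 * ∫ x in (0:ℝ)..c, f x := by
  rw [← intervalIntegral.integral_add_adjacent_intervals hi hi']
  have := intervalIntegral.integral_comp_neg (a := 0) (b := c) f
  simp only [hf, neg_zero] at this
  rw [← this]; ring

lemma ii_of_cont {ω : ℝ → ℝ} (hω : IsModulus ω) {u v : ℝ} (hu : 0 ≤ u) (hv : 0 ≤ v) :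
    IntervalIntegrable ω volume u v := by
  refine ContinuousOn.intervalIntegrable (hω.1.mono fun x hx => ?_)
  exact le_trans (le_min hu hv) hx.1

lemma avg_bound {ω : ℝ → ℝ} (hω : IsModulus ω) {ε d : ℝ} (hε : 0 < ε) (hd : 0 ≤ d) :
    ∫ u in (0:ℝ)..d, (ω (2 * u + 2 * ε) - ω (2 * u)) / (4 * ε) ≤ ω (2 * d) / 4 := by
  have i1 : IntervalIntegrable (fun u => ω (2 * u + 2 * ε)) volume 0 d := by
    refine ContinuousOn.intervalIntegrable (hω.1.comp (by fun_prop) fun x hx => ?_)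
    rw [Set.uIcc_of_le hd] at hx
    exact Set.mem_Ici.2 (by linarith [hx.1])
  have i2 : IntervalIntegrable (fun u => ω (2 * u)) volume 0 d := by
    refine ContinuousOn.intervalIntegrable (hω.1.comp (by fun_prop) fun x hx => ?_)
    rw [Set.uIcc_of_le hd] at hx
    exact Set.mem_Ici.2 (by linarith [hx.1])
  rw [intervalIntegral.integral_div, intervalIntegral.integral_sub i1 i2,
    intervalIntegral.integral_comp_mul_add (fun x => ω x) (by norm_num : (2:ℝ) ≠ 0),
    intervalIntegral.integral_comp_mul_left (fun x => ω x) (by norm_num : (2:ℝ) ≠ 0)]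
  simp only [mul_zero, zero_add, smul_eq_mul]
  have hI : ∀ u v : ℝ, 0 ≤ u → 0 ≤ v → IntervalIntegrable ω volume u v := fun u v => ii_of_cont hω
  have A1 := intervalIntegral.integral_add_adjacent_intervals (hI 0 (2*ε) le_rfl (by positivity))
    (hI (2*ε) (2*d+2*ε) (by positivity) (by positivity))
  have A2 := intervalIntegral.integral_add_adjacent_intervals (hI 0 (2*d) le_rfl (by positivity))
    (hI (2*d) (2*d+2*ε) (by positivity) (by positivity))
  have B : ∫ v in (2*d)..(2*d+2*ε), ω v ≤ (∫ v in (0:ℝ)..(2*ε), ω v) + 2 * ε * ω (2*d) := by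
    have e := intervalIntegral.integral_comp_add_left (a := 0) (b := 2*ε) ω (2*d)
    rw [add_zero] at e
    rw [← e]
    have i3 : IntervalIntegrable (fun v => ω (2*d+v)) volume 0 (2*ε) := by
      refine ContinuousOn.intervalIntegrable (hω.1.comp (by fun_prop) fun x hx => ?_)
      rw [Set.uIcc_of_le (by positivity)] at hx
      exact Set.mem_Ici.2 (by linarith [hx.1])
    have := intervalIntegral.integral_mono_on (by positivity : (0:ℝ) ≤ 2*ε) i3
      ((hI 0 (2*ε) le_rfl (by positivity)).add (intervalIntegrable_const (c := ω (2*d)))) fun v hv => by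
        have := hω.2.2.1 (2*d) v (by positivity) hv.1
        linarith
    rw [intervalIntegral.integral_add (hI 0 (2*ε) le_rfl (by positivity)) intervalIntegrable_const,
      intervalIntegral.integral_const, smul_eq_mul] at this
    linarith
  rw [div_le_iff₀ (by positivity)]
  linarith

lemma phE_eq {ω : ℝ → ℝ} {a ε x : ℝ} (h0 : 0 ≤ x) (h1 : x ≤ π) :
    phE ω a ε x = if x ≤ a then (ω (2 * x + 2 * ε) - ω (2 * x)) / (4 * ε) else 0 := by
  unfold phE gE
  rw [Real.arccos_cos h0 h1, max_eq_left h0]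

lemma phE_mod1 {ω : ℝ → ℝ} (hω : IsModulus ω) (hc : ConcaveOn ℝ (Set.Ici 0) ω) {a ε : ℝ} (hε : 0 < ε)
    {h : ℝ} (h0 : 0 ≤ h) (h1 : h ≤ 2 * π) :
    ∫ x in (-π)..π, |phE ω a ε (x + h) - phE ω a ε x| ≤ ω h := by
  have hpi := Real.pi_pos
  have P := phE_PI1 hω hc (a := a) hε
  set φ := phE ω a ε with hφ
  set d := h/2 with hd
  have e1 : ∫ x in (-π)..π, |φ (x + h) - φ x| = ∫ x in (-π)..π, |φ (x + d) - φ (x - d)| := by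
    have := per_int_shift (g := fun x => |φ (x + h) - φ x|) (fun x => by
      simp only []
      have := P.1 (x + h)
      rw [P.1 x, ← this]; congr 3; ring) (-d)
    rw [← this]
    refine intervalIntegral.integral_congr fun x _ => ?_
    show |φ (x + -d + h) - φ (x + -d)| = |φ (x + d) - φ (x - d)|
    congr 3
    rw [hd]; ring
  have ip := P.shift d
  have im := P.shift (-d)
  simp only [← sub_eq_add_neg] at im
  have hPi := ip.sub im
  rw [e1, even_int (fun x => by
    rw [show -x + d = -(x - d) by ring, show -x - d = -(x + d) by ring]
    rw [hφ, phE_even, phE_even, abs_sub_comm]) (hPi.ii _ _).abs (hPi.ii _ _).abs]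
  have e2 : ∫ x in (0:ℝ)..π, |φ (x + d) - φ (x - d)| = ∫ x in (0:ℝ)..π, (φ (x - d) - φ (x + d)) := by
    refine intervalIntegral.integral_congr fun x hx => ?_
    rw [Set.uIcc_of_le hpi.le] at hx
    show |φ (x + d) - φ (x - d)| = (φ (x - d) - φ (x + d))
    rw [abs_sub_comm, abs_of_nonneg]
    rw [sub_nonneg]
    refine phE_mono hω hc hε ?_
    rw [Real.cos_add, Real.cos_sub]
    have s1 := Real.sin_nonneg_of_nonneg_of_le_pi hx.1 hx.2
    have s2 := Real.sin_nonneg_of_nonneg_of_le_pi (by positivity : 0 ≤ d) (by rw [hd]; linarith)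
    nlinarith
  rw [e2, intervalIntegral.integral_sub (im.ii _ _) (ip.ii _ _),
    intervalIntegral.integral_comp_sub_right, intervalIntegral.integral_comp_add_right, zero_sub, zero_add]
  have a1 := intervalIntegral.integral_add_adjacent_intervals (P.ii (-d) d) (P.ii d (π - d))
  have a2 := intervalIntegral.integral_add_adjacent_intervals (P.ii d (π - d)) (P.ii (π - d) (π + d))
  have a3 : 0 ≤ ∫ x in (π - d)..(π + d), φ x :=
    intervalIntegral.integral_nonneg (by linarith) fun x _ => gE_nonneg hω hε _
  have a4 := even_int (f := φ) phE_even (P.ii (-d) 0) (P.ii 0 d)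
  have a5 : ∫ x in (0:ℝ)..d, φ x ≤ ω (2 * d) / 4 := by
    refine le_trans ?_ (avg_bound hω hε (by positivity))
    refine intervalIntegral.integral_mono_on (by positivity) (P.ii 0 d) ?_ fun x hx => ?_
    · refine ContinuousOn.intervalIntegrable (ContinuousOn.div_const (ContinuousOn.sub
        (hω.1.comp (by fun_prop) fun x hx => ?_) (hω.1.comp (by fun_prop) fun x hx => ?_)) _) <;>
      · rw [Set.uIcc_of_le (by positivity)] at hx
        exact Set.mem_Ici.2 (by linarith [hx.1])
    · rw [hφ, phE_eq hx.1 (by linarith [hx.2])]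
      split_ifs
      · exact le_rfl
      · exact div_nonneg (om_sub_nonneg hω (by linarith [hx.1]) (by positivity)) (by positivity)
  have : 2 * d = h := by rw [hd]; ring
  rw [this] at a5
  linarith

lemma phE_mod {ω : ℝ → ℝ} (hω : IsModulus ω) (hc : ConcaveOn ℝ (Set.Ici 0) ω) {a ε : ℝ} (hε : 0 < ε)
    (h : ℝ) : ∫ x in (-π)..π, |phE ω a ε (x + h) - phE ω a ε x| ≤ ω |h| := by
  have hpi := Real.pi_pos
  have P := phE_PI1 hω hc (a := a) hε
  set φ := phE ω a ε with hφ
  have pos : ∀ h : ℝ, 0 ≤ h → ∫ x in (-π)..π, |φ (x + h) - φ x| ≤ ω h := by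
    intro h h0
    set k := ⌊h / (2*π)⌋₊ with hk
    have k1 : (k:ℝ) * (2*π) ≤ h := by
      have := Nat.floor_le (div_nonneg h0 (by positivity : 0 ≤ 2*π))
      rwa [le_div_iff₀ (by positivity)] at this
    have k2 : h < (k+1) * (2*π) := by
      have := Nat.lt_floor_add_one (h / (2*π))
      rwa [div_lt_iff₀ (by positivity)] at this
    have := phE_mod1 hω hc (a := a) hε (h := h - k * (2*π)) (by linarith) (by linarith)
    have e : ∀ x, phE ω a ε (x + (h - k * (2*π))) = φ (x + h) := by
      intro x
      have := P.1.sub_nat_mul_eq k (x := x + h)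
      rw [← this, add_sub_assoc]
    simp only [e] at this
    refine this.trans (hω.2.1 (Set.mem_Ici.2 (by linarith)) (Set.mem_Ici.2 h0) ?_)
    have : 0 ≤ (k:ℝ) * (2*π) := by positivity
    linarith
  rcases le_or_gt 0 h with h0 | h0
  · rw [abs_of_nonneg h0]; exact pos h h0
  · rw [abs_of_neg h0]
    refine le_trans (le_of_eq ?_) (pos (-h) (by linarith))
    have := per_int_shift (g := fun x => |φ (x + -h) - φ x|) (fun x => by
      simp only []
      have := P.1 (x + -h)
      rw [P.1 x, ← this]; congr 3; ring) h
    rw [← this]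
    refine intervalIntegral.integral_congr fun x _ => ?_
    simp only [add_neg_cancel_right]
    rw [abs_sub_comm]


lemma cos_taylor (x : ℝ) {y : ℝ} (h0 : 0 ≤ y) (h1 : y ≤ 1) :
    y * sin x - y ^ 2 ≤ cos (x - y) - cos x := by
  have c1 := Real.one_sub_sq_div_two_le_cos (x := y)
  have c2 := Real.cos_le_one y
  have s1 : y - y ^ 3 / 4 ≤ sin y := by
    rcases eq_or_lt_of_le h0 with h | h
    · rw [← h]; simp
    · have := Real.sin_gt_sub_cube h
      have : 0 < y^3 := by positivity
      linarith
  have s2 := Real.sin_le h0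
  have hx1 := Real.cos_le_one x
  have hx2 := Real.neg_one_le_sin x
  have hx3 := Real.sin_le_one x
  rw [Real.cos_sub]
  have a1 : cos x * (1 - cos y) ≤ 1 * (y^2/2) := by
    have : cos x * (1 - cos y) ≤ 1 * (1 - cos y) := by gcongr
    linarith
  have a2 : sin x * (y - sin y) ≤ 1 * (y^3/4) := by
    have : sin x * (y - sin y) ≤ 1 * (y - sin y) := by gcongr
    linarith
  have a3 : y^3 ≤ y^2 := by nlinarith [sq_nonneg y]
  nlinarith [sq_nonneg y]

lemma phE_coef {ω : ℝ → ℝ} (hω : IsModulus ω) (hc : ConcaveOn ℝ (Set.Ici 0) ω) (n : ℕ) (hn : 0 < n)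
    {ε : ℝ} (hε : 0 < ε) (hεa : ε ≤ π/(2*n)) (hε1 : n * ε ≤ 1) :
    eN n ω / 2 - (n * ω π / 2 + n^2 * ω π * π / 2) * ε - ω (2 * ε) / 2 ≤
      ∫ x in (-π)..π, phE ω (π/(2*n)) ε x * cos (n * x) := by
  have hpi := Real.pi_pos
  have hn' : (0:ℝ) < n := by exact_mod_cast hn
  have hn1 : (1:ℝ) ≤ n := by exact_mod_cast hn
  have P := phE_PI1 hω hc (a := π/(2*n)) hε
  set a := π/(2*n) with ha
  have hna : n * a = π/2 := by rw [ha]; field_simp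
  have ha0 : 0 < a := by positivity
  have haπ : a ≤ π/2 := by rw [← hna]; nlinarith
  set φ := phE ω a ε with hφ
  have hM0 : 0 ≤ ω π := hω.2.2.2.2 _ hpi.le
  have Pc : ∀ u v, IntervalIntegrable (fun x => φ x * cos (n * x)) volume u v := fun u v =>
    (P.ii u v).mul_continuousOn (by fun_prop)
  have CW : ∀ {w : ℝ → ℝ} (_ : Continuous w) {u v : ℝ} (_ : 0 ≤ u) (_ : 0 ≤ v),
      IntervalIntegrable (fun x => ω (2 * x) * w x) volume u v := by
    intro w hw u v hu hv
    refine ContinuousOn.intervalIntegrable (ContinuousOn.mul (hω.1.comp (by fun_prop) fun x hx => ?_)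
      hw.continuousOn)
    exact Set.mem_Ici.2 (by linarith [le_trans (le_min hu hv) hx.1])
  have e1 : ∫ x in (-π)..π, φ x * cos (n * x) = 2 * ∫ x in (0:ℝ)..a, φ x * cos (n * x) := by
    rw [even_int (fun x => by rw [hφ, phE_even, mul_neg, Real.cos_neg]) (Pc _ _) (Pc _ _),
      ← intervalIntegral.integral_add_adjacent_intervals (Pc 0 a) (Pc a π)]
    rw [intervalIntegral.integral_zero_ae (a := a) (b := π), add_zero]
    refine Eventually.of_forall fun x hx => ?_
    rw [Set.uIoc_of_le (by linarith)] at hx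
    rw [hφ, phE_eq (by linarith [hx.1]) hx.2, if_neg (by linarith [hx.1]), zero_mul]
  have e2 : ∫ x in (0:ℝ)..a, φ x * cos (n * x) =
      (∫ x in (0:ℝ)..a, (ω (2 * (x + ε)) * cos (n * (x + ε - ε)) - ω (2 * x) * cos (n * x))) / (4 * ε) := by
    rw [← intervalIntegral.integral_div]
    refine intervalIntegral.integral_congr fun x hx => ?_
    rw [Set.uIcc_of_le ha0.le] at hx
    show φ x * cos (n * x) = _
    rw [hφ, phE_eq hx.1 (by linarith [hx.2]), if_pos hx.2, add_sub_cancel_right, mul_add]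
    ring
  have i1 : IntervalIntegrable (fun x => ω (2 * (x + ε)) * cos (n * (x + ε - ε))) volume 0 a := by
    have := (CW (w := fun v => cos (n * (v - ε))) (by fun_prop) hε.le (by positivity : 0 ≤ a + ε)).comp_add_right ε
    simpa using this
  rw [intervalIntegral.integral_sub i1 (CW (w := fun v => cos (n * v)) (by fun_prop) le_rfl ha0.le),
    intervalIntegral.integral_comp_add_right (fun v => ω (2 * v) * cos (n * (v - ε))), zero_add] at e2
  have c1 : Continuous fun v : ℝ => cos (n * (v - ε)) := by fun_prop
  have c2 : Continuous fun v : ℝ => cos (n * v) := by fun_prop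
  have c3 : Continuous fun v : ℝ => sin (n * v) := by fun_prop
  have A1 := intervalIntegral.integral_add_adjacent_intervals (CW c1 hε.le ha0.le)
    (CW c1 ha0.le (by positivity : 0 ≤ a + ε))
  have A2 := intervalIntegral.integral_add_adjacent_intervals (CW c2 le_rfl hε.le) (CW c2 hε.le ha0.le)
  have A3 := intervalIntegral.integral_add_adjacent_intervals (CW c3 le_rfl hε.le) (CW c3 hε.le ha0.le)
  rw [eN_eq n hn] at A3
  have B1 : 0 ≤ ∫ v in a..(a+ε), ω (2 * v) * cos (n * (v - ε)) := by
    refine intervalIntegral.integral_nonneg (by linarith) fun v hv => ?_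
    refine mul_nonneg (hω.2.2.2.2 _ (by linarith [hv.1])) (Real.cos_nonneg_of_neg_pi_div_two_le_of_le ?_ ?_)
    · have : 0 ≤ n * (v - ε) := mul_nonneg hn'.le (by linarith [hv.1])
      linarith
    · rw [← hna]; gcongr; linarith [hv.2]
  have bound : ∀ {w : ℝ → ℝ} (_ : Continuous w) (_ : ∀ v, w v ≤ 1) (C : ℝ) (_ : ω (2 * ε) ≤ C),
      ∫ v in (0:ℝ)..ε, ω (2 * v) * w v ≤ ε * C := by
    intro w hw hw1 C hC
    have := intervalIntegral.integral_mono_on hε.le (CW hw le_rfl hε.le)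
      (intervalIntegrable_const (c := C)) fun v hv => by
        have m1 := hω.2.2.2.2 (2 * v) (by linarith [hv.1])
        have m2 : ω (2 * v) ≤ ω (2 * ε) := hω.2.1 (Set.mem_Ici.2 (by linarith [hv.1]))
          (Set.mem_Ici.2 (by linarith)) (by linarith [hv.2])
        exact (mul_le_of_le_one_right m1 (hw1 v)).trans (m2.trans hC)
    rwa [intervalIntegral.integral_const, smul_eq_mul, sub_zero] at this
  have hωπ : ω (2 * ε) ≤ ω π := hω.2.1 (Set.mem_Ici.2 (by linarith)) (Set.mem_Ici.2 hpi.le) (by linarith)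
  have B2 := bound c2 (fun v => Real.cos_le_one _) _ le_rfl
  have B3 := bound c3 (fun v => Real.sin_le_one _) _ hωπ
  have B4 : (n * ε) * (∫ v in ε..a, ω (2 * v) * sin (n * v)) - (a - ε) * (ω π * (n * ε)^2) ≤
      (∫ v in ε..a, ω (2 * v) * cos (n * (v - ε))) - ∫ v in ε..a, ω (2 * v) * cos (n * v) := by
    rw [← intervalIntegral.integral_sub (CW c1 hε.le ha0.le) (CW c2 hε.le ha0.le),
      ← intervalIntegral.integral_const_mul]
    have k := intervalIntegral.integral_const (a := ε) (b := a) (ω π * (n * ε)^2)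
    rw [smul_eq_mul] at k
    rw [← k, ← intervalIntegral.integral_sub ((CW c3 hε.le ha0.le).const_mul _) intervalIntegrable_const]
    refine intervalIntegral.integral_mono_on hεa (((CW c3 hε.le ha0.le).const_mul _).sub intervalIntegrable_const)
      ((CW c1 hε.le ha0.le).sub (CW c2 hε.le ha0.le)) fun v hv => ?_
    have t := cos_taylor (n * v) (y := n * ε) (by positivity) hε1
    rw [← mul_sub] at t
    have m1 := hω.2.2.2.2 (2 * v) (by linarith [hv.1])
    have m2 : ω (2 * v) ≤ ω π := hω.2.1 (Set.mem_Ici.2 (by linarith [hv.1]))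
          (Set.mem_Ici.2 hpi.le) (by linarith [hv.2])
    have m3 := mul_le_mul_of_nonneg_left t m1
    have m4 : ω (2 * v) * (n * ε)^2 ≤ ω π * (n * ε)^2 := by gcongr
    nlinarith
  have C1 : eN n ω / n - ε * ω π ≤ ∫ v in ε..a, ω (2 * v) * sin (n * v) := by linarith
  have C2 : (n * ε) * (eN n ω / n - ε * ω π) ≤ (n * ε) * ∫ v in ε..a, ω (2 * v) * sin (n * v) := by gcongr
  have C3 : (a - ε) * (ω π * (n * ε)^2) ≤ π * (ω π * (n * ε)^2) := by gcongr; linarith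
  have D : (n * ε) * (eN n ω / n - ε * ω π) - π * (ω π * (n * ε)^2) - ε * ω (2 * ε) ≤
      (∫ v in ε..(a+ε), ω (2 * v) * cos (n * (v - ε))) - ∫ v in (0:ℝ)..a, ω (2 * v) * cos (n * v) := by
    linarith
  rw [e1, e2, ← mul_div_assoc, le_div_iff₀ (by positivity)]
  refine le_trans (le_of_eq ?_) (mul_le_mul_of_nonneg_left D (by norm_num : (0:ℝ) ≤ 2))
  field_simp
  ring

lemma phE_coef_lim {ω : ℝ → ℝ} (hω : IsModulus ω) (hc : ConcaveOn ℝ (Set.Ici 0) ω) (n : ℕ) (hn : 0 < n)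
    {η : ℝ} (hη : 0 < η) : ∃ ε > 0, eN n ω / 2 - η ≤
      ∫ x in (-π)..π, phE ω (π/(2*n)) ε x * cos (n * x) := by
  have hpi := Real.pi_pos
  have hn' : (0:ℝ) < n := by exact_mod_cast hn
  have t1 : Tendsto (fun ε : ℝ => ω (2 * ε)) (nhdsWithin 0 (Set.Ioi 0)) (nhds 0) := by
    have h1 : ContinuousWithinAt ω (Set.Ici 0) 0 := hω.1 0 (by simp)
    have h2 : Tendsto ω (nhdsWithin 0 (Set.Ici 0)) (nhds 0) := by
      have := h1.tendsto; rwa [hω.2.2.2.1] at this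
    refine h2.comp (tendsto_nhdsWithin_iff.2 ⟨?_, ?_⟩)
    · have : Tendsto (fun ε : ℝ => 2 * ε) (nhds 0) (nhds (2 * 0)) := by
        exact (continuous_const_mul (2:ℝ)).tendsto 0
      rw [mul_zero] at this
      exact this.mono_left nhdsWithin_le_nhds
    · filter_upwards [self_mem_nhdsWithin] with ε hε
      have : (0:ℝ) < ε := hε
      exact Set.mem_Ici.2 (by linarith)
  have t2 : Tendsto (fun ε : ℝ => (n * ω π / 2 + n^2 * ω π * π / 2) * ε + ω (2 * ε) / 2)
      (nhdsWithin 0 (Set.Ioi 0)) (nhds ((n * ω π / 2 + n^2 * ω π * π / 2) * 0 + 0 / 2)) := by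
    refine Tendsto.add ?_ (t1.div_const 2)
    exact ((continuous_const_mul _).tendsto 0).mono_left nhdsWithin_le_nhds
  rw [mul_zero, zero_div, add_zero] at t2
  have ev1 := t2.eventually (gt_mem_nhds hη)
  have ev2 : ∀ᶠ ε : ℝ in nhdsWithin 0 (Set.Ioi 0), ε < min (π/(2*n)) (1/n) :=
    nhdsWithin_le_nhds (gt_mem_nhds (by positivity))
  obtain ⟨ε, h1, h2, h3⟩ := (ev1.and (ev2.and self_mem_nhdsWithin)).exists
  have h3' : 0 < ε := h3
  have h4 := (lt_min_iff.1 h2)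
  refine ⟨ε, h3', le_trans ?_ (phE_coef hω hc n hn h3' h4.1.le ?_)⟩
  · linarith
  · have := h4.2.le
    rw [le_div_iff₀ hn'] at this
    linarith

def sg (n : ℕ) (b x : ℝ) : ℝ := cos (n * x - b) / |cos (n * x - b)|

lemma sg_abs (n : ℕ) (b x : ℝ) : |sg n b x| ≤ 1 := by
  unfold sg
  rw [abs_div, abs_abs]
  exact div_self_le_one _

lemma sg_meas (n : ℕ) (b : ℝ) : Measurable (sg n b) := by
  unfold sg; fun_prop

lemma sg_shift (n : ℕ) (hn : 0 < n) (b x : ℝ) : sg n b (x + π/n) = - sg n b x := by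
  have hn' : (n:ℝ) ≠ 0 := by positivity
  unfold sg
  have : (n:ℝ) * (x + π/n) - b = (n * x - b) + π := by field_simp; ring
  rw [this, Real.cos_add_pi, abs_neg, neg_div]

lemma sg_per (n : ℕ) (b : ℝ) : Function.Periodic (sg n b) (2 * π) := by
  intro x
  unfold sg
  have : (n:ℝ) * (x + 2 * π) - b = (n * x - b) + n * (2 * π) := by ring
  rw [this, Real.cos_add_nat_mul_two_pi]

lemma sg_int (n : ℕ) (b : ℝ) {g : ℝ → ℝ} {u v : ℝ} (hg : IntervalIntegrable g volume u v) :
    IntervalIntegrable (fun x => g x * sg n b x) volume u v := by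
  rw [intervalIntegrable_iff] at *
  refine Integrable.mul_bdd (c := 1) hg (sg_meas n b).aestronglyMeasurable
    (Eventually.of_forall fun x => ?_)
  exact sg_abs n b x

lemma sg_orth (n : ℕ) (hn : 0 < n) (b : ℝ) (k : ℕ) (hk : k < 3 * n) (hkn : k ≠ n) (θ : ℝ) :
    ∫ x in (-π)..π, cos (k * x + θ) * sg n b x = 0 := by
  have hpi := Real.pi_pos
  have hn' : (n:ℝ) ≠ 0 := by positivity
  have I : ∀ θ : ℝ, IntervalIntegrable (fun x => cos (k * x + θ) * sg n b x) volume (-π) π := fun θ =>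
    sg_int n b (Continuous.intervalIntegrable (by fun_prop) _ _)
  set q := k * π / (2 * n) with hq
  have hc : cos q ≠ 0 := by
    intro h
    obtain ⟨j, hj⟩ := Real.cos_eq_zero_iff.1 h
    rw [hq] at hj
    have h1 : (k:ℝ) = (2 * j + 1) * n := by
      field_simp at hj
      linarith
    have h2 : (k:ℤ) = (2 * j + 1) * n := by exact_mod_cast h1
    have hnz : (0:ℤ) < n := by exact_mod_cast hn
    have j0 : 0 ≤ j := by
      by_contra hneg
      have : 2 * j + 1 ≤ -1 := by omega
      nlinarith
    have j1 : j ≤ 0 := by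
      by_contra hneg
      have : 3 ≤ 2 * j + 1 := by omega
      have : (k:ℤ) < 3 * n := by exact_mod_cast hk
      nlinarith
    have : j = 0 := le_antisymm j1 j0
    rw [this] at h2
    exact hkn (by push_cast at h2; omega)
  have S := per_int_shift (g := fun x => cos (k * x + (θ - q)) * sg n b x) (fun x => by
    simp only []
    rw [sg_per n b x]
    have : (k:ℝ) * (x + 2 * π) + (θ - q) = (k * x + (θ - q)) + k * (2 * π) := by ring
    rw [this, Real.cos_add_nat_mul_two_pi]) (π/n)
  simp only [sg_shift n hn] at S
  have e : ∫ x in (-π)..π, cos (k * (x + π/n) + (θ - q)) * -sg n b x =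
      - ∫ x in (-π)..π, cos (k * x + (θ + q)) * sg n b x := by
    rw [← intervalIntegral.integral_neg]
    refine intervalIntegral.integral_congr fun x _ => ?_
    show cos (k * (x + π/n) + (θ - q)) * -sg n b x = -(cos (k * x + (θ + q)) * sg n b x)
    have : (k:ℝ) * (x + π/n) + (θ - q) = k * x + (θ + q) := by rw [hq]; field_simp; ring
    rw [this]; ring
  rw [e] at S
  have T : (∫ x in (-π)..π, cos (k * x + (θ - q)) * sg n b x) +
      (∫ x in (-π)..π, cos (k * x + (θ + q)) * sg n b x) =
      2 * cos q * ∫ x in (-π)..π, cos (k * x + θ) * sg n b x := by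
    rw [← intervalIntegral.integral_add (I _) (I _), ← intervalIntegral.integral_const_mul]
    refine intervalIntegral.integral_congr fun x _ => ?_
    show cos (k * x + (θ - q)) * sg n b x + cos (k * x + (θ + q)) * sg n b x =
      2 * cos q * (cos (k * x + θ) * sg n b x)
    rw [← add_sub_assoc, ← add_assoc, Real.cos_add _ q, Real.cos_sub _ q]
    ring
  rw [← S, neg_add_cancel] at T
  have := T.symm
  simpa [hc] using this

lemma sg_trig (n : ℕ) (hn : 0 < n) (b : ℝ) {T : ℝ → ℝ} (hT : IsTrigPoly n T) :
    ∫ x in (-π)..π, T x * sg n b x = 0 := by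
  obtain ⟨a, d, h⟩ := hT
  have e : ∀ x, T x * sg n b x = ∑ k ∈ Finset.range n, (a k * (cos (k * x + 0) * sg n b x) +
      d k * (cos (k * x + (-(π/2))) * sg n b x)) := by
    intro x
    rw [h, Finset.sum_mul]
    refine Finset.sum_congr rfl fun k _ => ?_
    rw [add_zero, ← sub_eq_add_neg, Real.cos_sub_pi_div_two]
    ring
  simp only [e]
  have I : ∀ (k : ℕ) (θ : ℝ), IntervalIntegrable (fun x => cos (k * x + θ) * sg n b x) volume (-π) π := fun k θ =>
    sg_int n b (Continuous.intervalIntegrable (by fun_prop) _ _)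
  rw [intervalIntegral.integral_finsetSum fun k _ => ((I k 0).const_mul _).add ((I k _).const_mul _)]
  refine Finset.sum_eq_zero fun k hk => ?_
  have hk' := Finset.mem_range.1 hk
  rw [intervalIntegral.integral_add ((I k 0).const_mul _) ((I k _).const_mul _),
    intervalIntegral.integral_const_mul, intervalIntegral.integral_const_mul,
    sg_orth n hn b k (by omega) (by omega), sg_orth n hn b k (by omega) (by omega)]
  ring

lemma sg_four (n : ℕ) (hn : 0 < n) (b : ℝ) : ∫ x in (-π)..π, cos (n * x - b) * sg n b x = 4 := by
  have hpi := Real.pi_pos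
  have hn' : (0:ℝ) < n := by exact_mod_cast hn
  have e : ∀ x, cos (n * x - b) * sg n b x = |cos (n * x - b)| := by
    intro x
    unfold sg
    rcases eq_or_ne (cos (n * x - b)) 0 with h | h
    · rw [h]; simp
    · rw [← mul_div_assoc, ← sq, ← sq_abs, sq, mul_div_assoc, div_self (abs_ne_zero.2 h), mul_one]
  simp only [e]
  have hH : PI1 (fun x => |cos (n * x - b)|) := by
    refine ⟨fun x => ?_, Continuous.intervalIntegrable (by fun_prop) _ _⟩
    have : (n:ℝ) * (x + 2 * π) - b = (n * x - b) + n * (2 * π) := by ring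
    show |cos (n * (x + 2 * π) - b)| = |cos (n * x - b)|
    rw [this, Real.cos_add_nat_mul_two_pi]
  rw [cellRep hH n hn ((b - π/2)/n)]
  have e2 : ∀ s ∈ Set.uIcc 0 (π/(2*n)), (∑ i ∈ Finset.range (2*n),
      (|cos (n * ((b - π/2)/n + i * (π / n) + s) - b)| + |cos (n * ((b - π/2)/n + i * (π / n) - s) - b)|)) =
      (4 * n) * sin (n * s) := by
    intro s hs
    rw [Set.uIcc_of_le (by positivity)] at hs
    have hsin : 0 ≤ sin (n * s) := by
      refine Real.sin_nonneg_of_nonneg_of_le_pi (mul_nonneg hn'.le hs.1) ?_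
      calc (n:ℝ) * s ≤ n * (π/(2*n)) := by gcongr; exact hs.2
        _ = π/2 := by field_simp
        _ ≤ π := by linarith
    have : ∀ i ∈ Finset.range (2*n), (|cos (n * ((b - π/2)/n + i * (π / n) + s) - b)| + |cos (n * ((b - π/2)/n + i * (π / n) - s) - b)|) = 2 * sin (n * s) := by
      intro i _
      have c2 := cos_node n hn b (-s) i
      rw [← sub_eq_add_neg, mul_neg, Real.sin_neg] at c2
      rw [cos_node n hn b s i, c2]
      simp only [abs_mul, abs_pow, abs_neg, abs_one, one_pow, one_mul, abs_of_nonneg hsin]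
      ring
    rw [Finset.sum_congr rfl this, Finset.sum_const, Finset.card_range, nsmul_eq_mul]
    push_cast; ring
  rw [intervalIntegral.integral_congr e2, intervalIntegral.integral_const_mul,
    intervalIntegral.integral_comp_mul_left (fun x => sin x) hn'.ne', integral_sin]
  have : (n:ℝ) * (π/(2*n)) = π/2 := by field_simp
  rw [this]
  simp
  field_simp


lemma conv_cos {φ : ℝ → ℝ} (h : PI1 φ) (hev : ∀ x, φ (-x) = φ x) (k : ℕ) (b x : ℝ) :
    ∫ t in (-π)..π, φ (x - t) * cos (k * t - b) =
      (∫ u in (-π)..π, φ u * cos (k * u)) * cos (k * x - b) := by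
  have S := per_int_neg (g := fun u => φ u * cos (k * (x - u) - b)) (fun u => by
    simp only []
    rw [h.1 u]
    have : (k:ℝ) * (x - (u + 2 * π)) - b = (k * (x - u) - b) - k * (2 * π) := by ring
    rw [this, Real.cos_sub_nat_mul_two_pi]) x
  simp only [sub_sub_cancel] at S
  rw [S]
  have i1 : IntervalIntegrable (fun u => φ u * cos (k * u)) volume (-π) π :=
    h.2.mul_continuousOn (by fun_prop)
  have i2 : IntervalIntegrable (fun u => φ u * sin (k * u)) volume (-π) π :=
    h.2.mul_continuousOn (by fun_prop)
  have z : ∫ u in (-π)..π, φ u * sin (k * u) = 0 := by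
    have := intervalIntegral.integral_comp_neg (a := -π) (b := π) (fun u => φ u * sin (k * u))
    simp only [hev, mul_neg, Real.sin_neg, neg_neg, intervalIntegral.integral_neg] at this
    linarith
  have e : ∀ u, φ u * cos (k * (x - u) - b) = cos (k * x - b) * (φ u * cos (k * u)) +
      sin (k * x - b) * (φ u * sin (k * u)) := by
    intro u
    have : (k:ℝ) * (x - u) - b = (k * x - b) - k * u := by ring
    rw [this, Real.cos_sub]; ring
  simp only [e]
  rw [intervalIntegral.integral_add (i1.const_mul _) (i2.const_mul _),
    intervalIntegral.integral_const_mul, intervalIntegral.integral_const_mul, z]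
  ring

lemma lowerGen {ψ ω φ : ℝ → ℝ} (β : ℝ) (m : ℕ) (hm1 : 1 ≤ m) (hnn : ∀ k : ℕ, 0 ≤ ψ (k+1))
    (hs : Summable fun k : ℕ => ψ (k+1)) (hω : IsModulus ω)
    (h : PI1 φ) (h0 : ∫ t in (-π)..π, φ t = 0) (hev : ∀ x, φ (-x) = φ x) (hm : HModul φ ω) :
    ∃ f ∈ L1Class ψ β ω, (4/π) * ψ ((m+1:ℕ)) * (∫ u in (-π)..π, φ u * cos ((m+1:ℕ) * u)) -
      100 * (∑' j, ψ ((m+1+(2*(m+1)+j) : ℕ))) * ω (1 / (m+1 : ℕ)) ≤ EnL1 (m+1) f := by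
  have hpi := Real.pi_pos
  set b := β * π / 2 with hb
  set q : ℕ → ℝ := fun j => ψ ((m+1+(2*(m+1)+j) : ℕ)) with hq
  have hqe : ∀ j : ℕ, q j = ψ (((j + (3*m+2) : ℕ):ℝ) + 1) := fun j => by
    rw [hq]; simp only []; congr 1; push_cast; ring
  have hq0 : ∀ j, 0 ≤ q j := fun j => by rw [hqe]; exact hnn _
  have hqs : Summable q := by
    have := (summable_nat_add_iff (3*m+2)).2 hs
    rw [funext hqe]; exact this
  set R : ℝ → ℝ := fun t => ∑' j : ℕ, q j * cos (((m+1+(2*(m+1)+j) : ℕ):ℝ) * t - b) with hR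
  have hRc : Continuous R := tsum_cos_cont hqs hq0 (fun j t => ((m+1+(2*(m+1)+j) : ℕ):ℝ) * t - b)
    (fun j => by fun_prop)
  have hRl : ∀ t, |R t| ≤ ∑' j, q j := fun t => tsum_cos_abs_le hqs hq0 _
  have hΨ : ∀ t, PsiKer ψ β t = (∑ k ∈ Finset.range (3*m+2), ψ (k+1) * cos ((k+1) * t - b)) + R t := by
    intro t
    have S0 : Summable fun k : ℕ => ψ (k+1) * cos ((k+1) * t - b) :=
      summ_cos hs hnn fun k => (k+1) * t - b
    unfold PsiKer
    rw [← S0.sum_add_tsum_nat_add (3*m+2)]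
    congr 1
    refine tsum_congr fun j => ?_
    rw [hqe]
    congr 3
    push_cast; ring
  have hΨc : Continuous (PsiKer ψ β) := by
    rw [funext hΨ]; fun_prop
  set f : ℝ → ℝ := fun x => (1/π) * ∫ t in (-π)..π, φ (x - t) * PsiKer ψ β t with hf
  have M0 := minkowski (F := fun x t => PsiKer ψ β t * φ (x - t)) (c := -π) (d := π) (by linarith)
    (prodInt h hΨc (continuous_id' (X := ℝ)) _ _)
    (N := fun t => |PsiKer ψ β t| * ∫ x in (-π)..π, |φ x|) (by
      intro t _
      simp only [abs_mul]
      rw [intervalIntegral.integral_const_mul, h.absInt_shift t])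
    (Continuous.intervalIntegrable (by fun_prop) _ _)
  have hfi : IntervalIntegrable f volume (-π) π := by
    have := M0.1.const_mul (1/π)
    rw [hf]
    simpa only [mul_comm (φ _)] using this
  refine ⟨f, ⟨hfi, ?_, 0, φ, h.2, h.1, h0, ?_, ?_⟩, ?_⟩
  · intro x
    show (1/π) * _ = (1/π) * _
    congr 2
    funext t
    have := h.1 (x - t)
    rw [← this]; congr 2; ring
  · intro t ht d hd
    exact (hm d).trans (hω.2.1 (Set.mem_Ici.2 (abs_nonneg _)) ht hd)
  · exact Eventually.of_forall fun x => by rw [hf]; simp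
  obtain ⟨U, hU, hUD⟩ := jackson hω h hm (m+1) (by omega)
  have hU1 := PI1.trig hU
  have hd1 : PI1 (fun x => φ x - U x) := h.sub hU1
  set τ := ∑' j, q j with hτ
  have hτ0 : 0 ≤ τ := tsum_nonneg hq0
  set D := ∫ x in (-π)..π, |φ x - U x| with hD
  have hD0 : 0 ≤ D := intervalIntegral.integral_nonneg (by linarith) fun x _ => abs_nonneg _
  have M := minkowski (F := fun x t => R t * (φ (x - t) - U (x - t))) (c := -π) (d := π) (by linarith)
    (prodInt hd1 hRc (continuous_id' (X := ℝ)) _ _) (N := fun _ => τ * D) (by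
      intro t _
      simp only [abs_mul]
      rw [intervalIntegral.integral_const_mul, hd1.absInt_shift t]
      have := hRl t
      gcongr) (by simp)
  set E2 : ℝ → ℝ := fun x => ∫ t in (-π)..π, R t * (φ (x - t) - U (x - t)) with hE2
  have hUR : IsTrigPoly (m+1) (fun x => ∫ t in (-π)..π, R t * U (x - t)) :=
    hU.conv (hRc.intervalIntegrable _ _) (continuous_id' (X := ℝ))
  set V : ℝ → ℝ := fun x => ∫ t in (-π)..π, R t * U (x - t) with hV
  set A : ℕ → ℝ := fun k => ∫ u in (-π)..π, φ u * cos (k * u) with hA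
  have fe : ∀ x, f x = (1/π) * ((∑ k ∈ Finset.range (3*m+2),
      (ψ (k+1) * A (k+1)) * cos ((k+1:ℕ) * x - b)) + (E2 x + V x)) := by
    intro x
    have i1 : ∀ k ∈ Finset.range (3*m+2), IntervalIntegrable (fun t => ψ (k+1) * (φ (x - t) * cos (((k+1:ℕ):ℝ) * t - b)))
      volume (-π) π := fun k _ => (h.convInt (by fun_prop) x _ _).const_mul _
    have i1s : IntervalIntegrable (fun t => ∑ k ∈ Finset.range (3*m+2), ψ (k+1) * (φ (x - t) * cos (((k+1:ℕ):ℝ) * t - b)))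
      volume (-π) π := by
      have e : (fun t => ∑ k ∈ Finset.range (3*m+2), ψ (k+1) * (φ (x - t) * cos (((k+1:ℕ):ℝ) * t - b))) =
        ∑ k ∈ Finset.range (3*m+2), (fun t => ψ (k+1) * (φ (x - t) * cos (((k+1:ℕ):ℝ) * t - b))) := by
        funext t; simp
      rw [e]; exact IntervalIntegrable.sum _ i1
    have i2 := h.convInt hRc x (-π) π
    have i3 := hU1.convInt hRc x (-π) π
    simp only [mul_comm (U _)] at i3
    have e2 : E2 x + V x = ∫ t in (-π)..π, φ (x - t) * R t := by
      have : E2 x = (∫ t in (-π)..π, φ (x - t) * R t) - V x := by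
        rw [hV]
        simp only []
        rw [← intervalIntegral.integral_sub i2 i3]
        refine intervalIntegral.integral_congr fun t _ => ?_
        show R t * (φ (x - t) - U (x - t)) = φ (x - t) * R t - R t * U (x - t)
        ring
      rw [this]; ring
    rw [e2, hf]
    simp only []
    congr 1
    have e3 : ∀ k ∈ Finset.range (3*m+2), (ψ (k+1) * A (k+1)) * cos ((k+1:ℕ) * x - b) =
        ∫ t in (-π)..π, ψ (k+1) * (φ (x - t) * cos (((k+1:ℕ):ℝ) * t - b)) := by
      intro k _
      rw [intervalIntegral.integral_const_mul, conv_cos h hev (k+1) b x, mul_assoc]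
    rw [Finset.sum_congr rfl e3, ← intervalIntegral.integral_finsetSum i1,
      ← intervalIntegral.integral_add i1s i2]
    refine intervalIntegral.integral_congr fun t _ => ?_
    show φ (x - t) * PsiKer ψ β t = _
    rw [hΨ, mul_add, Finset.mul_sum]
    congr 1
    refine Finset.sum_congr rfl fun k _ => ?_
    push_cast; ring
  refine le_csInf ⟨_, fun _ => 0, IsTrigPoly.zero _, rfl⟩ ?_
  rintro _ ⟨T, hT, rfl⟩
  have hTi := hT.continuous.intervalIntegrable (μ := volume) (-π) π
  have step1 : ∫ x in (-π)..π, (f x - T x) * sg (m+1) b x ≤ ∫ x in (-π)..π, |f x - T x| := by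
    refine intervalIntegral.integral_mono_on (by linarith) (sg_int _ _ (hfi.sub hTi)) (hfi.sub hTi).abs
      fun x _ => ?_
    refine (le_abs_self _).trans ?_
    rw [abs_mul]
    exact mul_le_of_le_one_right (abs_nonneg _) (sg_abs _ _ _)
  refine le_trans ?_ step1
  have ic : ∀ k : ℕ, IntervalIntegrable (fun x => (ψ (k+1) * A (k+1)) * (cos (((k+1:ℕ):ℝ) * x - b) * sg (m+1) b x))
      volume (-π) π := fun k =>
    (sg_int _ _ (Continuous.intervalIntegrable (by fun_prop) _ _)).const_mul _
  have ics : IntervalIntegrable (fun x => ∑ k ∈ Finset.range (3*m+2), (ψ (k+1) * A (k+1)) * (cos (((k+1:ℕ):ℝ) * x - b) * sg (m+1) b x))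
      volume (-π) π := by
    have e : (fun x => ∑ k ∈ Finset.range (3*m+2), (ψ (k+1) * A (k+1)) * (cos (((k+1:ℕ):ℝ) * x - b) * sg (m+1) b x)) =
      ∑ k ∈ Finset.range (3*m+2), (fun x => (ψ (k+1) * A (k+1)) * (cos (((k+1:ℕ):ℝ) * x - b) * sg (m+1) b x)) := by
      funext t; simp
    rw [e]; exact IntervalIntegrable.sum _ fun k _ => ic k
  have iE := sg_int (m+1) b M.1
  have iV := sg_int (m+1) b (hUR.continuous.intervalIntegrable (μ := volume) (-π) π)
  have iT := sg_int (m+1) b hTi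
  have step2 : ∫ x in (-π)..π, (f x - T x) * sg (m+1) b x =
      (1/π) * ((ψ (m+1) * A (m+1)) * 4 + ∫ x in (-π)..π, E2 x * sg (m+1) b x) := by
    have e : ∀ x, (f x - T x) * sg (m+1) b x = (1/π) * ((∑ k ∈ Finset.range (3*m+2),
        (ψ (k+1) * A (k+1)) * (cos (((k+1:ℕ):ℝ) * x - b) * sg (m+1) b x)) +
        (E2 x * sg (m+1) b x + V x * sg (m+1) b x)) - T x * sg (m+1) b x := by
      intro x
      rw [fe, sub_mul, mul_assoc, add_mul, Finset.sum_mul, add_mul]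
      simp only [mul_assoc]
    simp only [e]
    rw [intervalIntegral.integral_sub ((ics.add (iE.add iV)).const_mul _) iT,
      intervalIntegral.integral_const_mul, intervalIntegral.integral_add ics (iE.add iV),
      intervalIntegral.integral_add iE iV, sg_trig _ (by omega) b hT, sg_trig _ (by omega) b hUR,
      intervalIntegral.integral_finsetSum fun k _ => ic k, Finset.sum_eq_single m]
    · rw [intervalIntegral.integral_const_mul, sg_four _ (by omega)]
      ring
    · intro k hk hkm
      have := Finset.mem_range.1 hk
      rw [intervalIntegral.integral_const_mul]
      simp only [sub_eq_add_neg]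
      rw [sg_orth (m+1) (by omega) b (k+1) (by omega) (by omega), mul_zero]
    · intro hk
      exact absurd (Finset.mem_range.2 (by omega)) hk
  rw [step2]
  have step3 : |∫ x in (-π)..π, E2 x * sg (m+1) b x| ≤ (π - -π) * (τ * (50 * ω (1/(m+1:ℕ)))) := by
    refine (intervalIntegral.abs_integral_le_integral_abs (by linarith)).trans ?_
    have : ∫ x in (-π)..π, |E2 x * sg (m+1) b x| ≤ ∫ x in (-π)..π, |E2 x| := by
      refine intervalIntegral.integral_mono_on (by linarith) iE.abs M.1.abs fun x _ => ?_
      rw [abs_mul]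
      exact mul_le_of_le_one_right (abs_nonneg _) (sg_abs _ _ _)
    refine this.trans (M.2.trans ?_)
    rw [intervalIntegral.integral_const, smul_eq_mul]
    have : (0:ℝ) ≤ π - -π := by linarith
    gcongr
  have step4 := neg_le_of_abs_le step3
  have hψ : ψ ((m+1:ℕ):ℝ) = ψ ((m:ℝ)+1) := by push_cast; rfl
  rw [hψ]
  have : (1/π) * ((ψ (m+1) * A (m+1)) * 4 - (π - -π) * (τ * (50 * ω (1/(m+1:ℕ))))) ≤
    (1/π) * ((ψ (m+1) * A (m+1)) * 4 + ∫ x in (-π)..π, E2 x * sg (m+1) b x) := by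
    gcongr; linarith
  refine le_trans (le_of_eq ?_) this
  change (4/π) * ψ (m+1) * A (m+1) - 100 * τ * ω (1/(m+1:ℕ)) = _
  field_simp
  ring

lemma core {ψ ω : ℝ → ℝ} (β : ℝ) (m : ℕ) (hm1 : 1 ≤ m) (hnn : ∀ k : ℕ, 0 ≤ ψ (k+1))
    (hs : Summable fun k : ℕ => ψ (k+1)) (hp : GoodSeq fun j => ψ ((m+1+j : ℕ)))
    (hω : IsModulus ω) (hc : ConcaveOn ℝ (Set.Ici 0) ω) :
    |EnL1Class (m+1) (L1Class ψ β ω) - (2/π) * ψ ((m+1 : ℕ)) * eN (m+1) ω| ≤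
      4000 * ((∑' j, ψ ((m+1+(2*(m+1)+j) : ℕ))) + (∑' j, ψ ((m+1+(j+1) : ℕ))) / (m+1 : ℕ)) *
        ω (1 / (m+1 : ℕ)) := by
  have hpi := Real.pi_pos
  set B := (2/π) * ψ ((m+1 : ℕ)) * eN (m+1) ω with hB
  have ub : ∀ y ∈ EnL1 (m+1) '' (L1Class ψ β ω), y ≤ B +
      4000 * ((∑' j, ψ ((m+1+(2*(m+1)+j) : ℕ))) + (∑' j, ψ ((m+1+(j+1) : ℕ))) / (m+1 : ℕ)) *
        ω (1 / (m+1 : ℕ)) := by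
    rintro _ ⟨f, hf, rfl⟩
    exact upper β m hm1 hnn hs hp hω hf
  have bdd : BddAbove (EnL1 (m+1) '' (L1Class ψ β ω)) := ⟨_, ub⟩
  set τ := ∑' j, ψ ((m+1+(2*(m+1)+j) : ℕ)) with hτ
  set S := ∑' j, ψ ((m+1+(j+1) : ℕ)) with hS
  have hτ0 : 0 ≤ τ := tsum_nonneg fun j => hp.nonneg _
  have hS0 : 0 ≤ S := tsum_nonneg fun j => hp.nonneg _
  have ho0 : 0 ≤ ω (1 / (m+1 : ℕ)) := hω.2.2.2.2 _ (by positivity)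
  have hψ0 : 0 ≤ ψ ((m+1:ℕ)) := by simpa using hnn m
  have low : ∀ η > 0, B - (4/π) * ψ ((m+1:ℕ)) * η - 100 * τ * ω (1 / (m+1 : ℕ)) ≤
      EnL1Class (m+1) (L1Class ψ β ω) := by
    intro η hη
    obtain ⟨ε, hε, hA⟩ := phE_coef_lim hω hc (m+1) (by omega) hη
    set a := π/(2*(m+1:ℕ)) with ha
    have P := phE_PI1 hω hc (a := a) hε
    set c := (∫ x in (-π)..π, phE ω a ε x) / (2 * π) with hcd
    have Pc : PI1 (fun _ : ℝ => c) := ⟨fun _ => rfl, by simp⟩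
    obtain ⟨f, hf, hfl⟩ := lowerGen (φ := fun x => phE ω a ε x - c) β m hm1 hnn hs hω (P.sub Pc)
      (by
        rw [intervalIntegral.integral_sub P.2 Pc.2, intervalIntegral.integral_const, smul_eq_mul, hcd]
        field_simp; ring) (fun x => by simp only [phE_even])
      (fun h => by
        simp only [sub_sub_sub_cancel_right]
        exact phE_mod hω hc hε h)
    have e : ∫ u in (-π)..π, (phE ω a ε u - c) * cos ((m+1:ℕ) * u) =
        ∫ u in (-π)..π, phE ω a ε u * cos ((m+1:ℕ) * u) := by
      simp only [sub_mul]
      rw [intervalIntegral.integral_sub (P.2.mul_continuousOn (by fun_prop))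
        (Continuous.intervalIntegrable (by fun_prop) _ _), intervalIntegral.integral_const_mul]
      have := int_cos_int ((m+1:ℕ):ℤ) (by omega)
      simp only [Int.cast_natCast] at this
      rw [this]; ring
    rw [e] at hfl
    have h1 : EnL1 (m+1) f ≤ EnL1Class (m+1) (L1Class ψ β ω) := le_csSup bdd ⟨f, hf, rfl⟩
    refine le_trans ?_ (hfl.trans h1)
    have : (4/π) * ψ ((m+1:ℕ)) * (eN (m+1) ω / 2 - η) ≤ (4/π) * ψ ((m+1:ℕ)) *
      ∫ u in (-π)..π, phE ω a ε u * cos ((m+1:ℕ) * u) := by gcongr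
    rw [hB]
    have e2 : (4/π) * ψ ((m+1:ℕ)) * (eN (m+1) ω / 2 - η) =
      (2/π) * ψ ((m+1:ℕ)) * eN (m+1) ω - (4/π) * ψ ((m+1:ℕ)) * η := by ring
    linarith
  have low2 : B - 100 * τ * ω (1 / (m+1 : ℕ)) ≤ EnL1Class (m+1) (L1Class ψ β ω) := by
    refine le_of_forall_pos_le_add fun θ hθ => ?_
    have k0 : 0 ≤ (4/π) * ψ ((m+1:ℕ)) := by positivity
    have := low (θ / ((4/π) * ψ ((m+1:ℕ)) + 1)) (by positivity)
    have k : (4/π) * ψ ((m+1:ℕ)) * (θ / ((4/π) * ψ ((m+1:ℕ)) + 1)) ≤ θ := by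
      rw [← mul_div_assoc, div_le_iff₀ (by positivity)]
      nlinarith
    linarith
  have up : EnL1Class (m+1) (L1Class ψ β ω) ≤ B + 4000 * (τ + S / (m+1 : ℕ)) * ω (1 / (m+1 : ℕ)) := by
    obtain ⟨ε, hε, hA⟩ := phE_coef_lim hω hc (m+1) (by omega) one_pos
    have P0 : PI1 (fun _ : ℝ => (0:ℝ)) := ⟨fun _ => rfl, by simp⟩
    obtain ⟨f, hf, -⟩ := lowerGen (φ := fun _ => 0) β m hm1 hnn hs hω P0 (by simp) (fun x => rfl)
      (fun h => by simpa using hω.2.2.2.2 _ (abs_nonneg h))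
    exact csSup_le ⟨_, f, hf, rfl⟩ ub
  rw [abs_le]
  have k1 : 100 * τ * ω (1 / (m+1 : ℕ)) ≤ 4000 * (τ + S / (m+1 : ℕ)) * ω (1 / (m+1 : ℕ)) := by
    have : 0 ≤ S / (m+1:ℕ) := by positivity
    gcongr <;> linarith
  constructor <;> linarith


lemma decay {c r : ℝ} (hc : 0 < c) (hr : 0 < r) :
    ∃ C > 0, ∀ k : ℕ, exp (-c * (k:ℝ) ^ r) ≤ C / ((k:ℝ)+1)^4 := by
  have t := (tendsto_rpow_mul_exp_neg_mul_atTop_nhds_zero (4/r) c hc).comp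
    ((tendsto_rpow_atTop hr).comp tendsto_natCast_atTop_atTop)
  obtain ⟨B, hB⟩ := t.bddAbove_range
  refine ⟨16 * |B| + 1, by positivity, fun k => ?_⟩
  rw [le_div_iff₀ (by positivity)]
  have h1 : ((k:ℝ)^r)^(4/r) * exp (-c * (k:ℝ)^r) ≤ B := hB ⟨k, rfl⟩
  have h2 : ((k:ℝ)^r)^(4/r) = (k:ℝ)^4 := by
    rw [← Real.rpow_mul (by positivity), mul_div_cancel₀ _ hr.ne']
    norm_cast
  rw [h2] at h1
  have h3 := le_abs_self B
  rcases Nat.eq_zero_or_pos k with h | h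
  · rw [h]
    simp [Real.zero_rpow hr.ne']
  · have hk : (1:ℝ) ≤ k := by exact_mod_cast h
    have h4 : ((k:ℝ)+1)^4 ≤ 16 * (k:ℝ)^4 := by
      calc ((k:ℝ)+1)^4 ≤ (2 * k)^4 := by gcongr; linarith
        _ = _ := by ring
    have h5 := Real.exp_pos (-c * (k:ℝ)^r)
    nlinarith

lemma psi_pos (δ α r : ℝ) {t : ℝ} (ht : 0 < t) : 0 < psiDAR δ α r t := by
  unfold psiDAR; positivity

lemma psi_ratio {δ α : ℝ} (r : ℝ) (hδ : 0 ≤ δ) (n : ℕ) (hn : 1 ≤ n) (j : ℕ) :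
    psiDAR δ α r ((n+j:ℕ)) ≤ psiDAR δ α r n * exp (-α * (((n+j:ℕ):ℝ)^r - (n:ℝ)^r)) := by
  have hn' : (0:ℝ) < n := by exact_mod_cast hn
  unfold psiDAR
  rw [mul_assoc, ← Real.exp_add]
  have e : -α * (n:ℝ)^r + -α * (((n+j:ℕ):ℝ)^r - (n:ℝ)^r) = -α * ((n+j:ℕ):ℝ)^r := by ring
  rw [e]
  refine mul_le_mul_of_nonneg_right ?_ (Real.exp_pos _).le
  refine Real.rpow_le_rpow_of_nonpos hn' ?_ (by linarith)
  push_cast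
  linarith [(Nat.cast_nonneg j : (0:ℝ) ≤ j)]

lemma psi_le_exp {δ α : ℝ} (r : ℝ) (hδ : 0 ≤ δ) (n : ℕ) (hn : 1 ≤ n) :
    psiDAR δ α r n ≤ exp (-α * (n:ℝ)^r) := by
  unfold psiDAR
  have : (n:ℝ)^(-δ) ≤ 1 := Real.rpow_le_one_of_one_le_of_nonpos (by exact_mod_cast hn) (by linarith)
  exact mul_le_of_le_one_left (Real.exp_pos _).le this

lemma psi_decay {δ α r : ℝ} (hδ : 0 ≤ δ) (hα : 0 < α) (hr : 0 < r) :
    ∃ C > 0, ∀ n j : ℕ, 1 ≤ n → psiDAR δ α r ((n+j:ℕ)) ≤ C / ((j:ℝ)+1)^4 := by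
  obtain ⟨C, hC, h⟩ := decay hα hr
  refine ⟨C, hC, fun n j hn => ?_⟩
  refine (psi_le_exp r hδ (n+j) (by omega)).trans ((h (n+j)).trans ?_)
  gcongr
  push_cast
  linarith [(Nat.cast_nonneg n : (0:ℝ) ≤ n)]

lemma summ_sq : Summable fun j : ℕ => 1 / ((j:ℝ)+1)^2 := by
  have := (summable_nat_add_iff 1).2 (Real.summable_one_div_nat_pow.2 (by norm_num : 1 < 2))
  simpa using this

lemma four_le_sq {C : ℝ} (hC : 0 < C) (j : ℕ) : C / ((j:ℝ)+1)^4 ≤ C * (1 / ((j:ℝ)+1)^2) := by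
  rw [mul_one_div]
  gcongr
  · linarith [(Nat.cast_nonneg j : (0:ℝ) ≤ j)]
  · norm_num

lemma psi_summ {δ α r : ℝ} (hδ : 0 ≤ δ) (hα : 0 < α) (hr : 0 < r) (n : ℕ) (hn : 1 ≤ n) :
    Summable fun j : ℕ => psiDAR δ α r ((n+j:ℕ)) := by
  obtain ⟨C, hC, h⟩ := psi_decay hδ hα hr
  refine Summable.of_nonneg_of_le (fun j => (psi_pos _ _ _ (by positivity)).le)
    (fun j => (h n j hn).trans (four_le_sq hC j)) (summ_sq.mul_left C)

lemma psi_good {δ α r : ℝ} (hδ : 0 ≤ δ) (hα : 0 < α) (hr : 0 < r) (n : ℕ) (hn : 1 ≤ n)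
    (hconv : ∀ k : ℕ, n ≤ k → 2 * psiDAR δ α r ((k+1:ℕ)) ≤ psiDAR δ α r k + psiDAR δ α r ((k+2:ℕ))) :
    GoodSeq fun j => psiDAR δ α r ((n+j:ℕ)) where
  nonneg j := (psi_pos _ _ _ (by positivity)).le
  anti j := by
    have := psi_ratio (α := α) r hδ (n+j) (by omega) 1
    refine this.trans (mul_le_of_le_one_right (psi_pos _ _ _ (by positivity)).le ?_)
    rw [Real.exp_le_one_iff]
    have : ((n+j:ℕ):ℝ)^r ≤ ((n+j+1:ℕ):ℝ)^r :=
      Real.rpow_le_rpow (by positivity) (by push_cast; linarith) hr.le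
    nlinarith
  conv j := hconv (n+j) (by omega)
  summ := psi_summ hδ hα hr n hn
  lim := by
    obtain ⟨C, hC, h⟩ := psi_decay hδ hα hr
    have t : Tendsto (fun M : ℕ => C * (1 / ((M:ℝ)+1))) atTop (nhds (C * 0)) :=
      tendsto_one_div_add_atTop_nhds_zero_nat.const_mul C
    rw [mul_zero] at t
    refine squeeze_zero (fun M => mul_nonneg (psi_pos _ _ _ (by positivity)).le (by positivity)) (fun M => ?_) t
    calc _ ≤ C / ((M:ℝ)+1)^4 * ((M:ℝ)+1)^2 := by gcongr; exact h n M hn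
      _ = C * (1 / ((M:ℝ)+1)^2) := by field_simp
      _ ≤ C * (1 / ((M:ℝ)+1)^1) := by
        gcongr
        · linarith [(Nat.cast_nonneg M : (0:ℝ) ≤ M)]
        · norm_num
      _ = _ := by rw [pow_one]

lemma conv_le_one {δ α r : ℝ} (hδ : 0 ≤ δ) (hα : 0 < α) (hr : 0 < r) (hr1 : r ≤ 1) (k : ℕ) (hk : 1 ≤ k) :
    2 * psiDAR δ α r ((k+1:ℕ)) ≤ psiDAR δ α r k + psiDAR δ α r ((k+2:ℕ)) := by
  have hk' : (0:ℝ) < k := by exact_mod_cast hk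
  have e : ∀ t : ℝ, 0 < t → psiDAR δ α r t = exp (-δ * log t - α * t^r) := by
    intro t ht
    unfold psiDAR
    rw [Real.rpow_def_of_pos ht, ← Real.exp_add]
    congr 1; ring
  have c1 := strictConcaveOn_log_Ioi.concaveOn.2 (x := (k:ℝ)) (y := (k:ℝ)+2) hk' (Set.mem_Ioi.2 (by linarith))
    (by norm_num : (0:ℝ) ≤ 1/2) (by norm_num : (0:ℝ) ≤ 1/2) (by norm_num)
  have c2 := (Real.concaveOn_rpow hr.le hr1).2 (x := (k:ℝ)) (y := (k:ℝ)+2) (Set.mem_Ici.2 hk'.le) (Set.mem_Ici.2 (by linarith))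
    (by norm_num : (0:ℝ) ≤ 1/2) (by norm_num : (0:ℝ) ≤ 1/2) (by norm_num)
  simp only [smul_eq_mul] at c1 c2
  have m : (1/2:ℝ) * k + 1/2 * (k+2) = k + 1 := by ring
  rw [m] at c1 c2
  rw [e ((k+1:ℕ):ℝ) (by positivity), e (k:ℝ) hk', e ((k+2:ℕ):ℝ) (by positivity)]
  push_cast
  set L0 := -δ * log k - α * (k:ℝ)^r
  set L2 := -δ * log ((k:ℝ)+2) - α * ((k:ℝ)+2)^r
  have h1 : -δ * log ((k:ℝ)+1) - α * ((k:ℝ)+1)^r ≤ L0/2 + L2/2 := by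
    have := mul_le_mul_of_nonneg_left c1 hδ
    have := mul_le_mul_of_nonneg_left c2 hα.le
    simp only [L0, L2]
    nlinarith
  have h2 : exp (L0/2 + L2/2) = exp (L0/2) * exp (L2/2) := Real.exp_add _ _
  have h3 : exp L0 = exp (L0/2)^2 := by rw [← Real.exp_nat_mul]; congr 1; push_cast; ring
  have h4 : exp L2 = exp (L2/2)^2 := by rw [← Real.exp_nat_mul]; congr 1; push_cast; ring
  have h5 := Real.exp_le_exp.2 h1
  rw [h3, h4]
  nlinarith [sq_nonneg (exp (L0/2) - exp (L2/2))]

lemma diff_ge {r : ℝ} (hr1 : 1 ≤ r) (n : ℕ) (hn : 1 ≤ n) (j : ℕ) :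
    r * (n:ℝ)^(r-1) * j ≤ ((n+j:ℕ):ℝ)^r - (n:ℝ)^r := by
  have hn' : (0:ℝ) < n := by exact_mod_cast hn
  have hj : (0:ℝ) ≤ j := Nat.cast_nonneg j
  have hjn : (0:ℝ) ≤ (j:ℝ)/n := by positivity
  have h := one_add_mul_self_le_rpow_one_add (s := (j:ℝ)/n) (by linarith) hr1
  have e : ((n+j:ℕ):ℝ)^r = (n:ℝ)^r * (1 + (j:ℝ)/n)^r := by
    rw [← Real.mul_rpow (by positivity) (by positivity)]
    congr 1
    push_cast; field_simp
  have h2 := mul_le_mul_of_nonneg_left h (by positivity : 0 ≤ (n:ℝ)^r)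
  rw [e, Real.rpow_sub_one hn'.ne']
  have : r * ((n:ℝ)^r / n) * j = (n:ℝ)^r * (1 + r * (j/n)) - (n:ℝ)^r := by field_simp; ring
  linarith

lemma psi_geo {δ α r : ℝ} (hδ : 0 ≤ δ) (hα : 0 < α) (hr1 : 1 ≤ r) (n : ℕ) (hn : 1 ≤ n) (j : ℕ) :
    psiDAR δ α r ((n+j:ℕ)) ≤ psiDAR δ α r n * exp (-α * r * (n:ℝ)^(r-1)) ^ j := by
  refine (psi_ratio r hδ n hn j).trans ?_
  have := (psi_pos δ α r (by exact_mod_cast hn : (0:ℝ) < n)).le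
  rw [← Real.exp_nat_mul]
  refine mul_le_mul_of_nonneg_left (Real.exp_le_exp.2 ?_) this
  have := mul_le_mul_of_nonneg_left (diff_ge hr1 n hn j) hα.le
  nlinarith

lemma conv_gt_one {δ α r : ℝ} (hδ : 0 ≤ δ) (hα : 0 < α) (hr1 : 1 < r) :
    ∃ n₀ : ℕ, 1 ≤ n₀ ∧ ∀ k : ℕ, n₀ ≤ k →
      2 * psiDAR δ α r ((k+1:ℕ)) ≤ psiDAR δ α r k + psiDAR δ α r ((k+2:ℕ)) := by
  have t : Tendsto (fun k : ℕ => exp (-(α * r * (k:ℝ)^(r-1)))) atTop (nhds 0) := by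
    refine Real.tendsto_exp_neg_atTop_nhds_zero.comp ?_
    refine Tendsto.const_mul_atTop (by positivity) ?_
    exact (tendsto_rpow_atTop (by linarith)).comp tendsto_natCast_atTop_atTop
  obtain ⟨N, hN⟩ := eventually_atTop.1 (t.eventually (gt_mem_nhds (by norm_num : (0:ℝ) < 1/2)))
  refine ⟨max N 1, le_max_right _ _, fun k hk => ?_⟩
  have h1 := hN k (le_trans (le_max_left _ _) hk)
  have hk1 : 1 ≤ k := le_trans (le_max_right _ _) hk
  have h2 := psi_geo hδ hα hr1.le k hk1 1
  have p0 := (psi_pos δ α r (by exact_mod_cast hk1 : (0:ℝ) < k))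
  have p2 := (psi_pos δ α r (by positivity : (0:ℝ) < ((k+2:ℕ):ℝ)))
  rw [pow_one] at h2
  have e : -α * r * (k:ℝ)^(r-1) = -(α * r * (k:ℝ)^(r-1)) := by ring
  rw [e] at h2
  nlinarith

lemma est_ge {δ α r : ℝ} (hδ : 0 ≤ δ) (hα : 0 < α) (hr1 : 1 ≤ r) :
    ∃ K > 0, ∀ n : ℕ, 1 ≤ n →
      (∑' j, psiDAR δ α r ((n+(2*n+j) : ℕ))) + (∑' j, psiDAR δ α r ((n+(j+1) : ℕ))) / n ≤
        K * psiDAR δ α r n * gammaAR α r n := by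
  have hr : 0 < r := by linarith
  set ρ := exp (-(α * r)) with hρ
  have hρ0 : 0 < ρ := Real.exp_pos _
  have hρ1 : ρ < 1 := by rw [hρ, Real.exp_lt_one_iff]; have : 0 < α * r := by positivity
                         linarith
  obtain ⟨B, hB⟩ := (tendsto_self_mul_const_pow_of_lt_one hρ0.le hρ1).bddAbove_range
  refine ⟨(|B| + 1) / (1 - ρ), div_pos (by positivity) (by linarith), fun n hn => ?_⟩
  have hn' : (1:ℝ) ≤ n := by exact_mod_cast hn
  have hn0 : (0:ℝ) < n := by linarith
  set y := exp (-α * r * (n:ℝ)^(r-1)) with hy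
  have hy0 : 0 < y := Real.exp_pos _
  have hyρ : y ≤ ρ := by
    rw [hy, hρ, Real.exp_le_exp]
    have : 1 ≤ (n:ℝ)^(r-1) := Real.one_le_rpow hn' (by linarith)
    have : 0 < α * r := by positivity
    nlinarith
  have hy1 : y < 1 := by linarith
  have hγ : y / n ≤ gammaAR α r n := by
    unfold gammaAR
    rw [if_neg (by linarith)]
    split_ifs with h1
    · have : y = exp (-α) := by rw [hy, h1]; simp
      rw [this]
      gcongr
      have : 0 < 1/α := by positivity
      have := Real.exp_pos (-α)
      nlinarith
    · exact le_rfl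
  set p := psiDAR δ α r n with hp
  have hp0 : 0 < p := psi_pos _ _ _ hn0
  have sg0 := summable_geometric_of_lt_one hy0.le hy1
  have tg := tsum_geometric_of_lt_one hy0.le hy1
  have inv : (1 - y)⁻¹ ≤ (1 - ρ)⁻¹ := by
    have : 0 < 1 - ρ := by linarith
    gcongr
  have hinv : 0 < (1 - ρ)⁻¹ := inv_pos.2 (by linarith)
  have ps := psi_summ hδ hα hr n hn
  have S1 : ∑' j, psiDAR δ α r ((n+(j+1) : ℕ)) ≤ p * y * (1 - ρ)⁻¹ := by
    have : ∑' j, psiDAR δ α r ((n+(j+1) : ℕ)) ≤ ∑' j : ℕ, p * y * y ^ j := by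
      refine Summable.tsum_le_tsum (fun j => ?_) ((summable_nat_add_iff 1).2 ps) (sg0.mul_left _)
      refine (psi_geo hδ hα hr1 n hn (j+1)).trans (le_of_eq ?_)
      rw [pow_succ]; ring
    rw [tsum_mul_left, tg] at this
    exact this.trans (by gcongr)
  have T1 : ∑' j, psiDAR δ α r ((n+(2*n+j) : ℕ)) ≤ p * y^(2*n) * (1 - ρ)⁻¹ := by
    have : ∑' j, psiDAR δ α r ((n+(2*n+j) : ℕ)) ≤ ∑' j : ℕ, p * y^(2*n) * y ^ j := by
      refine Summable.tsum_le_tsum (fun j => ?_) ?_ (sg0.mul_left _)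
      · refine (psi_geo hδ hα hr1 n hn (2*n+j)).trans (le_of_eq ?_)
        rw [pow_add]; ring
      · simpa [add_comm] using (summable_nat_add_iff (2*n)).2 ps
    rw [tsum_mul_left, tg] at this
    exact this.trans (by gcongr)
  have yn : y^(2*n) ≤ y / n * |B| := by
    have h1 : (n:ℝ) * ρ^n ≤ B := hB ⟨n, rfl⟩
    have h2 := le_abs_self B
    have h3 : y^(2*n) ≤ y * y^n := by
      rw [← pow_succ']
      exact pow_le_pow_of_le_one hy0.le hy1.le (by omega)
    have h4 : y^n ≤ ρ^n := by gcongr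
    rw [div_mul_eq_mul_div, le_div_iff₀ hn0]
    calc y^(2*n) * n ≤ y * ρ^n * n := by gcongr; exact h3.trans (by gcongr)
      _ = y * (n * ρ^n) := by ring
      _ ≤ y * |B| := by gcongr; linarith
  calc _ ≤ p * (y / n * |B|) * (1 - ρ)⁻¹ + (p * y * (1 - ρ)⁻¹) / n := by
        gcongr; exact T1.trans (by gcongr)
    _ = (|B| + 1) / (1 - ρ) * p * (y / n) := by field_simp
    _ ≤ _ := by
      have : 0 ≤ (|B| + 1) / (1 - ρ) := div_nonneg (by positivity) (by linarith)
      gcongr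


lemma diff_lt1 {r : ℝ} (hr : 0 < r) (hr1 : r < 1) (n : ℕ) (hn : 1 ≤ n) (j : ℕ) (hj : j ≤ n) :
    r * (n:ℝ)^r / (2 * n) * j ≤ ((n+j:ℕ):ℝ)^r - (n:ℝ)^r := by
  have hn' : (0:ℝ) < n := by exact_mod_cast hn
  have hj0 : (0:ℝ) ≤ j := Nat.cast_nonneg j
  have hjn : (j:ℝ) ≤ n := by exact_mod_cast hj
  have hN : (0:ℝ) < n + j := by linarith
  have hs : (j:ℝ)/(n+j) ≤ 1 := by rw [div_le_one hN]; linarith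
  have h := rpow_one_add_le_one_add_mul_self (s := -((j:ℝ)/(n+j))) (by linarith) hr.le hr1.le
  have e : (n:ℝ)^r = ((n:ℝ)+j)^r * (1 + -((j:ℝ)/(n+j)))^r := by
    rw [← Real.mul_rpow hN.le (by linarith)]
    congr 1
    field_simp; ring
  have h2 := mul_le_mul_of_nonneg_left h (by positivity : 0 ≤ ((n:ℝ)+j)^r)
  rw [← e] at h2
  have h3 : r * (n:ℝ)^r / (2 * n) * j ≤ r * ((n:ℝ)+j)^r / (n+j) * j := by
    gcongr <;> linarith
  have h4 : ((n:ℝ)+j)^r * (1 + r * -((j:ℝ)/(n+j))) = ((n:ℝ)+j)^r - r * ((n:ℝ)+j)^r / (n+j) * j := by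
    field_simp
    ring
  push_cast
  linarith

lemma diff_lt2 {r : ℝ} (hr : 0 < r) (n : ℕ) (j : ℕ) (hj : n ≤ j) :
    (1 - (1/2:ℝ)^r) * ((n+j:ℕ):ℝ)^r ≤ ((n+j:ℕ):ℝ)^r - (n:ℝ)^r := by
  have hjn : (n:ℝ) ≤ j := by exact_mod_cast hj
  have h : (n:ℝ)^r ≤ (1/2 * ((n+j:ℕ):ℝ))^r :=
    Real.rpow_le_rpow (by positivity) (by push_cast; linarith) hr.le
  rw [Real.mul_rpow (by norm_num) (by positivity)] at h
  linarith

lemma est_lt {δ α r : ℝ} (hδ : 0 ≤ δ) (hα : 0 < α) (hr : 0 < r) (hr1 : r < 1) :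
    ∃ K > 0, ∀ n : ℕ, 1 ≤ n →
      (∑' j, psiDAR δ α r ((n+(2*n+j) : ℕ))) + (∑' j, psiDAR δ α r ((n+(j+1) : ℕ))) / n ≤
        K * psiDAR δ α r n * gammaAR α r n := by
  have hc : 0 < 1 - (1/2:ℝ)^r := by
    have := Real.rpow_lt_one (by norm_num : (0:ℝ) ≤ 1/2) (by norm_num) hr
    linarith
  set c := 1 - (1/2:ℝ)^r with hcd
  obtain ⟨C, hC, hdec⟩ := decay (mul_pos hα hc) hr
  set Q := ∑' j : ℕ, 1 / ((j:ℝ)+1)^2 with hQ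
  have hQ0 : 0 ≤ Q := tsum_nonneg fun j => by positivity
  refine ⟨2 + 2 * (C * Q * (r * α)), by positivity, fun n hn => ?_⟩
  have hn' : (1:ℝ) ≤ n := by exact_mod_cast hn
  have hn0 : (0:ℝ) < n := by linarith
  set p := psiDAR δ α r n with hp
  have hp0 : 0 < p := psi_pos _ _ _ hn0
  have ps := psi_summ hδ hα hr n hn
  set x := α * (r * (n:ℝ)^r / (2 * n)) with hx
  have hx0 : 0 < x := by positivity
  set y := exp (-x) with hy
  have hy0 : 0 < y := Real.exp_pos _
  have hy1 : y < 1 := by rw [hy, Real.exp_lt_one_iff]; linarith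
  have hyx : y * (1 + x) ≤ 1 := by
    have h1 := Real.add_one_le_exp x
    have h2 : y * exp x = 1 := by rw [hy, ← Real.exp_add]; simp
    nlinarith
  have far : ∀ i j : ℕ, j ≤ i → n ≤ i → psiDAR δ α r ((n+i:ℕ)) ≤ p * (C / n) * (1 / ((j:ℝ)+1)^2) := by
    intro i j hji hni
    refine (psi_ratio r hδ n hn i).trans ?_
    rw [mul_assoc]
    refine mul_le_mul_of_nonneg_left ?_ hp0.le
    have h1 : exp (-α * (((n+i:ℕ):ℝ)^r - (n:ℝ)^r)) ≤ exp (-(α * c) * ((n+i:ℕ):ℝ)^r) := by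
      rw [Real.exp_le_exp]
      have := mul_le_mul_of_nonneg_left (diff_lt2 hr n i hni) hα.le
      rw [← hcd] at this
      nlinarith
    refine h1.trans ((hdec (n+i)).trans ?_)
    have hji' : (j:ℝ) ≤ i := by exact_mod_cast hji
    have hj0 : (0:ℝ) ≤ j := Nat.cast_nonneg j
    rw [div_mul_div_comm, mul_one]
    push_cast
    have h2 : (n:ℝ) * ((j:ℝ)+1)^2 ≤ ((n:ℝ)+i+1)^4 := by
      calc (n:ℝ) * ((j:ℝ)+1)^2 ≤ ((n:ℝ)+i+1)^2 * ((n:ℝ)+i+1)^2 := by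
            gcongr
            · nlinarith
            · linarith
        _ = _ := by ring
    gcongr
  have near : ∀ i : ℕ, i ≤ n → psiDAR δ α r ((n+i:ℕ)) ≤ p * y^i := by
    intro i hi
    refine (psi_ratio r hδ n hn i).trans ?_
    refine mul_le_mul_of_nonneg_left ?_ hp0.le
    rw [hy, ← Real.exp_nat_mul, Real.exp_le_exp]
    have := mul_le_mul_of_nonneg_left (diff_lt1 hr hr1 n hn i hi) hα.le
    rw [← mul_assoc, ← hx] at this
    linarith
  have sg0 := summable_geometric_of_lt_one hy0.le hy1
  have tg := tsum_geometric_of_lt_one hy0.le hy1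
  have T1 : ∑' j, psiDAR δ α r ((n+(2*n+j) : ℕ)) ≤ p * (C / n) * Q := by
    rw [hQ, ← tsum_mul_left]
    refine Summable.tsum_le_tsum (fun j => far _ _ (by omega) (by omega)) ?_ (summ_sq.mul_left _)
    simpa [add_comm] using (summable_nat_add_iff (2*n)).2 ps
  have S1 : ∑' j, psiDAR δ α r ((n+(j+1) : ℕ)) ≤ p * y * (1-y)⁻¹ + p * (C / n) * Q := by
    rw [hQ, ← tg, ← tsum_mul_left, ← tsum_mul_left,
      ← (sg0.mul_left (p*y)).tsum_add (summ_sq.mul_left (p * (C/n)))]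
    refine Summable.tsum_le_tsum (fun j => ?_) ((summable_nat_add_iff 1).2 ps)
      ((sg0.mul_left (p*y)).add (summ_sq.mul_left (p * (C/n))))
    rcases le_total (j+1) n with h | h
    · have h1 := near (j+1) h
      have h2 : p * y^(j+1) = p * y * y^j := by ring
      have h3 : 0 ≤ p * (C / n) * (1 / ((j:ℝ)+1)^2) := by positivity
      linarith
    · have h1 := far (j+1) j (by omega) h
      have h3 : 0 ≤ p * y * y^j := by positivity
      linarith
  have g1 : y * (1-y)⁻¹ ≤ 1 / x := by
    rw [← div_eq_mul_inv, div_le_div_iff₀ (by linarith) hx0]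
    linarith
  have hγ : gammaAR α r n = 1 / (r * α * (n:ℝ)^r) := by
    unfold gammaAR; rw [if_pos hr1]
  set g := gammaAR α r n
  have hnr : 0 < (n:ℝ)^r := by positivity
  have hxg : 1 / x = 2 * n * g := by
    rw [hγ, hx]; field_simp
  have hgn : 1 / (n:ℝ) ≤ r * α * g := by
    have : r * α * g = 1 / (n:ℝ)^r := by rw [hγ]; field_simp
    rw [this]
    have h2 : (n:ℝ)^r ≤ n := by
      simpa using Real.rpow_le_rpow_of_exponent_le hn' hr1.le
    gcongr
  have hA : p * (C / n) * Q ≤ p * (C * Q * (r * α)) * g := by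
    calc p * (C / n) * Q = p * C * Q * (1 / n) := by ring
      _ ≤ p * C * Q * (r * α * g) := by gcongr
      _ = _ := by ring
  have hA0 : 0 ≤ p * (C / n) * Q := by positivity
  have hS : (∑' j, psiDAR δ α r ((n+(j+1) : ℕ))) / n ≤ p * 2 * g + p * (C / n) * Q := by
    rw [div_le_iff₀ hn0]
    have h1 : p * y * (1-y)⁻¹ ≤ p * (2 * n * g) := by
      rw [mul_assoc, ← hxg]; gcongr
    nlinarith
  linarith

lemma est_all {δ α r : ℝ} (hδ : 0 ≤ δ) (hα : 0 < α) (hr : 0 < r) :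
    ∃ K > 0, ∀ n : ℕ, 1 ≤ n →
      (∑' j, psiDAR δ α r ((n+(2*n+j) : ℕ))) + (∑' j, psiDAR δ α r ((n+(j+1) : ℕ))) / n ≤
        K * psiDAR δ α r n * gammaAR α r n := by
  rcases lt_or_ge r 1 with h | h
  · exact est_lt hδ hα hr h
  · exact est_ge hδ hα h

lemma conv_all {δ α r : ℝ} (hδ : 0 ≤ δ) (hα : 0 < α) (hr : 0 < r) :
    ∃ n₀ : ℕ, 1 ≤ n₀ ∧ ∀ k : ℕ, n₀ ≤ k →
      2 * psiDAR δ α r ((k+1:ℕ)) ≤ psiDAR δ α r k + psiDAR δ α r ((k+2:ℕ)) := by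
  rcases lt_or_ge 1 r with h | h
  · exact conv_gt_one hδ hα h
  · exact ⟨1, le_rfl, fun k hk => conv_le_one hδ hα hr h k hk⟩

/-- Corollary 1 (integral metric): for `ψ(t) = t^{−δ}e^{−αt^r}` and convex `ω`,
`E_n(L^ψ_β H_{ω_{L₁}})_{L₁} = ψ(n)((2/π) e_n(ω) + O(1) γ_n(α,r) ω(1/n))`. -/
theorem statement8 (δ α r : ℝ) (hδ : 0 ≤ δ) (hα : 0 < α) (hr : 0 < r) :
    ∃ K : ℝ, 0 < K ∧ ∃ n₀ : ℕ, ∀ β : ℝ, ∀ ω : ℝ → ℝ,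
      IsModulus ω → ConcaveOn ℝ (Set.Ici 0) ω → ∀ n : ℕ, n₀ ≤ n →
      |EnL1Class n (L1Class (psiDAR δ α r) β ω) -
          (2 / π) * psiDAR δ α r n * eN n ω| ≤
        K * psiDAR δ α r n * gammaAR α r n * ω (1 / n) := by
  obtain ⟨K, hK, hest⟩ := est_all hδ hα hr
  obtain ⟨N, hN1, hconv⟩ := conv_all hδ hα hr
  refine ⟨4000 * K, by positivity, N + 1, fun β ω hω hc n hn => ?_⟩
  obtain ⟨m, rfl⟩ : ∃ m, n = m + 1 := ⟨n - 1, by omega⟩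
  have hg := psi_good hδ hα hr (m+1) (by omega) (fun k hk => hconv k (by omega))
  have hs : Summable fun k : ℕ => psiDAR δ α r ((k:ℝ)+1) := by
    have := psi_summ hδ hα hr 1 le_rfl
    refine this.congr fun k => ?_
    push_cast
    rw [add_comm]
  have h := core β m (by omega) (fun k => (psi_pos δ α r (by positivity)).le) hs hg hω hc
  refine h.trans ?_
  have hw : 0 ≤ ω (1 / (m+1:ℕ)) := hω.2.2.2.2 _ (by positivity)
  refine mul_le_mul_of_nonneg_right ?_ hw
  have := hest (m+1) (by omega)
  linarith
end
end

section
/- There exists an absolute constant A>0 such that for every ψ∈𝔐_∞^+ and every n∈ℕ, the series ∑_{k=1}^∞ kψ(n+k) sin kt converges to a function g_n(t), and ∫_0^{2π}|g_n(t)|dt ≤ A·∑_{k=1}^∞ψ(n+k). Consequently the total variation of the kernel Ψ_n(t)=ψ(n)/2+∑_{k=1}^∞ψ(n+k)cos kt over [0,2π] is at most A·∑_{k=1}^∞ψ(n+k). -/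
open Real MeasureTheory Filter

noncomputable section

/-- `ψ` belongs to `𝔐_∞^+`, where `η t = ψ⁻¹(ψ t / 2)` (i.e. `η t ≥ t` and
`ψ (η t) = ψ t / 2`) and `μ t = t / (η t − t)` is nondecreasing and tends to `∞`. -/
def IsMInfPlus (ψ η : ℝ → ℝ) : Prop :=
  (∀ t ≥ (1:ℝ), 0 < ψ t) ∧ ContinuousOn ψ (Set.Ici 1) ∧
  ConvexOn ℝ (Set.Ici 1) ψ ∧ Tendsto ψ atTop (nhds 0) ∧
  (∀ t ≥ (1:ℝ), t < η t ∧ ψ (η t) = ψ t / 2) ∧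
  MonotoneOn (fun t => t / (η t - t)) (Set.Ici 1) ∧
  Tendsto (fun t => t / (η t - t)) atTop atTop


/-- The kernel `Ψ_n(t) = ψ(n)/2 + ∑_{k=1}^∞ ψ(n+k) cos kt`. -/
def PsiN (ψ : ℝ → ℝ) (n : ℕ) (t : ℝ) : ℝ :=
  ψ n / 2 + ∑' k : ℕ, ψ ((n : ℝ) + k + 1) * Real.cos ((k + 1) * t)


lemma abel_id (a s : ℕ → ℝ) (K : ℕ) :
    ∑ k ∈ Finset.range K, a k * s k =
      ∑ k ∈ Finset.range K, (a k - 2 * a (k+1) + a (k+2)) *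
          (∑ j ∈ Finset.range (k+2), ∑ i ∈ Finset.range j, s i)
        + (a K - a (K+1)) * (∑ j ∈ Finset.range (K+1), ∑ i ∈ Finset.range j, s i)
        + a K * ∑ i ∈ Finset.range K, s i := by
  induction K with
  | zero => simp
  | succ K ih =>
    have h1 := Finset.sum_range_succ (fun k => (a k - 2 * a (k+1) + a (k+2)) *
          (∑ j ∈ Finset.range (k+2), ∑ i ∈ Finset.range j, s i)) K
    have h2 := Finset.sum_range_succ (fun j => ∑ i ∈ Finset.range j, s i) (K+1)
    have h3 := Finset.sum_range_succ s K
    rw [Finset.sum_range_succ, ih, h1, h2, h3]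
    ring

lemma int_cos_nat (j l : ℕ) :
    ∫ t in (0:ℝ)..(2*π), cos (((j:ℝ) - l) * t) = if j = l then 2 * π else 0 := by
  split_ifs with h
  · subst h; simp
  · have h' : ((j:ℝ) - l) ≠ 0 := by
      rw [sub_ne_zero]; exact_mod_cast h
    rw [intervalIntegral.integral_comp_mul_left (fun x => cos x) h', integral_cos]
    have : sin (((j:ℝ) - l) * (2 * π)) = 0 := by
      have := Real.sin_int_mul_pi (2 * ((j:ℤ) - l))
      push_cast at this
      rw [← this]; ring_nf
    simp [this]

def PP (c : ℕ → ℝ) (N : ℕ) (t : ℝ) : ℝ := ∑ j ∈ Finset.range N, c j * cos (j * t)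
def QQ (c : ℕ → ℝ) (N : ℕ) (t : ℝ) : ℝ := ∑ j ∈ Finset.range N, c j * sin (j * t)

lemma PP_cont (c : ℕ → ℝ) (N : ℕ) : Continuous (PP c N) := by unfold PP; fun_prop
lemma QQ_cont (c : ℕ → ℝ) (N : ℕ) : Continuous (QQ c N) := by unfold QQ; fun_prop

lemma parseval (c : ℕ → ℝ) (N : ℕ) :
    ∫ t in (0:ℝ)..(2*π), (PP c N t ^ 2 + QQ c N t ^ 2) = 2 * π * ∑ j ∈ Finset.range N, c j ^ 2 := by
  have h : ∀ t, PP c N t ^ 2 + QQ c N t ^ 2 =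
      ∑ j ∈ Finset.range N, ∑ l ∈ Finset.range N, c j * c l * cos (((j:ℝ) - l) * t) := by
    intro t
    unfold PP QQ
    rw [sq, sq, Finset.sum_mul_sum, Finset.sum_mul_sum, ← Finset.sum_add_distrib]
    refine Finset.sum_congr rfl fun j _ => ?_
    rw [← Finset.sum_add_distrib]
    refine Finset.sum_congr rfl fun l _ => ?_
    rw [sub_mul, cos_sub]; ring
  simp_rw [h]
  rw [intervalIntegral.integral_finsetSum]
  · rw [Finset.mul_sum]
    refine Finset.sum_congr rfl fun j hj => ?_
    rw [intervalIntegral.integral_finsetSum]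
    · simp_rw [intervalIntegral.integral_const_mul, int_cos_nat]
      simp only [mul_ite, mul_zero, Finset.sum_ite_eq, hj, if_true]
      ring
    · intro l _
      exact Continuous.intervalIntegrable (by fun_prop) _ _
  · intro l _
    exact Continuous.intervalIntegrable (by fun_prop) _ _

def ss (t : ℝ) (k : ℕ) : ℝ := ((k:ℝ) + 1) * sin ((k + 1) * t)
def UU (N : ℕ) (t : ℝ) : ℝ := ∑ j ∈ Finset.range N, ∑ i ∈ Finset.range j, ss t i

lemma UU_cont (N : ℕ) : Continuous (UU N) := by unfold UU ss; fun_prop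

lemma UU_eq (N : ℕ) (t : ℝ) :
    UU N t = PP (fun _ => 1) N t * QQ (fun j => j) N t - QQ (fun _ => 1) N t * PP (fun j => j) N t := by
  induction N with
  | zero => simp [UU, PP, QQ]
  | succ N ih =>
    have key : ∑ i ∈ Finset.range N, ss t i =
        ∑ l ∈ Finset.range N, ((N:ℝ) - l) * sin (((N:ℝ) - l) * t) := by
      rw [← Finset.sum_range_reflect]
      refine Finset.sum_congr rfl fun l hl => ?_
      have : l < N := Finset.mem_range.mp hl
      have h2 : ((N - 1 - l : ℕ) : ℝ) + 1 = N - l := by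
        have : N - 1 - l + 1 + l = N := by omega
        have h3 : ((N - 1 - l + 1 + l : ℕ) : ℝ) = N := by rw [this]
        push_cast at h3 ⊢
        linarith
      unfold ss
      rw [h2]
    have e : ∑ l ∈ Finset.range N, ((N:ℝ) - l) * sin (((N:ℝ) - l) * t) =
        PP (fun _ => 1) N t * (N * sin (N * t)) - QQ (fun _ => 1) N t * (N * cos (N * t))
        - PP (fun j => j) N t * sin (N * t) + QQ (fun j => j) N t * cos (N * t) := by
      unfold PP QQ
      simp only [Finset.sum_mul]
      rw [← Finset.sum_sub_distrib, ← Finset.sum_sub_distrib, ← Finset.sum_add_distrib]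
      refine Finset.sum_congr rfl fun l _ => ?_
      rw [sub_mul (N:ℝ) l t, sin_sub]; ring
    have hU : UU (N+1) t = UU N t + ∑ i ∈ Finset.range N, ss t i := by
      unfold UU; rw [Finset.sum_range_succ]
    have hP : ∀ c, PP c (N+1) t = PP c N t + c N * cos (N * t) := by
      intro c; unfold PP; rw [Finset.sum_range_succ]
    have hQ : ∀ c, QQ c (N+1) t = QQ c N t + c N * sin (N * t) := by
      intro c; unfold QQ; rw [Finset.sum_range_succ]
    rw [hU, key, e, ih, hP, hQ, hP, hQ]
    ring

lemma UU_int (N : ℕ) (hN : 0 < N) : ∫ t in (0:ℝ)..(2*π), |UU N t| ≤ 2 * π * (N:ℝ)^2 := by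
  have hN' : (0:ℝ) < N := by exact_mod_cast hN
  have hp : ∀ t, |UU N t| ≤ (N:ℝ)/2 * (PP (fun _ => 1) N t ^ 2 + QQ (fun _ => 1) N t ^ 2) +
      1 / (2 * N) * (PP (fun j => j) N t ^ 2 + QQ (fun j => j) N t ^ 2) := by
    intro t
    rw [UU_eq]
    generalize PP (fun _ => 1) N t = p
    generalize QQ (fun _ => 1) N t = q
    generalize PP (fun j => j) N t = r
    generalize QQ (fun j => j) N t = s
    have e1 : (N:ℝ)/2 * (p^2+q^2) + 1/(2*N) * (r^2+s^2) - (p*s - q*r) = 1/(2*N) * ((N*p - s)^2 + (N*q+r)^2) := by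
      field_simp; ring
    have e2 : (N:ℝ)/2 * (p^2+q^2) + 1/(2*N) * (r^2+s^2) + (p*s - q*r) = 1/(2*N) * ((N*p + s)^2 + (N*q-r)^2) := by
      field_simp; ring
    have h1 : 0 ≤ 1/(2*N) * ((N*p - s)^2 + (N*q+r)^2) := by positivity
    have h2 : 0 ≤ 1/(2*N) * ((N*p + s)^2 + (N*q-r)^2) := by positivity
    rw [abs_le]; constructor <;> linarith
  have c1 := PP_cont (fun _ => 1) N
  have c2 := QQ_cont (fun _ => 1) N
  have c3 := PP_cont (fun j => j) N
  have c4 := QQ_cont (fun j => j) N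
  have cU := UU_cont N
  have h1 : ∫ t in (0:ℝ)..(2*π), |UU N t| ≤ ∫ t in (0:ℝ)..(2*π), ((N:ℝ)/2 * (PP (fun _ => 1) N t ^ 2 + QQ (fun _ => 1) N t ^ 2) +
      1 / (2 * N) * (PP (fun j => j) N t ^ 2 + QQ (fun j => j) N t ^ 2)) := by
    apply intervalIntegral.integral_mono_on (by positivity)
    · exact Continuous.intervalIntegrable (by fun_prop) _ _
    · exact Continuous.intervalIntegrable (by fun_prop) _ _
    · intro t _; exact hp t
  rw [intervalIntegral.integral_add, intervalIntegral.integral_const_mul, intervalIntegral.integral_const_mul,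
    parseval, parseval] at h1
  · have h2 : ∑ j ∈ Finset.range N, (j:ℝ)^2 ≤ N * (N:ℝ)^2 := by
      calc _ ≤ ∑ j ∈ Finset.range N, (N:ℝ)^2 := by
            refine Finset.sum_le_sum fun j hj => ?_
            have : (j:ℝ) ≤ N := by exact_mod_cast (Finset.mem_range.mp hj).le
            gcongr
        _ = _ := by simp
    simp only [one_pow, Finset.sum_const, Finset.card_range, nsmul_eq_mul, mul_one] at h1
    calc _ ≤ _ := h1
      _ ≤ (N:ℝ)/2 * (2*π*N) + 1/(2*N) * (2*π*(N * (N:ℝ)^2)) := by gcongr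
      _ = _ := by field_simp; ring
  · exact Continuous.intervalIntegrable (by fun_prop) _ _
  · exact Continuous.intervalIntegrable (by fun_prop) _ _

lemma antitone_psi {ψ : ℝ → ℝ} (hpos : ∀ t ≥ (1:ℝ), 0 < ψ t) (hc : ConvexOn ℝ (Set.Ici 1) ψ)
    (h0 : Tendsto ψ atTop (nhds 0)) : AntitoneOn ψ (Set.Ici 1) := by
  intro x hx y hy hxy
  by_contra! hlt
  have hxy' : x < y := lt_of_le_of_ne hxy (by rintro rfl; exact lt_irrefl _ hlt)
  have : ∀ z, y < z → ψ y ≤ ψ z := by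
    intro z hz
    have h := hc.le_max_of_mem_Icc (x := x) (y := z) (z := y) hx (le_trans hy hz.le) ⟨hxy, hz.le⟩
    rcases le_max_iff.mp h with h | h
    · linarith
    · exact h
  have h2 : ψ y ≤ 0 := ge_of_tendsto h0 ((eventually_gt_atTop y).mono this)
  linarith [hpos y hy]

lemma decay_s17 {ψ η : ℝ → ℝ} (h : IsMInfPlus ψ η) : ∃ C, 0 ≤ C ∧ ∀ t ≥ (1:ℝ), ψ t * t^4 ≤ C := by
  obtain ⟨hpos, -, hc, h0, hη, -, hμ⟩ := h
  have ha := antitone_psi hpos hc h0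
  obtain ⟨t1, ht1⟩ := eventually_atTop.mp (hμ.eventually_ge_atTop 8)
  set t0 := max t1 1
  have ht0 : 1 ≤ t0 := le_max_right _ _
  have step : ∀ t ≥ t0, ψ (9/8 * t) ≤ ψ t / 2 := by
    intro t ht
    have h1 : 1 ≤ t := ht0.trans ht
    have := ht1 t ((le_max_left _ _).trans ht)
    obtain ⟨h2, h3⟩ := hη t h1
    rw [le_div_iff₀ (by linarith)] at this
    rw [← h3]
    apply ha
    · simp only [Set.mem_Ici]; linarith
    · simp only [Set.mem_Ici]; linarith
    · linarith
  have dbl : ∀ t ≥ t0, ψ (2 * t) ≤ ψ t / 16 := by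
    intro t ht
    have s1 := step t ht
    have s2 := step (9/8*t) (by linarith)
    have s3 := step (9/8*(9/8*t)) (by linarith)
    have s4 := step (9/8*(9/8*(9/8*t))) (by linarith)
    have : ψ (2*t) ≤ ψ (9/8*(9/8*(9/8*(9/8*t)))) := by
      apply ha
      · simp only [Set.mem_Ici]; linarith
      · simp only [Set.mem_Ici]; linarith
      · linarith
    linarith
  have h1pos := hpos 1 le_rfl
  refine ⟨ψ 1 * (2*t0)^4, by positivity, ?_⟩
  have base : ∀ t ≥ (1:ℝ), t ≤ 2 * t0 → ψ t * t^4 ≤ ψ 1 * (2*t0)^4 := by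
    intro t ht ht'
    have : ψ t ≤ ψ 1 := ha (by simp) ht ht
    gcongr
  have ind : ∀ m : ℕ, ∀ t ≥ (1:ℝ), t ≤ 2^m * (2*t0) → ψ t * t^4 ≤ ψ 1 * (2*t0)^4 := by
    intro m
    induction m with
    | zero => intro t ht h; exact base t ht (by simpa using h)
    | succ m ih =>
      intro t ht h
      by_cases hh : t ≤ 2 * t0
      · exact base t ht hh
      · push Not at hh
        have h1 := ih (t/2) (by linarith) (by rw [pow_succ] at h; linarith)
        have h2 := dbl (t/2) (by linarith)
        rw [mul_div_cancel₀ _ (two_ne_zero)] at h2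
        calc ψ t * t^4 ≤ ψ (t/2) / 16 * t^4 := by gcongr
          _ = ψ (t/2) * (t/2)^4 := by ring
          _ ≤ _ := h1
  intro t ht
  obtain ⟨m, hm⟩ := pow_unbounded_of_one_lt t (one_lt_two)
  refine ind m t ht (hm.le.trans ?_)
  have : (0:ℝ) < 2^m := by positivity
  nlinarith

lemma ss_bound {x : ℝ} (hx : 0 ≤ x) (t : ℝ) (k : ℕ) : ‖x * ss t k‖ ≤ x * ((k:ℝ) + 1) := by
  have hk : (0:ℝ) ≤ (k:ℝ) + 1 := by positivity
  rw [norm_mul, Real.norm_of_nonneg hx]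
  refine mul_le_mul_of_nonneg_left ?_ hx
  unfold ss
  rw [norm_mul, Real.norm_of_nonneg hk]
  exact mul_le_of_le_one_right hk (Real.abs_sin_le_one _)

lemma summ_b {a : ℕ → ℝ} {C : ℝ} (hC : 0 ≤ C) (ha0 : ∀ k, 0 ≤ a k)
    (hdec : ∀ k : ℕ, a k * ((k:ℝ)+1)^4 ≤ C) : Summable (fun k => a k * ((k:ℝ)+1)) := by
  have h2 : Summable (fun k : ℕ => C * (1 / (((k+1 : ℕ)):ℝ)^2)) :=
    ((summable_nat_add_iff 1).mpr (Real.summable_one_div_nat_pow.mpr one_lt_two)).mul_left C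
  refine Summable.of_nonneg_of_le (fun k => mul_nonneg (ha0 k) (by positivity)) (fun k => ?_) h2
  have hk : (0:ℝ) < (k:ℝ) + 1 := by positivity
  have hk1 : (1:ℝ) ≤ (k:ℝ) + 1 := by have : (0:ℝ) ≤ k := by positivity
                                     linarith
  push_cast
  rw [mul_one_div, le_div_iff₀ (by positivity)]
  refine le_trans ?_ (hdec k)
  rw [mul_assoc]
  refine mul_le_mul_of_nonneg_left ?_ (ha0 k)
  rw [← pow_succ']
  exact pow_le_pow_right₀ hk1 (by norm_num)

lemma summ_a {a : ℕ → ℝ} (ha0 : ∀ k, 0 ≤ a k)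
    (hs : Summable (fun k => a k * ((k:ℝ)+1))) : Summable a := by
  refine Summable.of_nonneg_of_le ha0 (fun k => ?_) hs
  have : (0:ℝ) ≤ k := by positivity
  nlinarith [ha0 k]

lemma g_cont {a : ℕ → ℝ} (ha0 : ∀ k, 0 ≤ a k)
    (hs : Summable (fun k => a k * ((k:ℝ)+1))) : Continuous (fun t => ∑' k, a k * ss t k) := by
  refine continuous_tsum (fun k => ?_) hs (fun k t => ss_bound (ha0 k) t k)
  unfold ss; fun_prop

lemma tend_b {a : ℕ → ℝ} {C : ℝ} (ha0 : ∀ k, 0 ≤ a k)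
    (hdec : ∀ k : ℕ, a k * ((k:ℝ)+1)^4 ≤ C) : Tendsto (fun K : ℕ => a K * ((K:ℝ)+1)^2) atTop (nhds 0) := by
  have h2 : Tendsto (fun k : ℕ => C * (1 / ((k:ℝ) + 1))) atTop (nhds 0) := by
    simpa using (tendsto_one_div_add_atTop_nhds_zero_nat (𝕜 := ℝ)).const_mul C
  refine squeeze_zero (fun k => mul_nonneg (ha0 k) (by positivity)) (fun k => ?_) h2
  have hk : (0:ℝ) < (k:ℝ) + 1 := by positivity
  have hk1 : (1:ℝ) ≤ (k:ℝ) + 1 := by have : (0:ℝ) ≤ k := by positivity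
                                     linarith
  rw [mul_one_div, le_div_iff₀ (by positivity)]
  refine le_trans ?_ (hdec k)
  rw [mul_assoc]
  refine mul_le_mul_of_nonneg_left ?_ (ha0 k)
  rw [← pow_succ]
  exact pow_le_pow_right₀ hk1 (by norm_num)

lemma e_sum {a : ℕ → ℝ} (ha0 : ∀ k, 0 ≤ a k) (hm : ∀ k, a (k+1) ≤ a k) (hsa : Summable a)
    (hcv : ∀ k, 0 ≤ a k - 2 * a (k+1) + a (k+2)) (K : ℕ) :
    ∑ k ∈ Finset.range K, (a k - 2 * a (k+1) + a (k+2)) * ((k:ℝ)+2)^2 ≤ 4 * ∑' k, a k := by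
  have h := abel_id a (fun _ => 2) K
  have hin : ∀ N : ℕ, ∑ j ∈ Finset.range (N+1), ∑ i ∈ Finset.range j, (2:ℝ) = (N:ℝ) * (N+1) := by
    intro N
    induction N with
    | zero => simp
    | succ N ih => rw [Finset.sum_range_succ, ih]; simp; ring
  have h3 : ∑ k ∈ Finset.range K, (a k - 2 * a (k+1) + a (k+2)) * ((k:ℝ)+2)^2 ≤
      2 * ∑ k ∈ Finset.range K, (a k - 2 * a (k+1) + a (k+2)) *
          (∑ j ∈ Finset.range (k+2), ∑ i ∈ Finset.range j, 2) := by
    rw [Finset.mul_sum]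
    refine Finset.sum_le_sum fun k _ => ?_
    rw [hin (k+1)]
    push_cast
    have : (0:ℝ) ≤ k := by positivity
    have h4 : ((k:ℝ)+2)^2 ≤ 2 * (((k:ℝ)+1) * (k+1+1)) := by nlinarith
    nlinarith [mul_le_mul_of_nonneg_left h4 (hcv k)]
  have h5 : 0 ≤ (a K - a (K+1)) * (∑ j ∈ Finset.range (K+1), ∑ i ∈ Finset.range j, (2:ℝ)) :=
    mul_nonneg (sub_nonneg.mpr (hm K)) (by rw [hin]; positivity)
  have h6 : 0 ≤ a K * ∑ i ∈ Finset.range K, (2:ℝ) := mul_nonneg (ha0 K) (by simp)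
  have h7 := hsa.sum_le_tsum (Finset.range K) (fun k _ => ha0 k)
  rw [← Finset.sum_mul] at h
  linarith

lemma S_int (K : ℕ) : ∫ t in (0:ℝ)..(2*π), |∑ i ∈ Finset.range K, ss t i| ≤ 2 * π * ((K:ℝ)+1)^2 := by
  have h1 : ∫ t in (0:ℝ)..(2*π), |∑ i ∈ Finset.range K, ss t i| ≤ ∫ t in (0:ℝ)..(2*π), ((K:ℝ)+1)^2 := by
    apply intervalIntegral.integral_mono_on (by positivity)
    · exact Continuous.intervalIntegrable (by unfold ss; fun_prop) _ _
    · exact Continuous.intervalIntegrable (by fun_prop) _ _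
    · intro t _
      calc |∑ i ∈ Finset.range K, ss t i| ≤ ∑ i ∈ Finset.range K, |ss t i| := Finset.abs_sum_le_sum_abs _ _
        _ ≤ ∑ i ∈ Finset.range K, ((K:ℝ)+1) := by
          refine Finset.sum_le_sum fun i hi => ?_
          have h := ss_bound zero_le_one t i
          have : (i:ℝ) ≤ K := by exact_mod_cast (Finset.mem_range.mp hi).le
          simp only [one_mul, Real.norm_eq_abs] at h
          linarith
        _ ≤ _ := by simp; nlinarith [(Nat.cast_nonneg K : (0:ℝ) ≤ K)]
  refine h1.trans (le_of_eq ?_)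
  simp

lemma main_int {a : ℕ → ℝ} {C : ℝ} (hC : 0 ≤ C) (ha0 : ∀ k, 0 ≤ a k) (hm : ∀ k, a (k+1) ≤ a k)
    (hcv : ∀ k, 0 ≤ a k - 2 * a (k+1) + a (k+2))
    (hdec : ∀ k : ℕ, a k * ((k:ℝ)+1)^4 ≤ C) :
    ∫ t in (0:ℝ)..(2*π), |∑' k, a k * ss t k| ≤ 8 * π * ∑' k, a k := by
  have hs := summ_b hC ha0 hdec
  have hsa := summ_a ha0 hs
  have hg := g_cont ha0 hs
  have hpt : ∀ K : ℕ, ∀ t, |∑' k, a k * ss t k| ≤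
      (∑ k ∈ Finset.range K, (a k - 2 * a (k+1) + a (k+2)) * |UU (k+2) t|)
        + a K * |UU (K+1) t| + a K * |∑ i ∈ Finset.range K, ss t i|
        + ∑' k, a (k + K) * (((k + K : ℕ):ℝ)+1) := by
    intro K t
    have hst : Summable (fun k => a k * ss t k) :=
      Summable.of_norm_bounded hs (fun k => ss_bound (ha0 k) t k)
    rw [← hst.sum_add_tsum_nat_add K]
    have htail : |∑' k, a (k+K) * ss t (k+K)| ≤ ∑' k, a (k + K) * (((k + K : ℕ):ℝ)+1) := by
      rw [← Real.norm_eq_abs]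
      exact tsum_of_norm_bounded ((summable_nat_add_iff K).mpr hs).hasSum
        (fun k => ss_bound (ha0 _) t _)
    have hfin : |∑ k ∈ Finset.range K, a k * ss t k| ≤
      (∑ k ∈ Finset.range K, (a k - 2 * a (k+1) + a (k+2)) * |UU (k+2) t|)
        + a K * |UU (K+1) t| + a K * |∑ i ∈ Finset.range K, ss t i| := by
      rw [abel_id a (ss t) K]
      refine (abs_add_le _ _).trans (add_le_add ((abs_add_le _ _).trans (add_le_add ?_ ?_)) ?_)
      · refine (Finset.abs_sum_le_sum_abs _ _).trans (Finset.sum_le_sum fun k _ => ?_)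
        rw [abs_mul, abs_of_nonneg (hcv k)]; rfl
      · rw [abs_mul, abs_of_nonneg (sub_nonneg.mpr (hm K))]
        exact mul_le_mul_of_nonneg_right (by linarith [ha0 (K+1)]) (abs_nonneg _)
      · rw [abs_mul, abs_of_nonneg (ha0 K)]
    exact (abs_add_le _ _).trans (add_le_add hfin htail)
  have hK : ∀ K : ℕ, ∫ t in (0:ℝ)..(2*π), |∑' k, a k * ss t k| ≤ 8 * π * ∑' k, a k +
      4 * π * (a K * ((K:ℝ)+1)^2) + 2 * π * ∑' k, a (k + K) * (((k + K : ℕ):ℝ)+1) := by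
    intro K
    have cU := UU_cont
    have cS : Continuous fun t => ∑ i ∈ Finset.range K, ss t i := by unfold ss; fun_prop
    have i0 : ∫ t in (0:ℝ)..(2*π), |∑' k, a k * ss t k| ≤ ∫ t in (0:ℝ)..(2*π),
       ((∑ k ∈ Finset.range K, (a k - 2 * a (k+1) + a (k+2)) * |UU (k+2) t|)
        + a K * |UU (K+1) t| + a K * |∑ i ∈ Finset.range K, ss t i|
        + ∑' k, a (k + K) * (((k + K : ℕ):ℝ)+1)) := by
      apply intervalIntegral.integral_mono_on (by positivity)
      · exact Continuous.intervalIntegrable hg.abs _ _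
      · exact Continuous.intervalIntegrable (by fun_prop) _ _
      · intro t _; exact hpt K t
    rw [intervalIntegral.integral_add, intervalIntegral.integral_add, intervalIntegral.integral_add,
      intervalIntegral.integral_finsetSum] at i0
    · simp only [intervalIntegral.integral_const_mul, intervalIntegral.integral_const] at i0
      have j1 : ∑ k ∈ Finset.range K, (a k - 2 * a (k+1) + a (k+2)) * ∫ t in (0:ℝ)..(2*π), |UU (k+2) t|
          ≤ 2 * π * (4 * ∑' k, a k) := by
        calc _ ≤ ∑ k ∈ Finset.range K, 2 * π * ((a k - 2 * a (k+1) + a (k+2)) * ((k:ℝ)+2)^2) := by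
              refine Finset.sum_le_sum fun k _ => ?_
              have := UU_int (k+2) (by omega)
              push_cast at this
              calc _ ≤ (a k - 2 * a (k+1) + a (k+2)) * (2 * π * ((k:ℝ)+2)^2) :=
                    mul_le_mul_of_nonneg_left this (hcv k)
                _ = _ := by ring
          _ ≤ _ := by
              rw [← Finset.mul_sum]
              exact mul_le_mul_of_nonneg_left (e_sum ha0 hm hsa hcv K) (by positivity)
      have j2 := UU_int (K+1) (by omega)
      push_cast at j2
      have j2' := mul_le_mul_of_nonneg_left j2 (ha0 K)
      have j3' := mul_le_mul_of_nonneg_left (S_int K) (ha0 K)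
      simp only [smul_eq_mul, sub_zero] at i0
      linarith
    all_goals first
      | exact Continuous.intervalIntegrable (by fun_prop) _ _
      | (intro k _; exact Continuous.intervalIntegrable (by fun_prop) _ _)
  have ht : Tendsto (fun K : ℕ => 8 * π * ∑' k, a k +
      4 * π * (a K * ((K:ℝ)+1)^2) + 2 * π * ∑' k, a (k + K) * (((k + K : ℕ):ℝ)+1)) atTop
      (nhds (8 * π * ∑' k, a k + 4 * π * 0 + 2 * π * 0)) := by
    refine (tendsto_const_nhds.add ((tend_b ha0 hdec).const_mul _)).add (Tendsto.const_mul _ ?_)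
    exact tendsto_sum_nat_add (fun k => a k * ((k:ℝ)+1))
  have := ge_of_tendsto ht (Eventually.of_forall hK)
  simpa using this

lemma var_le {a : ℕ → ℝ} (hs : Summable (fun k => a k * ((k:ℝ)+1))) (ha0 : ∀ k, 0 ≤ a k) (c : ℝ) :
    eVariationOn (fun t => c + ∑' k : ℕ, a k * Real.cos ((k+1) * t)) (Set.Icc 0 (2*π)) ≤
      ENNReal.ofReal (∫ t in (0:ℝ)..(2*π), |∑' k, a k * ss t k|) := by
  have hsa := summ_a ha0 hs
  have hg := g_cont ha0 hs
  set g : ℝ → ℝ := fun t => ∑' k, a k * ss t k with hgdef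
  set f : ℝ → ℝ := fun t => c + ∑' k : ℕ, a k * Real.cos ((k+1) * t) with hf
  have hder : ∀ t, HasDerivAt f (-g t) t := by
    intro t
    have h := hasDerivAt_tsum (g := fun (k:ℕ) t => a k * Real.cos ((k+1) * t))
      (g' := fun k t => - (a k * ss t k)) (y₀ := 0) hs ?_ ?_ ?_ t
    · have h2 := h.const_add c
      rw [tsum_neg] at h2
      exact h2
    · intro k y
      have h1 : HasDerivAt (fun y : ℝ => ((k:ℝ)+1) * y) ((k:ℝ)+1) y := by
        simpa using (hasDerivAt_id y).const_mul ((k:ℝ)+1)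
      have := (h1.cos).const_mul (a k)
      refine this.congr_deriv ?_
      unfold ss; ring
    · intro k y
      rw [norm_neg]; exact ss_bound (ha0 k) y k
    · simpa using hsa
  set F : ℝ → ℝ := fun x => ∫ t in (0:ℝ)..x, |g t| with hF
  have hii : ∀ x y, IntervalIntegrable (fun t => |g t|) volume x y :=
    fun x y => hg.abs.intervalIntegrable x y
  have hFd : ∀ x y, F y - F x = ∫ t in x..y, |g t| := by
    intro x y
    exact intervalIntegral.integral_interval_sub_left (hii _ _) (hii _ _)
  have hfF : ∀ x y, x ≤ y → |f y - f x| ≤ F y - F x := by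
    intro x y hxy
    rw [hFd, ← intervalIntegral.integral_eq_sub_of_hasDerivAt (fun t _ => hder t)
      (hg.neg.intervalIntegrable x y)]
    refine (intervalIntegral.abs_integral_le_integral_abs hxy).trans (le_of_eq ?_)
    simp
  unfold eVariationOn
  refine iSup_le ?_
  rintro ⟨m, u, hu, hus⟩
  simp only
  have : ∀ i ∈ Finset.range m, edist (f (u (i+1))) (f (u i)) ≤ ENNReal.ofReal (F (u (i+1)) - F (u i)) := by
    intro i _
    rw [edist_dist, Real.dist_eq]
    exact ENNReal.ofReal_le_ofReal (hfF _ _ (hu (Nat.le_succ i)))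
  refine (Finset.sum_le_sum this).trans ?_
  rw [← ENNReal.ofReal_sum_of_nonneg (fun i _ => (abs_nonneg _).trans (hfF _ _ (hu (Nat.le_succ i)))),
    Finset.sum_range_sub (fun i => F (u i))]
  apply ENNReal.ofReal_le_ofReal
  have h1 : F 0 ≤ F (u 0) := by linarith [(abs_nonneg _).trans (hfF 0 (u 0) (hus 0).1)]
  have h2 : F (u m) ≤ F (2*π) := by linarith [(abs_nonneg _).trans (hfF _ _ (hus m).2)]
  have h3 : F 0 = 0 := by simp [hF]
  have : F (2*π) = ∫ t in (0:ℝ)..(2*π), |g t| := rfl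
  linarith

/-- Estimates (105)–(106): there is an absolute constant `A > 0` such that for every
`ψ ∈ 𝔐_∞^+` and `n`, the series `∑_{k=1}^∞ kψ(n+k) sin kt` converges to a function
`g_n` with `∫_0^{2π}|g_n| ≤ A ∑_{k=1}^∞ ψ(n+k)`, and the total variation of `Ψ_n`
over `[0,2π]` is at most `A ∑_{k=1}^∞ ψ(n+k)`. -/
theorem statement17 :
    ∃ A : ℝ, 0 < A ∧ ∀ ψ η : ℝ → ℝ, IsMInfPlus ψ η → ∀ n : ℕ,
      ∃ g : ℝ → ℝ,
        (∀ t : ℝ, HasSum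
          (fun k : ℕ => ((k : ℝ) + 1) * ψ ((n : ℝ) + k + 1) * Real.sin ((k + 1) * t))
          (g t)) ∧
        (∫ t in (0:ℝ)..(2 * π), |g t|) ≤ A * ∑' k : ℕ, ψ ((n : ℝ) + k + 1) ∧
        (eVariationOn (PsiN ψ n) (Set.Icc 0 (2 * π))).toReal ≤
          A * ∑' k : ℕ, ψ ((n : ℝ) + k + 1) := by
  refine ⟨8 * π, by positivity, ?_⟩
  intro ψ η h n
  obtain ⟨C, hC, hd⟩ := decay_s17 h
  obtain ⟨hpos, -, hc, h0, -, -, -⟩ := h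
  have hanti := antitone_psi hpos hc h0
  set a : ℕ → ℝ := fun k => ψ ((n:ℝ) + k + 1) with ha
  have h1 : ∀ k : ℕ, (1:ℝ) ≤ (n:ℝ) + k + 1 := by
    intro k
    have : (0:ℝ) ≤ (n:ℝ) + k := by positivity
    linarith
  have ha0 : ∀ k, 0 ≤ a k := fun k => (hpos _ (h1 k)).le
  have hm : ∀ k, a (k+1) ≤ a k := by
    intro k
    apply hanti (h1 k) (h1 (k+1))
    push_cast; linarith
  have hcv : ∀ k, 0 ≤ a k - 2 * a (k+1) + a (k+2) := by
    intro k
    have := hc.2 (h1 k) (h1 (k+2)) (by norm_num : (0:ℝ) ≤ 1/2) (by norm_num : (0:ℝ) ≤ 1/2) (by norm_num)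
    simp only [smul_eq_mul] at this
    rw [show 1/2 * ((n:ℝ) + k + 1) + 1/2 * ((n:ℝ) + ((k+2 : ℕ):ℝ) + 1) = (n:ℝ) + ((k+1:ℕ):ℝ) + 1 by
      push_cast; ring] at this
    simp only [ha]
    linarith
  have hdec : ∀ k : ℕ, a k * ((k:ℝ)+1)^4 ≤ C := by
    intro k
    refine le_trans ?_ (hd _ (h1 k))
    have := ha0 k
    have h2 : (k:ℝ) + 1 ≤ (n:ℝ) + k + 1 := by
      have : (0:ℝ) ≤ n := by positivity
      linarith
    exact mul_le_mul_of_nonneg_left (by gcongr) this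
  have hs := summ_b hC ha0 hdec
  have hI := main_int hC ha0 hm hcv hdec
  refine ⟨fun t => ∑' k, a k * ss t k, ?_, hI, ?_⟩
  · intro t
    have := (Summable.of_norm_bounded hs (fun k => ss_bound (ha0 k) t k)).hasSum
    have e : (fun k : ℕ => ((k : ℝ) + 1) * ψ ((n : ℝ) + k + 1) * Real.sin ((k + 1) * t)) =
        fun k => a k * ss t k := by
      funext k
      simp only [ha, ss]; ring
    rw [e]
    exact this
  · have hv := var_le hs ha0 (ψ n / 2)
    refine le_trans (ENNReal.toReal_le_of_le_ofReal ?_ hv) hI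
    exact intervalIntegral.integral_nonneg (by positivity) (fun _ _ => abs_nonneg _)
end
end
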